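/- arXiv:1905.08121 — 3 statements merged into one kernel-verified Lean document; each statement's English description precedes it below -/
import Mathlib

section
/- Let n ≥ 1, 1 < p < ∞, 0 < q < p−1, 0 < α < n/p, and n(p−1)/(n−αp) ≤ r < ∞, and let σ be a locally finite nonnegative Borel measure on ℝⁿ with σ ≠ 0. Then there exists a solution u, not Lebesgue-a.e. zero, of the integral equation u = W_{α,p}(u^q dσ) with u ∈ L^r_loc(ℝⁿ) (with respect to Lebesgue measure) if and only if both: (a) ∫₁^∞ [ ( σ(B(0,ρ)) / ρ^{n−αp} )^{1/(p−1)} + ( κ(B(0,ρ))^{q(p−1)/(p−1−q)} / ρ^{n−αp} )^{1/(p−1)} ] dρ/ρ < ∞, and (b) for every R > 0, ∫_{B(0,R)} sup_{0<ρ<R} ( κ(B(x,ρ))^{q(p−1)/(p−1−q)} / ρ^{n−αp} )^{r/(p−1)} dx < ∞. -/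
open MeasureTheory Metric Set
open scoped ENNReal NNReal

/-- The Wolff potential `W_{α,p}ν(x) = ∫₀^∞ (ν(B(x,ρ))/ρ^{n−αp})^{1/(p−1)} dρ/ρ`. -/
noncomputable def wolffPot (n : ℕ) (α p : ℝ)
    (ν : Measure (EuclideanSpace ℝ (Fin n))) (x : EuclideanSpace ℝ (Fin n)) : ℝ≥0∞ :=
  ∫⁻ ρ in Set.Ioi (0 : ℝ),
    (ν (Metric.ball x ρ) / ENNReal.ofReal (ρ ^ ((n : ℝ) - α * p))) ^ (1 / (p - 1)) /
      ENNReal.ofReal ρ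

/-- The least constant `κ(E)` such that
`(∫_E (W_{α,p}ν)^q dσ)^{1/q} ≤ κ · ν(ℝⁿ)^{1/(p−1)}` for all finite measures `ν`. -/
noncomputable def embC (n : ℕ) (α p q : ℝ) (σ : Measure (EuclideanSpace ℝ (Fin n)))
    (E : Set (EuclideanSpace ℝ (Fin n))) : ℝ≥0∞ :=
  sInf {κ : ℝ≥0∞ | ∀ ν : Measure (EuclideanSpace ℝ (Fin n)), IsFiniteMeasure ν →
    (∫⁻ y in E, wolffPot n α p ν y ^ q ∂σ) ^ (1 / q) ≤ κ * (ν Set.univ) ^ (1 / (p - 1))}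

/-- The intrinsic potential of Wolff type
`K_{α,p,q}σ(x) = ∫₀^∞ (κ(B(x,ρ))^{q(p−1)/(p−1−q)}/ρ^{n−αp})^{1/(p−1)} dρ/ρ`. -/
noncomputable def intK (n : ℕ) (α p q : ℝ) (σ : Measure (EuclideanSpace ℝ (Fin n)))
    (x : EuclideanSpace ℝ (Fin n)) : ℝ≥0∞ :=
  ∫⁻ ρ in Set.Ioi (0 : ℝ),
    (embC n α p q σ (Metric.ball x ρ) ^ (q * (p - 1) / (p - 1 - q)) /
      ENNReal.ofReal (ρ ^ ((n : ℝ) - α * p))) ^ (1 / (p - 1)) / ENNReal.ofReal ρ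

/-- `u` is a solution of the integral equation `u = W_{α,p}(u^q dσ)`:
`u` is Borel measurable, `u ∈ L^q_loc(σ)`, and the equation holds
`σ`-a.e. and Lebesgue-a.e. -/
def IsSolution (n : ℕ) (α p q : ℝ) (σ : Measure (EuclideanSpace ℝ (Fin n)))
    (u : EuclideanSpace ℝ (Fin n) → ℝ≥0∞) : Prop :=
  Measurable u ∧
  (∀ x : EuclideanSpace ℝ (Fin n), ∀ R : ℝ, 0 < R →
    (∫⁻ y in Metric.ball x R, u y ^ q ∂σ) < ⊤) ∧
  (∀ᵐ x ∂σ, u x = wolffPot n α p (σ.withDensity fun y => u y ^ q) x) ∧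
  (∀ᵐ x ∂(volume : Measure (EuclideanSpace ℝ (Fin n))),
    u x = wolffPot n α p (σ.withDensity fun y => u y ^ q) x)

/-! ### Elementary inequalities in `ℝ≥0∞` -/

theorem ENNReal.rpow_one_sub_mul_rpow_self (x : ℝ≥0∞) {a : ℝ} (h0 : 0 ≤ a) (h1 : a ≤ 1) :
    x ^ (1 - a) * x ^ a = x := by
  rw [← ENNReal.rpow_add_of_nonneg _ _ (by linarith) h0]
  simp

theorem ENNReal.exists_young_rpow {a : ℝ} (h0 : 0 < a) (h1 : a < 1) {η : ℝ≥0∞} (hη : η ≠ 0)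
    (hη' : η ≠ ⊤) :
    ∃ C : ℝ≥0∞, C ≠ ⊤ ∧ ∀ x y : ℝ≥0∞, x ^ (1 - a) * y ^ a ≤ η * y + C * x := by
  have h1a : 0 < 1 - a := by linarith
  set ζ : ℝ≥0∞ := η ^ (1 / (1 - a)) with hζ
  have hζ0 : ζ ≠ 0 := by simp [hζ, ENNReal.rpow_eq_zero_iff, hη, hη']
  have hζt : ζ ≠ ⊤ := by simp [hζ, ENNReal.rpow_eq_top_iff, hη, hη']
  have hζη : ζ ^ (1 - a) = η := by
    rw [hζ, ← ENNReal.rpow_mul, one_div_mul_cancel h1a.ne', ENNReal.rpow_one]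
  refine ⟨(ζ⁻¹) ^ a, ENNReal.rpow_ne_top_of_nonneg h0.le (by simpa using hζ0), fun x y => ?_⟩
  rcases le_total x (ζ * y) with h | h
  · calc x ^ (1 - a) * y ^ a ≤ (ζ * y) ^ (1 - a) * y ^ a := by gcongr
      _ = η * (y ^ (1 - a) * y ^ a) := by
        rw [ENNReal.mul_rpow_of_nonneg _ _ h1a.le, hζη, mul_assoc]
      _ = η * y := by rw [ENNReal.rpow_one_sub_mul_rpow_self y h0.le h1.le]
      _ ≤ _ := le_self_add
  · have hy : y ≤ ζ⁻¹ * x := by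
      calc y = ζ⁻¹ * (ζ * y) := by rw [← mul_assoc, ENNReal.inv_mul_cancel hζ0 hζt, one_mul]
        _ ≤ _ := by gcongr
    calc x ^ (1 - a) * y ^ a ≤ x ^ (1 - a) * (ζ⁻¹ * x) ^ a := by gcongr
      _ = (ζ⁻¹) ^ a * (x ^ (1 - a) * x ^ a) := by
        rw [ENNReal.mul_rpow_of_nonneg _ _ h0.le]; ring
      _ = (ζ⁻¹) ^ a * x := by rw [ENNReal.rpow_one_sub_mul_rpow_self x h0.le h1.le]
      _ ≤ _ := le_add_self

theorem ENNReal.add_rpow_le_two_rpow_mul (x y : ℝ≥0∞) {r : ℝ} (hr : 0 ≤ r) :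
    (x + y) ^ r ≤ 2 ^ r * (x ^ r + y ^ r) := by
  have h : x + y ≤ 2 * max x y := by
    rw [two_mul]; exact add_le_add (le_max_left _ _) (le_max_right _ _)
  calc (x + y) ^ r ≤ (2 * max x y) ^ r := by gcongr
    _ = 2 ^ r * (max x y) ^ r := ENNReal.mul_rpow_of_nonneg _ _ hr
    _ ≤ _ := by
      gcongr
      rcases max_cases x y with h | h <;> rw [h.1]
      · exact le_self_add
      · exact le_add_self

theorem ENNReal.two_rpow_ne_top (r : ℝ) : (2 : ℝ≥0∞) ^ r ≠ ⊤ := by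
  simp [ENNReal.rpow_eq_top_iff]

theorem ENNReal.le_two_mul_of_le_half_add {x y : ℝ≥0∞} (hx : x ≠ ⊤) (h : x ≤ 2⁻¹ * x + y) :
    x ≤ 2 * y := by
  have h2 : 2⁻¹ * x + 2⁻¹ * x = x := by rw [← add_mul, ENNReal.inv_two_add_inv_two, one_mul]
  have h3 : 2⁻¹ * x ≤ y := by
    have : 2⁻¹ * x + 2⁻¹ * x ≤ 2⁻¹ * x + y := by rwa [h2]
    exact (ENNReal.add_le_add_iff_left (ENNReal.mul_ne_top (by simp) hx)).1 this
  calc x = 2 * (2⁻¹ * x) := by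
        rw [← mul_assoc, ENNReal.mul_inv_cancel (by simp) (by simp), one_mul]
    _ ≤ _ := by gcongr

theorem ENNReal.iSup_rpow_const {ι : Type*} (f : ι → ℝ≥0∞) {r : ℝ} (hr : 0 < r) :
    (⨆ i, f i) ^ r = ⨆ i, f i ^ r :=
  (ENNReal.orderIsoRpow r hr).map_iSup f

/-! ### Radial potentials -/

/-- The weighted integral `∫_A φ(ρ)^s ρ^{-l} dρ/ρ` of a set of radii. -/
noncomputable def radialPot (s l : ℝ) (A : Set ℝ) (φ : ℝ → ℝ≥0∞) : ℝ≥0∞ :=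
  ∫⁻ ρ in A, φ ρ ^ s * ENNReal.ofReal (ρ ^ (-l - 1))

theorem radialPot_mono {s l : ℝ} (hs : 0 ≤ s) {A : Set ℝ} (hA : MeasurableSet A)
    {φ ψ : ℝ → ℝ≥0∞} (h : ∀ ρ ∈ A, φ ρ ≤ ψ ρ) : radialPot s l A φ ≤ radialPot s l A ψ :=
  setLIntegral_mono' hA fun ρ hρ => by gcongr; exact h ρ hρ

theorem radialPot_mono_set {s l : ℝ} {A B : Set ℝ} (h : A ⊆ B) (φ : ℝ → ℝ≥0∞) :
    radialPot s l A φ ≤ radialPot s l B φ :=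
  lintegral_mono_set h

theorem radialPot_comp_mul {s l c t : ℝ} (hc : 0 < c) (ht : 0 ≤ t) (φ : ℝ → ℝ≥0∞) :
    radialPot s l (Ioi t) (fun ρ => φ (c * ρ)) =
      ENNReal.ofReal (c ^ l) * radialPot s l (Ioi (c * t)) φ := by
  have hemb : MeasurableEmbedding (fun ρ : ℝ => c * ρ) :=
    (Homeomorph.mulLeft₀ c hc.ne').measurableEmbedding
  have hpre : (fun ρ : ℝ => c * ρ) ⁻¹' Ioi (c * t) = Ioi t := by
    ext ρ; simp only [mem_preimage, mem_Ioi]; exact mul_lt_mul_iff_right₀ hc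
  have key : ∀ f : ℝ → ℝ≥0∞, ∫⁻ ρ in Ioi t, f (c * ρ) =
      ENNReal.ofReal c⁻¹ * ∫⁻ ρ in Ioi (c * t), f ρ := by
    intro f
    have h1 := hemb.lintegral_map (μ := volume.restrict (Ioi t)) f
    rw [← hpre, ← hemb.restrict_map, Real.map_volume_mul_left hc.ne', Measure.restrict_smul, lintegral_smul_measure,
      abs_of_pos (inv_pos.2 hc)] at h1
    rw [hpre] at h1
    rw [← h1, smul_eq_mul]
  unfold radialPot
  have h2 := key (fun ρ => φ ρ ^ s * ENNReal.ofReal (ρ ^ (-l - 1)))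
  have h3 : ∫⁻ ρ in Ioi t, φ (c * ρ) ^ s * ENNReal.ofReal ((c * ρ) ^ (-l - 1)) =
      ENNReal.ofReal (c ^ (-l - 1)) *
        ∫⁻ ρ in Ioi t, φ (c * ρ) ^ s * ENNReal.ofReal (ρ ^ (-l - 1)) := by
    rw [← lintegral_const_mul' _ _ ENNReal.ofReal_ne_top]
    refine setLIntegral_congr_fun measurableSet_Ioi fun ρ hρ => ?_
    have hρ0 : 0 < ρ := lt_of_le_of_lt ht hρ
    rw [Real.mul_rpow hc.le hρ0.le, ENNReal.ofReal_mul (Real.rpow_nonneg hc.le _)]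
    ring
  have hcc : ENNReal.ofReal (c ^ (l + 1)) * ENNReal.ofReal (c ^ (-l - 1)) = 1 := by
    rw [← ENNReal.ofReal_mul (Real.rpow_nonneg hc.le _), ← Real.rpow_add hc]
    simp
  have hcd : ENNReal.ofReal (c ^ (l + 1)) * ENNReal.ofReal c⁻¹ = ENNReal.ofReal (c ^ l) := by
    rw [← ENNReal.ofReal_mul (Real.rpow_nonneg hc.le _), Real.rpow_add hc, Real.rpow_one,
      mul_assoc, mul_inv_cancel₀ hc.ne', mul_one]
  rw [h3] at h2
  calc _ = ENNReal.ofReal (c ^ (l + 1)) * (ENNReal.ofReal (c ^ (-l - 1)) *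
        ∫⁻ ρ in Ioi t, φ (c * ρ) ^ s * ENNReal.ofReal (ρ ^ (-l - 1))) := by
        rw [← mul_assoc, hcc, one_mul]
    _ = _ := by rw [h2, ← mul_assoc, hcd]

theorem lintegral_Ioi_weight {l t : ℝ} (hl : 0 < l) (ht : 0 < t) :
    ∫⁻ ρ in Ioi t, ENNReal.ofReal (ρ ^ (-l - 1)) = ENNReal.ofReal (t ^ (-l) / l) := by
  have h := integral_Ioi_rpow_of_lt (a := -l - 1) (by linarith) ht
  rw [← ofReal_integral_eq_lintegral_ofReal
    (integrableOn_Ioi_rpow_of_lt (by linarith) ht), h]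
  · congr 1
    rw [show -l - 1 + 1 = -l by ring, neg_div_neg_eq]
  · filter_upwards [ae_restrict_mem measurableSet_Ioi] with ρ hρ
    exact Real.rpow_nonneg (ht.trans hρ).le _

theorem radialPot_Ioi_const {s l t : ℝ} (hl : 0 < l) (ht : 0 < t) (c : ℝ≥0∞) :
    radialPot s l (Ioi t) (fun _ => c) = c ^ s * ENNReal.ofReal (t ^ (-l) / l) := by
  unfold radialPot
  rw [lintegral_const_mul _ (by fun_prop), lintegral_Ioi_weight hl ht]

theorem le_radialPot_Ioi {s l t : ℝ} (hs : 0 ≤ s) (hl : 0 < l) (ht : 0 < t) {φ : ℝ → ℝ≥0∞}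
    {c : ℝ≥0∞} (h : ∀ ρ, t < ρ → c ≤ φ ρ) :
    c ^ s * ENNReal.ofReal (t ^ (-l) / l) ≤ radialPot s l (Ioi t) φ := by
  rw [← radialPot_Ioi_const hl ht]
  exact radialPot_mono hs measurableSet_Ioi h

theorem radialPot_Ioi_lt_top {s l t : ℝ} (hs : 0 ≤ s) (hl : 0 < l) (ht : 0 < t)
    {φ : ℝ → ℝ≥0∞} {c : ℝ≥0∞} (hc : c ≠ ⊤) (h : ∀ ρ, t < ρ → φ ρ ≤ c) :
    radialPot s l (Ioi t) φ < ⊤ := by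
  refine (radialPot_mono hs measurableSet_Ioi h).trans_lt ?_
  rw [radialPot_Ioi_const hl ht]
  exact ENNReal.mul_lt_top (ENNReal.rpow_ne_top_of_nonneg hs hc).lt_top ENNReal.ofReal_lt_top

theorem iUnion_Ioi_add_inv (b : ℝ) : ⋃ k : ℕ, Ioi (b + 1 / ((k : ℝ) + 1)) = Ioi b := by
  ext ρ
  simp only [mem_iUnion, mem_Ioi]
  constructor
  · rintro ⟨k, hk⟩
    have : (0 : ℝ) < 1 / ((k : ℝ) + 1) := by positivity
    linarith
  · intro h
    obtain ⟨k, hk⟩ := exists_nat_one_div_lt (sub_pos.2 h)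
    exact ⟨k, by linarith⟩

theorem monotone_Ioi_add_inv (b : ℝ) : Monotone fun k : ℕ => Ioi (b + 1 / ((k : ℝ) + 1)) := by
  intro j k hjk
  refine Ioi_subset_Ioi ?_
  have : (j : ℝ) ≤ k := by exact_mod_cast hjk
  gcongr

theorem radialPot_Ioi_eq_iSup {s l b : ℝ} (φ : ℝ → ℝ≥0∞) :
    radialPot s l (Ioi b) φ = ⨆ k : ℕ, radialPot s l (Ioi (b + 1 / ((k : ℝ) + 1))) φ := by
  unfold radialPot
  rw [← setLIntegral_iUnion_of_directed _ (monotone_Ioi_add_inv b).directed_le,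
    iUnion_Ioi_add_inv]

theorem radialPot_Ioi_le_of_forall {s l b : ℝ} {φ : ℝ → ℝ≥0∞} {c : ℝ≥0∞}
    (h : ∀ t, b < t → radialPot s l (Ioi t) φ ≤ c) : radialPot s l (Ioi b) φ ≤ c := by
  rw [radialPot_Ioi_eq_iSup]
  refine iSup_le fun k => h _ ?_
  have : (0 : ℝ) < 1 / ((k : ℝ) + 1) := by positivity
  linarith

theorem div_rpow_div_eq {s b ρ : ℝ} (hs : 0 ≤ s) (hρ : 0 < ρ) (X : ℝ≥0∞) :
    (X / ENNReal.ofReal (ρ ^ b)) ^ s / ENNReal.ofReal ρ =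
      X ^ s * ENNReal.ofReal (ρ ^ (-(b * s) - 1)) := by
  rw [ENNReal.div_rpow_of_nonneg _ _ hs, ENNReal.ofReal_rpow_of_nonneg (by positivity) hs,
    ← Real.rpow_mul hρ.le, div_eq_mul_inv, div_eq_mul_inv, mul_assoc,
    ← ENNReal.ofReal_inv_of_pos (by positivity), ← ENNReal.ofReal_inv_of_pos hρ,
    ← ENNReal.ofReal_mul (by positivity), Real.rpow_sub hρ, Real.rpow_neg hρ.le, Real.rpow_one]
  rfl

/-! ### Functions of balls -/

section Balls

set_option linter.unusedSectionVars false

variable {E : Type*} [MetricSpace E]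

theorem iUnion_ball_sub_inv (x : E) (ρ : ℝ) : ⋃ k : ℕ, ball x (ρ - 1 / ((k : ℝ) + 1)) = ball x ρ := by
  ext y
  simp only [mem_iUnion, mem_ball]
  constructor
  · rintro ⟨k, hk⟩
    have : (0 : ℝ) < 1 / ((k : ℝ) + 1) := by positivity
    linarith
  · intro h
    obtain ⟨k, hk⟩ := exists_nat_one_div_lt (sub_pos.2 h)
    exact ⟨k, by linarith⟩

theorem monotone_ball_sub_inv (x : E) (ρ : ℝ) :
    Monotone fun k : ℕ => ball x (ρ - 1 / ((k : ℝ) + 1)) := by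
  intro j k hjk
  refine ball_subset_ball ?_
  have : (j : ℝ) ≤ k := by exact_mod_cast hjk
  gcongr

variable [MeasurableSpace E] [BorelSpace E] [SecondCountableTopology E]

theorem measurable_uncurry_of_ball_mono {Φ : E → ℝ → ℝ≥0∞}
    (hmono : ∀ x y ρ t, dist x y + ρ ≤ t → Φ x ρ ≤ Φ y t)
    (hcont : ∀ x ρ, Φ x ρ ≤ ⨆ k : ℕ, Φ x (ρ - 1 / ((k : ℝ) + 1))) :
    Measurable (Function.uncurry Φ) := by
  refine LowerSemicontinuous.measurable ?_
  rintro ⟨x, ρ⟩ c hc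
  obtain ⟨k, hk⟩ := lt_iSup_iff.1 (lt_of_lt_of_le hc (hcont x ρ))
  set ε : ℝ := 1 / ((k : ℝ) + 1) with hε
  have hε0 : 0 < ε := by positivity
  filter_upwards [Metric.ball_mem_nhds (x, ρ) (half_pos hε0)] with z hz
  rw [mem_ball, Prod.dist_eq, max_lt_iff, Real.dist_eq, abs_lt] at hz
  simp only at hz
  refine hk.trans_le (hmono _ _ _ _ ?_)
  rw [dist_comm]
  linarith [hz.1, hz.2.1]

theorem ball_mono_measure (ν : Measure E) (x y : E) (ρ t : ℝ) (h : dist x y + ρ ≤ t) :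
    ν (ball x ρ) ≤ ν (ball y t) :=
  measure_mono (ball_subset_ball' (by linarith))

theorem measurable_measure_ball (ν : Measure E) :
    Measurable (Function.uncurry fun (x : E) (ρ : ℝ) => ν (ball x ρ)) := by
  refine measurable_uncurry_of_ball_mono (ball_mono_measure ν) fun x ρ => ?_
  rw [← (monotone_ball_sub_inv x ρ).measure_iUnion, iUnion_ball_sub_inv]

theorem measurable_radialPot {s l : ℝ} (A : Set ℝ) {Φ : E → ℝ → ℝ≥0∞}
    (h : Measurable (Function.uncurry Φ)) : Measurable fun x => radialPot s l A (Φ x) := by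
  unfold radialPot
  refine Measurable.lintegral_prod_right'
    (f := fun z : E × ℝ => Φ z.1 z.2 ^ s * ENNReal.ofReal (z.2 ^ (-l - 1))) ?_
  exact (h.pow_const s).mul (by fun_prop)

/-- The Wolff potential `∫₀^∞ ν(B(x,ρ))^s ρ^{-l} dρ/ρ`. -/
noncomputable def wolff (s l : ℝ) (ν : Measure E) (x : E) : ℝ≥0∞ :=
  radialPot s l (Ioi 0) fun ρ => ν (ball x ρ)

theorem measurable_wolff (s l : ℝ) (ν : Measure E) : Measurable (wolff s l ν) :=
  measurable_radialPot _ (measurable_measure_ball ν)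

theorem wolff_mono {s l : ℝ} (hs : 0 ≤ s) {μ ν : Measure E} (h : μ ≤ ν) (x : E) :
    wolff s l μ x ≤ wolff s l ν x :=
  radialPot_mono hs measurableSet_Ioi fun _ _ => h _

theorem wolff_eq_iSup {s l : ℝ} (hs : 0 < s) {ν : Measure E} {μ : ℕ → Measure E}
    (hμ : Monotone μ) (h : ∀ x ρ, ν (ball x ρ) = ⨆ k, μ k (ball x ρ)) (x : E) :
    wolff s l ν x = ⨆ k, wolff s l (μ k) x := by
  unfold wolff radialPot
  rw [← lintegral_iSup]
  · refine lintegral_congr fun ρ => ?_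
    simp only [h, ENNReal.iSup_rpow_const _ hs, ENNReal.iSup_mul]
  · intro k
    have h1 := (measurable_measure_ball (μ k)).comp (measurable_prodMk_left (x := x))
    exact (h1.pow_const s).mul (by fun_prop)
  · intro j k hjk ρ
    have := hμ hjk (ball x ρ)
    dsimp only
    gcongr

theorem wolff_zero {s l : ℝ} (hs : 0 < s) (x : E) : wolff s l (0 : Measure E) x = 0 := by
  simp [wolff, radialPot, hs]

theorem le_wolff {s l : ℝ} (hs : 0 ≤ s) (hl : 0 < l) (ν : Measure E) (x : E) {t : ℝ} (ht : 0 < t) :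
    ν (ball x t) ^ s * ENNReal.ofReal (t ^ (-l) / l) ≤ wolff s l ν x :=
  (le_radialPot_Ioi hs hl ht fun _ hρ => measure_mono (ball_subset_ball hρ.le)).trans
    (radialPot_mono_set (Ioi_subset_Ioi ht.le) _)

theorem exists_measure_ball_pos {ν : Measure E} (hν : ν ≠ 0) (x : E) :
    ∃ R : ℝ, 0 < R ∧ 0 < ν (ball x R) := by
  by_contra! h
  apply hν
  rw [← Measure.measure_univ_eq_zero, ← iUnion_ball_nat_succ x]
  exact measure_iUnion_null fun k => le_antisymm (h _ (by positivity)) (zero_le)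

theorem wolff_pos {s l : ℝ} (hs : 0 < s) (hl : 0 < l) {ν : Measure E} (hν : ν ≠ 0) (x : E) :
    0 < wolff s l ν x := by
  obtain ⟨R, hR, h⟩ := exists_measure_ball_pos hν x
  refine lt_of_lt_of_le ?_ (le_wolff hs.le hl ν x hR)
  refine ENNReal.mul_pos (by simp [ENNReal.rpow_eq_zero_iff, h.ne', hs, hs.le]) ?_
  simp only [ne_eq, ENNReal.ofReal_eq_zero, not_le]
  positivity

theorem measure_ball_lt_top_of_wolff_lt_top {s l : ℝ} (hs : 0 < s) (hl : 0 < l) {ν : Measure E}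
    {x : E} (h : wolff s l ν x < ⊤) (R : ℝ) : ν (ball x R) < ⊤ := by
  by_contra! h1
  have hR : 0 < max R 1 := by positivity
  have h2 : ν (ball x (max R 1)) = ⊤ :=
    top_le_iff.1 (h1.trans (measure_mono (ball_subset_ball (le_max_left _ _))))
  have h3 := le_wolff hs.le hl ν x hR
  rw [h2, ENNReal.top_rpow_of_pos hs, ENNReal.top_mul] at h3
  · exact absurd (h3.trans_lt h) (lt_irrefl _)
  · simp only [ne_eq, ENNReal.ofReal_eq_zero, not_le]
    positivity

/-! ### Embedding constants -/

/-- The least constant in the inequality `∫_A (Wν)^q dσ ≤ κ^q ν(E)^{qs}`. -/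
noncomputable def embConst (s l q : ℝ) (σ : Measure E) (A : Set E) : ℝ≥0∞ :=
  sInf {κ : ℝ≥0∞ | ∀ ν : Measure E, IsFiniteMeasure ν →
    ∫⁻ y in A, wolff s l ν y ^ q ∂σ ≤ κ ^ q * ν univ ^ (q * s)}

variable {s l q : ℝ}

theorem embConst_spec (hs : 0 < s) (hq : 0 < q) (σ : Measure E) (A : Set E) (ν : Measure E)
    [IsFiniteMeasure ν] :
    ∫⁻ y in A, wolff s l ν y ^ q ∂σ ≤ embConst s l q σ A ^ q * ν univ ^ (q * s) := by
  rcases eq_or_ne ν 0 with rfl | hν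
  · simp [wolff_zero hs, hq]
  have h0 : ν univ ^ (q * s) ≠ 0 := by
    simp [ENNReal.rpow_eq_zero_iff, hν]
  have h1 : ν univ ^ (q * s) ≠ ⊤ :=
    ENNReal.rpow_ne_top_of_nonneg (mul_pos hq hs).le (measure_ne_top _ _)
  rw [← ENNReal.div_le_iff h0 h1, ← ENNReal.rpow_inv_le_iff hq]
  refine le_sInf fun κ hκ => ?_
  rw [ENNReal.rpow_inv_le_iff hq, ENNReal.div_le_iff h0 h1]
  exact hκ ν inferInstance

theorem embConst_le {σ : Measure E} {A : Set E} {κ : ℝ≥0∞}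
    (h : ∀ ν : Measure E, IsFiniteMeasure ν →
      ∫⁻ y in A, wolff s l ν y ^ q ∂σ ≤ κ ^ q * ν univ ^ (q * s)) : embConst s l q σ A ≤ κ :=
  sInf_le h

theorem embConst_mono (hs : 0 < s) (hq : 0 < q) {σ τ : Measure E} {A B : Set E}
    (h : σ.restrict A ≤ τ.restrict B) : embConst s l q σ A ≤ embConst s l q τ B :=
  embConst_le fun ν _ => (lintegral_mono' h le_rfl).trans (embConst_spec hs hq τ B ν)

theorem embConst_restrict_of_subset (hs : 0 < s) (hq : 0 < q) (σ : Measure E) {A B : Set E}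
    (h : A ⊆ B) (hA : MeasurableSet A) :
    embConst s l q (σ.restrict B) A = embConst s l q σ A := by
  have : (σ.restrict B).restrict A = σ.restrict A := by
    rw [Measure.restrict_restrict hA, inter_eq_self_of_subset_left h]
  exact le_antisymm (embConst_mono hs hq this.le) (embConst_mono hs hq this.ge)

theorem embConst_iUnion_le (hs : 0 < s) (hq : 0 < q) (σ : Measure E) {A : ℕ → Set E}
    (hA : Monotone A) : embConst s l q σ (⋃ k, A k) ≤ ⨆ k, embConst s l q σ (A k) := by
  refine embConst_le fun ν _ => ?_
  rw [setLIntegral_iUnion_of_directed _ hA.directed_le]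
  refine iSup_le fun k => (embConst_spec hs hq σ (A k) ν).trans ?_
  gcongr
  exact le_iSup (fun k => embConst s l q σ (A k)) k

theorem ball_mono_embConst (hs : 0 < s) (hq : 0 < q) (σ : Measure E) (x y : E) (ρ t : ℝ)
    (h : dist x y + ρ ≤ t) : embConst s l q σ (ball x ρ) ≤ embConst s l q σ (ball y t) :=
  embConst_mono hs hq (Measure.restrict_mono (ball_subset_ball' (by linarith)) le_rfl)

theorem measurable_embConst_ball (hs : 0 < s) (hq : 0 < q) (σ : Measure E) :
    Measurable (Function.uncurry fun (x : E) (ρ : ℝ) => embConst s l q σ (ball x ρ)) := by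
  refine measurable_uncurry_of_ball_mono (ball_mono_embConst hs hq σ) fun x ρ => ?_
  rw [← iUnion_ball_sub_inv x ρ]
  exact (embConst_iUnion_le hs hq σ (monotone_ball_sub_inv x ρ))

/-- Lower bound for the embedding constant of a ball, tested with a point mass at the centre. -/
theorem measure_ball_mul_le_embConst (hs : 0 < s) (hl : 0 < l) (hq : 0 < q) (σ : Measure E) (x : E)
    {ρ : ℝ} (hρ : 0 < ρ) :
    σ (ball x ρ) * ENNReal.ofReal (ρ ^ (-l) / l) ^ q ≤ embConst s l q σ (ball x ρ) ^ q := by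
  have h := embConst_spec (l := l) hs hq σ (ball x ρ) (Measure.dirac x)
  rw [measure_univ, ENNReal.one_rpow, mul_one] at h
  refine le_trans ?_ h
  rw [mul_comm, ← setLIntegral_const]
  refine setLIntegral_mono' measurableSet_ball fun y hy => ?_
  gcongr
  have h2 := le_wolff hs.le hl (Measure.dirac x) y hρ
  rwa [Measure.dirac_apply' _ measurableSet_ball, indicator_of_mem, Pi.one_apply,
    ENNReal.one_rpow, one_mul] at h2
  rwa [mem_ball_comm] at hy

end Balls

/-! ### A weak-type estimate and lower bounds for solutions -/

section WeakType

set_option linter.unusedSectionVars false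

variable {E : Type*} [MetricSpace E] [MeasurableSpace E] [BorelSpace E] [SecondCountableTopology E]

theorem mul_measure_setOf_exists_ball_le_of_bounded (ω ν : Measure E) (t : ℝ≥0∞) (N : ℝ) :
    t * ω {x | ∃ ρ, 0 < ρ ∧ ρ ≤ N ∧ t * ω (ball x ρ) ≤ ν (ball x (ρ / 8))} ≤ ν univ := by
  set S := {x | ∃ ρ, 0 < ρ ∧ ρ ≤ N ∧ t * ω (ball x ρ) ≤ ν (ball x (ρ / 8))} with hS
  have hex : ∀ x : E, ∃ ρ : ℝ, x ∈ S → 0 < ρ ∧ ρ ≤ N ∧ t * ω (ball x ρ) ≤ ν (ball x (ρ / 8)) := by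
    intro x
    by_cases hx : x ∈ S
    · obtain ⟨ρ, h⟩ := hx
      exact ⟨ρ, fun _ => h⟩
    · exact ⟨0, fun h => absurd h hx⟩
  choose r hr using hex
  obtain ⟨u, huS, hdisj, hcov⟩ := Vitali.exists_disjoint_subfamily_covering_enlargement_closedBall
    S id (fun x => r x / 8) (N / 8) (fun a ha => by
      have := (hr a ha).2.1
      linarith) 4 (by norm_num)
  have hcount : u.Countable := by
    refine hdisj.countable_of_nonempty_interior fun a ha => ?_
    refine ⟨a, ball_subset_interior_closedBall (mem_ball_self ?_)⟩
    have := (hr a (huS ha)).1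
    positivity
  have hsub : S ⊆ ⋃ b ∈ u, ball b (r b) := by
    intro a ha
    obtain ⟨b, hb, hab⟩ := hcov a ha
    refine mem_biUnion hb ?_
    have h0 := (hr a ha).1
    have h1 := (hr b (huS hb)).1
    refine closedBall_subset_ball (by linarith : 4 * (r b / 8) < r b) (hab ?_)
    exact mem_closedBall_self (by positivity)
  have : Countable u := hcount.to_subtype
  calc t * ω S ≤ t * ω (⋃ b ∈ u, ball b (r b)) := by gcongr
    _ ≤ t * ∑' b : u, ω (ball (b : E) (r b)) := by gcongr; exact measure_biUnion_le _ hcount _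
    _ = ∑' b : u, t * ω (ball (b : E) (r b)) := ENNReal.tsum_mul_left.symm
    _ ≤ ∑' b : u, ν (closedBall (b : E) (r b / 8)) := by
      refine ENNReal.tsum_le_tsum fun b => ?_
      exact (hr b (huS b.2)).2.2.trans (measure_mono ball_subset_closedBall)
    _ ≤ ν univ := by
      refine tsum_measure_le_measure_univ (fun b => measurableSet_closedBall.nullMeasurableSet) ?_
      intro a b hab
      exact (hdisj a.2 b.2 (Subtype.coe_injective.ne hab)).aedisjoint

theorem mul_measure_setOf_exists_ball_le (ω ν : Measure E) (t : ℝ≥0∞) :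
    t * ω {x | ∃ ρ, 0 < ρ ∧ t * ω (ball x ρ) ≤ ν (ball x (ρ / 8))} ≤ ν univ := by
  have : {x | ∃ ρ, 0 < ρ ∧ t * ω (ball x ρ) ≤ ν (ball x (ρ / 8))} =
      ⋃ N : ℕ, {x | ∃ ρ, 0 < ρ ∧ ρ ≤ (N : ℝ) ∧ t * ω (ball x ρ) ≤ ν (ball x (ρ / 8))} := by
    ext x
    simp only [mem_ofPred_eq, mem_iUnion]
    constructor
    · rintro ⟨ρ, h0, h1⟩
      obtain ⟨N, hN⟩ := exists_nat_ge ρ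
      exact ⟨N, ρ, h0, hN, h1⟩
    · rintro ⟨N, ρ, h0, -, h1⟩
      exact ⟨ρ, h0, h1⟩
  rw [this, Monotone.measure_iUnion, ENNReal.mul_iSup]
  · exact iSup_le fun N => mul_measure_setOf_exists_ball_le_of_bounded ω ν t N
  · rintro j k hjk x ⟨ρ, h0, h1, h2⟩
    exact ⟨ρ, h0, h1.trans (by exact_mod_cast hjk), h2⟩

theorem wolff_le_of_forall_ball {s l : ℝ} (hs : 0 < s) {ω ν : Measure E} {x : E} {t : ℝ≥0∞}
    (h : ∀ ρ, 0 < ρ → ν (ball x (ρ / 8)) ≤ t * ω (ball x ρ)) :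
    wolff s l ν x ≤ ENNReal.ofReal (8 ^ l) * t ^ s * wolff s l ω x := by
  have h1 := radialPot_comp_mul (s := s) (l := l) (c := 1 / 8) (t := 0) (by norm_num) le_rfl
    (fun ρ => ν (ball x ρ))
  rw [mul_zero] at h1
  have h2 : radialPot s l (Ioi 0) (fun ρ => ν (ball x (1 / 8 * ρ))) ≤ t ^ s * wolff s l ω x := by
    calc _ ≤ radialPot s l (Ioi 0) (fun ρ => t * ω (ball x ρ)) := by
          refine radialPot_mono hs.le measurableSet_Ioi fun ρ hρ => ?_
          rw [one_div_mul_eq_div]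
          exact h ρ hρ
      _ = _ := by
          unfold wolff radialPot
          rw [← lintegral_const_mul]
          · simp only [ENNReal.mul_rpow_of_nonneg _ _ hs.le, mul_assoc]
          · have h1 := (measurable_measure_ball ω).comp (measurable_prodMk_left (x := x))
            exact (h1.pow_const s).mul (by fun_prop)
  have h3 : ENNReal.ofReal (8 ^ l) * ENNReal.ofReal ((1 / 8) ^ l) = 1 := by
    rw [← ENNReal.ofReal_mul (by positivity), ← Real.mul_rpow (by norm_num) (by norm_num)]
    norm_num
  calc wolff s l ν x = ENNReal.ofReal (8 ^ l) * (ENNReal.ofReal ((1 / 8) ^ l) * wolff s l ν x) := by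
        rw [← mul_assoc, h3, one_mul]
    _ = ENNReal.ofReal (8 ^ l) * radialPot s l (Ioi 0) (fun ρ => ν (ball x (1 / 8 * ρ))) := by
        rw [h1]; rfl
    _ ≤ _ := by rw [mul_assoc]; gcongr

/-- The constant in `lintegral_wolff_rpow_le`. -/
noncomputable def supersolConst (s l q : ℝ) : ℝ≥0∞ :=
  ENNReal.ofReal (8 ^ l) ^ q * (1 + ∑' k : ℕ, 2 ^ (q * s) * (2 ^ (q * s) * 2⁻¹) ^ k)

theorem supersolConst_ne_top {s l q : ℝ} (hq : 0 < q) (hqs : q * s < 1) :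
    supersolConst s l q ≠ ⊤ := by
  unfold supersolConst
  refine ENNReal.mul_ne_top (ENNReal.rpow_ne_top_of_nonneg hq.le ENNReal.ofReal_ne_top) ?_
  refine ENNReal.add_ne_top.2 ⟨by simp, ?_⟩
  rw [ENNReal.tsum_mul_left, ENNReal.tsum_geometric]
  refine ENNReal.mul_ne_top (ENNReal.two_rpow_ne_top _) (ENNReal.inv_ne_top.2 ?_)
  refine (tsub_pos_of_lt ?_).ne'
  rw [← ENNReal.rpow_neg_one, ← ENNReal.rpow_add _ _ (by simp) (by simp)]
  exact ENNReal.rpow_lt_one_of_one_lt_of_neg (by simp) (by linarith)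

theorem lintegral_wolff_rpow_le {s l q : ℝ} (hs : 0 < s) (hl : 0 < l) (hq : 0 < q)
    (hqs : q * s < 1) (σ : Measure E) {u : E → ℝ≥0∞} (hu : Measurable u) {A : Set E}
    (hA : MeasurableSet A) (hω : σ.withDensity (fun y => u y ^ q) ≠ 0)
    (hsup : ∀ᵐ x ∂σ.restrict A, wolff s l (σ.withDensity fun y => u y ^ q) x ≤ u x)
    (ν : Measure E) [IsFiniteMeasure ν] :
    ∫⁻ y in A, wolff s l ν y ^ q ∂σ ≤
      supersolConst s l q * (σ.withDensity (fun y => u y ^ q) A ^ (1 - q * s) *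
        ν univ ^ (q * s)) := by
  set ω := σ.withDensity fun y => u y ^ q with hωdef
  have huq : Measurable fun y => u y ^ q := hu.pow_const q
  have ha0 : 0 < q * s := mul_pos hq hs
  have ha1 : 0 < 1 - q * s := by linarith
  have hL0 : ENNReal.ofReal (8 ^ l) ≠ 0 := by
    simp only [ne_eq, ENNReal.ofReal_eq_zero, not_le]; positivity
  rcases eq_or_ne ν 0 with rfl | hν
  · simp [wolff_zero hs, hq]
  have hν0 : ν univ ≠ 0 := by simpa using hν
  have hνt : ν univ ≠ ⊤ := measure_ne_top _ _
  have hωA : ω A = ∫⁻ y in A, u y ^ q ∂σ := withDensity_apply _ hA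
  rcases eq_or_ne (ω A) 0 with h0 | h0
  · have h1 : ∀ᵐ x ∂σ.restrict A, u x ^ q = 0 := by
      rw [hωA, lintegral_eq_zero_iff huq] at h0
      exact h0
    have h2 : ∀ᵐ _x ∂σ.restrict A, False := by
      filter_upwards [h1, hsup] with x hx hx2
      have := (wolff_pos hs hl hω x).trans_le hx2
      rw [ENNReal.rpow_eq_zero_iff_of_pos hq] at hx
      exact this.ne' hx
    have h3 : σ.restrict A = 0 := by
      rw [← ae_eq_bot]
      exact Filter.eventually_false_iff_eq_bot.1 h2
    simp [h3]
  rcases eq_or_ne (ω A) ⊤ with ht | ht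
  · rw [ht, ENNReal.top_rpow_of_pos ha1, ENNReal.top_mul, ENNReal.mul_top]
    · exact le_top
    · unfold supersolConst
      refine mul_ne_zero ?_ (by simp)
      simp [ENNReal.rpow_eq_zero_iff, hL0]
    · simp [ENNReal.rpow_eq_zero_iff, hν0, hνt]
  set L := ENNReal.ofReal (8 ^ l) with hL
  have hLt : L ≠ ⊤ := ENNReal.ofReal_ne_top
  set t₀ := ν univ / ω A with ht₀
  have ht₀0 : t₀ ≠ 0 := (ENNReal.div_pos hν0 ht).ne'
  have ht₀t : t₀ ≠ ⊤ := ENNReal.div_ne_top hνt h0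
  set S : ℕ → Set E := fun k => {x | L * (2 ^ k * t₀) ^ s * wolff s l ω x < wolff s l ν x} with hS
  have hSm : ∀ k, MeasurableSet (S k) := fun k =>
    measurableSet_lt ((measurable_wolff s l ω).const_mul _) (measurable_wolff s l ν)
  have hSω : ∀ k, ω (S k) ≤ (2⁻¹) ^ k * ω A := by
    intro k
    have hsub : S k ⊆ {x | ∃ ρ, 0 < ρ ∧ (2 ^ k * t₀) * ω (ball x ρ) ≤ ν (ball x (ρ / 8))} := by
      intro x hx
      by_contra hcon
      simp only [mem_ofPred_eq, not_exists, not_and, not_le] at hcon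
      exact absurd (wolff_le_of_forall_ball (l := l) hs fun ρ hρ => (hcon ρ hρ).le) (not_le.2 hx)
    have h1 := (mul_le_mul_right (measure_mono hsub) (2 ^ k * t₀)).trans
      (mul_measure_setOf_exists_ball_le ω ν (2 ^ k * t₀))
    have h2 : (2 : ℝ≥0∞) ^ k * t₀ ≠ 0 := mul_ne_zero (by simp) ht₀0
    have h3 : (2 : ℝ≥0∞) ^ k * t₀ ≠ ⊤ := ENNReal.mul_ne_top (by simp) ht₀t
    calc ω (S k) ≤ (2 ^ k * t₀)⁻¹ * ν univ := by
          rw [mul_comm, ← div_eq_mul_inv, ENNReal.le_div_iff_mul_le (Or.inl h2) (Or.inl h3), mul_comm]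
          exact h1
      _ = (2⁻¹) ^ k * ω A := by
          rw [ENNReal.mul_inv (Or.inr ht₀t) (Or.inr ht₀0), mul_assoc, ENNReal.inv_pow]
          congr 1
          rw [ht₀, ENNReal.inv_div (Or.inl ht) (Or.inl h0), ENNReal.div_mul_cancel hν0 hνt]
  have hpt : ∀ᵐ x ∂σ.restrict A, wolff s l ν x ^ q ≤ (L * t₀ ^ s) ^ q * u x ^ q +
      ∑' k, (L * (2 ^ (k + 1) * t₀) ^ s) ^ q * (S k).indicator (fun y => u y ^ q) x := by
    filter_upwards [hsup] with x hx
    have hux : 0 < u x := (wolff_pos hs hl hω x).trans_le hx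
    have hstep : ∀ k, x ∉ S k → wolff s l ν x ^ q ≤ (L * (2 ^ k * t₀) ^ s) ^ q * u x ^ q := by
      intro k hk
      rw [← ENNReal.mul_rpow_of_nonneg _ _ hq.le]
      have : wolff s l ν x ≤ L * (2 ^ k * t₀) ^ s * wolff s l ω x := not_lt.1 hk
      gcongr
      exact this.trans (by gcongr)
    by_cases h00 : x ∈ S 0
    · refine le_trans ?_ le_add_self
      by_cases hall : ∀ k, x ∈ S k
      · have : ∑' k : ℕ, (L * (2 ^ (k + 1) * t₀) ^ s) ^ q * (S k).indicator (fun y => u y ^ q) x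
            = ⊤ := by
          rw [eq_top_iff]
          have hc : (L * t₀ ^ s) ^ q * u x ^ q ≠ 0 := by
            refine mul_ne_zero ?_ ?_
            · rw [ne_eq, ENNReal.rpow_eq_zero_iff_of_pos hq]
              refine mul_ne_zero hL0 ?_
              rwa [ne_eq, ENNReal.rpow_eq_zero_iff_of_pos hs]
            · rw [ne_eq, ENNReal.rpow_eq_zero_iff_of_pos hq]
              exact hux.ne'
          rw [← ENNReal.tsum_const_eq_top_of_ne_zero (α := ℕ) hc]
          refine ENNReal.tsum_le_tsum fun k => ?_
          rw [indicator_of_mem (hall k)]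
          gcongr
          exact le_mul_of_one_le_left (zero_le) (one_le_pow₀ (by norm_num))
        rw [this]
        exact le_top
      · push Not at hall
        classical
        have hk := Nat.find_spec hall
        have hmin := fun m => Nat.find_min hall (m := m)
        obtain ⟨m, hm⟩ : ∃ m, Nat.find hall = m + 1 := by
          refine Nat.exists_eq_succ_of_ne_zero fun h => ?_
          rw [h] at hk
          exact hk h00
        have hxm : x ∈ S m := by
          by_contra h
          exact hmin m (by omega) h
        rw [hm] at hk
        refine (hstep _ hk).trans ?_
        refine le_trans ?_ (ENNReal.le_tsum m)
        rw [indicator_of_mem hxm]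
    · refine le_trans ?_ le_self_add
      simpa using hstep 0 h00
  have hind : ∀ k, ∫⁻ x in A, (S k).indicator (fun y => u y ^ q) x ∂σ ≤ (2⁻¹) ^ k * ω A := by
    intro k
    rw [lintegral_indicator (hSm k)]
    refine le_trans ?_ (hSω k)
    rw [hωdef, withDensity_apply _ (hSm k)]
    exact lintegral_mono' (Measure.restrict_mono le_rfl Measure.restrict_le_self) le_rfl
  have hmain : t₀ ^ (q * s) * ω A = ω A ^ (1 - q * s) * ν univ ^ (q * s) := by
    rw [ht₀, ENNReal.div_rpow_of_nonneg _ _ ha0.le]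
    nth_rewrite 2 [← ENNReal.rpow_one_sub_mul_rpow_self (ω A) ha0.le hqs.le]
    rw [mul_comm (ω A ^ _), ← mul_assoc, ENNReal.div_mul_cancel, mul_comm]
    · simp [ENNReal.rpow_eq_zero_iff, h0, ht]
    · exact ENNReal.rpow_ne_top_of_nonneg ha0.le ht
  have hpow : ∀ y : ℝ≥0∞, (L * y ^ s) ^ q = L ^ q * y ^ (q * s) := by
    intro y
    rw [ENNReal.mul_rpow_of_nonneg _ _ hq.le, ← ENNReal.rpow_mul, mul_comm s q]
  calc ∫⁻ y in A, wolff s l ν y ^ q ∂σ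
      ≤ ∫⁻ x in A, ((L * t₀ ^ s) ^ q * u x ^ q +
        ∑' k, (L * (2 ^ (k + 1) * t₀) ^ s) ^ q * (S k).indicator (fun y => u y ^ q) x) ∂σ :=
        lintegral_mono_ae hpt
    _ = (L * t₀ ^ s) ^ q * ω A + ∑' k, (L * (2 ^ (k + 1) * t₀) ^ s) ^ q *
        ∫⁻ x in A, (S k).indicator (fun y => u y ^ q) x ∂σ := by
        rw [lintegral_add_left (huq.const_mul _), lintegral_const_mul _ huq, ← hωA, lintegral_tsum]
        · congr 2
          ext k
          rw [lintegral_const_mul _ (huq.indicator (hSm k))]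
        · exact fun k => ((huq.indicator (hSm k)).const_mul _).aemeasurable
    _ ≤ (L * t₀ ^ s) ^ q * ω A +
        ∑' k, (L * (2 ^ (k + 1) * t₀) ^ s) ^ q * ((2⁻¹) ^ k * ω A) := by
        gcongr with k
        exact hind k
    _ = L ^ q * (1 + ∑' k : ℕ, 2 ^ (q * s) * (2 ^ (q * s) * 2⁻¹) ^ k) * (t₀ ^ (q * s) * ω A) := by
        rw [mul_add, add_mul, hpow]
        congr 1
        · ring
        · rw [← ENNReal.tsum_mul_left, ← ENNReal.tsum_mul_right]
          congr 1
          ext k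
          rw [hpow, ENNReal.mul_rpow_of_nonneg _ _ ha0.le, mul_pow, ← ENNReal.rpow_natCast,
            ← ENNReal.rpow_mul, mul_comm ((k + 1 : ℕ) : ℝ), ENNReal.rpow_mul, ENNReal.rpow_natCast,
            pow_succ]
          ring
    _ = _ := by rw [hmain]; rfl

/-- If `u ≥ W(u^q dσ)` on `A`, then `κ(A)` is controlled by `∫_A u^q dσ`. -/
theorem embConst_rpow_le_of_supersolution {s l q : ℝ} (hs : 0 < s) (hl : 0 < l) (hq : 0 < q)
    (hqs : q * s < 1) (σ : Measure E) {u : E → ℝ≥0∞} (hu : Measurable u) {A : Set E}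
    (hA : MeasurableSet A) (hω : σ.withDensity (fun y => u y ^ q) ≠ 0)
    (hsup : ∀ᵐ x ∂σ.restrict A, wolff s l (σ.withDensity fun y => u y ^ q) x ≤ u x) :
    embConst s l q σ A ^ (q / (1 - q * s)) ≤
      supersolConst s l q ^ (1 / (1 - q * s)) * σ.withDensity (fun y => u y ^ q) A := by
  have ha1 : 0 < 1 - q * s := by linarith
  set X := supersolConst s l q * σ.withDensity (fun y => u y ^ q) A ^ (1 - q * s) with hX
  have h : embConst s l q σ A ≤ X ^ (1 / q) := by
    refine embConst_le fun ν _ => ?_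
    rw [← ENNReal.rpow_mul, one_div_mul_cancel hq.ne', ENNReal.rpow_one, hX, mul_assoc]
    exact lintegral_wolff_rpow_le hs hl hq hqs σ hu hA hω hsup ν
  calc _ ≤ (X ^ (1 / q)) ^ (q / (1 - q * s)) := by gcongr
    _ = X ^ (1 / (1 - q * s)) := by
      rw [← ENNReal.rpow_mul]
      congr 1
      field_simp
    _ = _ := by
      rw [hX, ENNReal.mul_rpow_of_nonneg _ _ (by positivity), ← ENNReal.rpow_mul,
        mul_one_div_cancel ha1.ne', ENNReal.rpow_one]

end WeakType

/-! ### Construction of solutions by monotone iteration -/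

section Iteration

set_option linter.unusedSectionVars false

variable {E : Type*} [MetricSpace E] [MeasurableSpace E] [BorelSpace E] [SecondCountableTopology E]

theorem withDensity_rpow_apply_eq_iSup {q : ℝ} (hq : 0 < q) {τ : Measure E} {f : ℕ → E → ℝ≥0∞}
    (hf : ∀ k, Measurable (f k)) (hmono : Monotone f) {A : Set E} (hA : MeasurableSet A) :
    τ.withDensity (fun y => (⨆ k, f k y) ^ q) A = ⨆ k, τ.withDensity (fun y => f k y ^ q) A := by
  simp only [withDensity_apply _ hA, ENNReal.iSup_rpow_const _ hq]
  refine lintegral_iSup (fun k => (hf k).pow_const q) fun j k hjk x => ?_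
  have := hmono hjk x
  dsimp only
  gcongr

theorem withDensity_rpow_mono {q : ℝ} (hq : 0 < q) {τ τ' : Measure E} (hτ : τ ≤ τ')
    {f g : E → ℝ≥0∞} (h : f ≤ g) :
    τ.withDensity (fun y => f y ^ q) ≤ τ'.withDensity (fun y => g y ^ q) := by
  refine Measure.le_intro fun A hA _ => ?_
  rw [withDensity_apply _ hA, withDensity_apply _ hA]
  exact lintegral_mono' (Measure.restrict_mono le_rfl hτ)
    fun y => ENNReal.rpow_le_rpow (h y) hq.le

/-- The Picard iterates of `u ↦ W(u^q dτ)` started at `u₀`. -/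
noncomputable def wolffIter (s l q : ℝ) (u₀ : E → ℝ≥0∞) (τ : Measure E) : ℕ → E → ℝ≥0∞
  | 0 => u₀
  | k + 1 => wolff s l (τ.withDensity fun y => wolffIter s l q u₀ τ k y ^ q)

/-- The pointwise supremum of the Picard iterates. -/
noncomputable def wolffSol (s l q : ℝ) (u₀ : E → ℝ≥0∞) (τ : Measure E) (x : E) : ℝ≥0∞ :=
  ⨆ k, wolffIter s l q u₀ τ k x

variable {s l q : ℝ} {u₀ : E → ℝ≥0∞}

theorem measurable_wolffIter (h₀ : Measurable u₀) (τ : Measure E) (k : ℕ) :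
    Measurable (wolffIter s l q u₀ τ k) := by
  cases k with
  | zero => exact h₀
  | succ k => exact measurable_wolff _ _ _

theorem measurable_wolffSol (h₀ : Measurable u₀) (τ : Measure E) :
    Measurable (wolffSol s l q u₀ τ) :=
  Measurable.iSup fun k => measurable_wolffIter h₀ τ k

theorem wolffIter_mono_measure (hs : 0 < s) (hq : 0 < q) {τ τ' : Measure E} (h : τ ≤ τ') (k : ℕ) :
    wolffIter s l q u₀ τ k ≤ wolffIter s l q u₀ τ' k := by
  induction k with
  | zero => exact le_rfl
  | succ k ih => exact fun x => wolff_mono hs.le (withDensity_rpow_mono hq h ih) x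

theorem wolffSol_mono_measure (hs : 0 < s) (hq : 0 < q) {τ τ' : Measure E} (h : τ ≤ τ') :
    wolffSol s l q u₀ τ ≤ wolffSol s l q u₀ τ' :=
  fun x => iSup_mono fun k => wolffIter_mono_measure hs hq h k x

theorem monotone_wolffIter (hs : 0 < s) (hq : 0 < q) {τ : Measure E}
    (hsub : u₀ ≤ wolff s l (τ.withDensity fun y => u₀ y ^ q)) :
    Monotone (wolffIter s l q u₀ τ) := by
  refine monotone_nat_of_le_succ fun k => ?_
  induction k with
  | zero => exact hsub
  | succ k ih => exact fun x => wolff_mono hs.le (withDensity_rpow_mono hq le_rfl ih) x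

theorem wolffSol_eq (hs : 0 < s) (hq : 0 < q) {τ : Measure E} (h₀ : Measurable u₀)
    (hsub : u₀ ≤ wolff s l (τ.withDensity fun y => u₀ y ^ q)) (x : E) :
    wolffSol s l q u₀ τ x = wolff s l (τ.withDensity fun y => wolffSol s l q u₀ τ y ^ q) x := by
  have hmono := monotone_wolffIter hs hq hsub
  have h := wolff_eq_iSup (l := l) hs (ν := τ.withDensity fun y => wolffSol s l q u₀ τ y ^ q)
    (μ := fun k => τ.withDensity fun y => wolffIter s l q u₀ τ k y ^ q)
    (fun j k hjk => withDensity_rpow_mono hq le_rfl (hmono hjk))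
    (fun x ρ => withDensity_rpow_apply_eq_iSup hq (measurable_wolffIter h₀ τ) hmono
      measurableSet_ball) x
  rw [h]
  exact ((show Monotone fun k => wolffIter s l q u₀ τ k x from
    fun j k hjk => hmono hjk x).iSup_nat_add 1).symm

theorem le_wolffSol (τ : Measure E) : u₀ ≤ wolffSol s l q u₀ τ :=
  fun x => le_iSup (fun k => wolffIter s l q u₀ τ k x) 0

theorem lintegral_wolffSol_rpow_le (hs : 0 < s) (hq : 0 < q) (hqs : q * s < 1)
    {τ : Measure E} (h₀ : Measurable u₀)
    (hsub : u₀ ≤ wolff s l (τ.withDensity fun y => u₀ y ^ q))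
    (hfint : ∫⁻ y, u₀ y ^ q ∂τ ≠ ⊤) (hκ : embConst s l q τ univ ≠ ⊤) :
    ∫⁻ y, wolffSol s l q u₀ τ y ^ q ∂τ ≤ embConst s l q τ univ ^ (q / (1 - q * s)) := by
  have ha0 : 0 < q * s := mul_pos hq hs
  have ha1 : 0 < 1 - q * s := by linarith
  have hmono := monotone_wolffIter hs hq hsub
  set X : ℕ → ℝ≥0∞ := fun k => ∫⁻ y, wolffIter s l q u₀ τ k y ^ q ∂τ with hX
  have hstep : ∀ k, X k ≠ ⊤ → X (k + 1) ≤ embConst s l q τ univ ^ q * X k ^ (q * s) := by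
    intro k hk
    have : IsFiniteMeasure (τ.withDensity fun y => wolffIter s l q u₀ τ k y ^ q) :=
      isFiniteMeasure_withDensity hk
    have h := embConst_spec (l := l) hs hq τ univ
      (τ.withDensity fun y => wolffIter s l q u₀ τ k y ^ q)
    rwa [Measure.restrict_univ, withDensity_apply _ MeasurableSet.univ, Measure.restrict_univ] at h
  have hfin : ∀ k, X k ≠ ⊤ := by
    intro k
    induction k with
    | zero => exact hfint
    | succ k ih =>
      refine ((hstep k ih).trans_lt (ENNReal.mul_lt_top ?_ ?_)).ne
      · exact (ENNReal.rpow_ne_top_of_nonneg hq.le hκ).lt_top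
      · exact (ENNReal.rpow_ne_top_of_nonneg ha0.le ih).lt_top
  have hbound : ∀ k, X k ≤ embConst s l q τ univ ^ (q / (1 - q * s)) := by
    intro k
    have h1 : X k ≤ embConst s l q τ univ ^ q * X k ^ (q * s) := by
      refine le_trans (lintegral_mono fun y => ?_) (hstep k (hfin k))
      have := hmono (Nat.le_succ k) y
      dsimp only
      gcongr
    rcases eq_or_ne (X k) 0 with h0 | h0
    · rw [h0]; exact zero_le
    have h2 : X k ^ (q * s) ≠ 0 := by simp [ENNReal.rpow_eq_zero_iff, h0, hfin k]
    have h3 : X k ^ (q * s) ≠ ⊤ := ENNReal.rpow_ne_top_of_nonneg ha0.le (hfin k)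
    nth_rewrite 1 [← ENNReal.rpow_one_sub_mul_rpow_self (X k) ha0.le hqs.le] at h1
    have h4 : X k ^ (1 - q * s) ≤ embConst s l q τ univ ^ q :=
      (ENNReal.mul_le_mul_iff_left h2 h3).1 h1
    rw [div_eq_mul_inv, ENNReal.rpow_mul, ENNReal.le_rpow_inv_iff ha1]
    exact h4
  have := withDensity_rpow_apply_eq_iSup hq (measurable_wolffIter h₀ τ) hmono
    (τ := τ) MeasurableSet.univ
  simp only [withDensity_apply _ MeasurableSet.univ, Measure.restrict_univ] at this
  exact this.le.trans (iSup_le hbound)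

theorem exists_subsolution_ball (hs : 0 < s) (hl : 0 < l) (hq : 0 < q) (hqs : q * s < 1)
    {σ : Measure E} {x₀ : E} {R : ℝ} (hR : 0 < R) (hpos : 0 < σ (ball x₀ R))
    (hfin : σ (ball x₀ R) < ⊤) :
    ∃ c : ℝ≥0∞, c ≠ 0 ∧ c ≠ ⊤ ∧ ∀ τ : Measure E, σ.restrict (ball x₀ R) ≤ τ →
      (ball x₀ R).indicator (fun _ => c) ≤
        wolff s l (τ.withDensity fun y => (ball x₀ R).indicator (fun _ => c) y ^ q) := by
  have ha0 : 0 < q * s := mul_pos hq hs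
  have ha1 : 0 < 1 - q * s := by linarith
  set M : ℝ≥0∞ := σ (ball x₀ R) ^ s * ENNReal.ofReal ((2 * R) ^ (-l) / l) with hM
  have hM0 : M ≠ 0 := by
    refine mul_ne_zero (by simp [ENNReal.rpow_eq_zero_iff, hpos.ne', hfin.ne]) ?_
    simp only [ne_eq, ENNReal.ofReal_eq_zero, not_le]
    positivity
  have hMt : M ≠ ⊤ :=
    ENNReal.mul_ne_top (ENNReal.rpow_ne_top_of_nonneg hs.le hfin.ne) ENNReal.ofReal_ne_top
  refine ⟨M ^ (1 / (1 - q * s)), by simp [ENNReal.rpow_eq_zero_iff, hM0, hMt],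
    ENNReal.rpow_ne_top_of_nonneg (by positivity) hMt, fun τ hτ x => ?_⟩
  set c := M ^ (1 / (1 - q * s)) with hc
  have hcM : c ^ (1 - q * s) = M := by
    rw [hc, ← ENNReal.rpow_mul, one_div_mul_cancel ha1.ne', ENNReal.rpow_one]
  by_cases hx : x ∈ ball x₀ R
  · rw [indicator_of_mem hx]
    refine le_trans ?_ (le_wolff hs.le hl _ x (by positivity : 0 < 2 * R))
    have hball : c ^ q * σ (ball x₀ R) ≤
        τ.withDensity (fun y => (ball x₀ R).indicator (fun _ => c) y ^ q) (ball x (2 * R)) := by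
      rw [withDensity_apply _ measurableSet_ball, ← setLIntegral_const]
      have hsub : ball x₀ R ⊆ ball x (2 * R) :=
        ball_subset_ball' (by rw [mem_ball, dist_comm] at hx; linarith)
      calc ∫⁻ _ in ball x₀ R, c ^ q ∂σ
          ≤ ∫⁻ _ in ball x₀ R, c ^ q ∂τ := by
            refine lintegral_mono' ?_ le_rfl
            have := Measure.restrict_mono (subset_refl (ball x₀ R)) hτ
            rwa [Measure.restrict_restrict measurableSet_ball, inter_self] at this
        _ ≤ ∫⁻ y in ball x₀ R, (ball x₀ R).indicator (fun _ => c) y ^ q ∂τ :=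
            setLIntegral_mono' measurableSet_ball fun y hy => by rw [indicator_of_mem hy]
        _ ≤ _ := lintegral_mono_set hsub
    calc c = c ^ (1 - q * s) * c ^ (q * s) :=
          (ENNReal.rpow_one_sub_mul_rpow_self c ha0.le hqs.le).symm
      _ = (c ^ q * σ (ball x₀ R)) ^ s * ENNReal.ofReal ((2 * R) ^ (-l) / l) := by
          rw [hcM, hM, ENNReal.mul_rpow_of_nonneg _ _ hs.le, ENNReal.rpow_mul]
          ring
      _ ≤ _ := by gcongr
  · rw [indicator_of_notMem hx]
    exact zero_le

/-- On a ball with finite embedding constant there is a measure that dominates the embedding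
constants of all smaller balls and is dominated by that of the whole ball. -/
theorem exists_measure_embConst_le (hs : 0 < s) (hl : 0 < l) (hq : 0 < q) (hqs : q * s < 1)
    (σ : Measure E) {x₀ : E} {R : ℝ} (hR : 0 < R) (hfin : σ (ball x₀ R) < ⊤)
    (hκ : embConst s l q σ (ball x₀ R) ≠ ⊤) :
    ∃ ω : Measure E, ω univ ≤ embConst s l q σ (ball x₀ R) ^ (q / (1 - q * s)) ∧
      ∀ x ρ, ball x ρ ⊆ ball x₀ R → embConst s l q σ (ball x ρ) ^ (q / (1 - q * s)) ≤
        supersolConst s l q ^ (1 / (1 - q * s)) * ω (ball x ρ) := by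
  have ha1 : 0 < 1 - q * s := by linarith
  rcases eq_or_ne (σ (ball x₀ R)) 0 with h0 | h0
  · refine ⟨0, by simp, fun x ρ hsub => ?_⟩
    have : embConst s l q σ (ball x ρ) = 0 := by
      refine le_antisymm (embConst_le fun ν _ => ?_) (zero_le)
      have : σ.restrict (ball x ρ) = 0 :=
        Measure.restrict_eq_zero.2 (measure_mono_null hsub h0)
      simp [this]
    rw [this, ENNReal.zero_rpow_of_pos (by positivity)]
    exact zero_le
  set τ := σ.restrict (ball x₀ R) with hτ
  have hκτ : embConst s l q τ univ = embConst s l q σ (ball x₀ R) :=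
    le_antisymm (embConst_mono hs hq (by rw [Measure.restrict_univ]))
      (embConst_mono hs hq (by rw [Measure.restrict_univ]))
  obtain ⟨c, hc0, hct, hsub⟩ := exists_subsolution_ball hs hl hq hqs hR (pos_iff_ne_zero.2 h0) hfin
  set u₀ : E → ℝ≥0∞ := (ball x₀ R).indicator fun _ => c with hu₀
  have h₀ : Measurable u₀ := measurable_const.indicator measurableSet_ball
  have hsub' := hsub τ le_rfl
  have hfint : ∫⁻ y, u₀ y ^ q ∂τ ≠ ⊤ := by
    refine ((lintegral_mono (g := fun _ => c ^ q) fun y => ?_).trans_lt ?_).ne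
    · exact ENNReal.rpow_le_rpow (indicator_le_self' (fun _ _ => zero_le) y) hq.le
    · rw [lintegral_const, hτ, Measure.restrict_apply_univ]
      exact ENNReal.mul_lt_top (ENNReal.rpow_ne_top_of_nonneg hq.le hct).lt_top hfin
  have hbound := lintegral_wolffSol_rpow_le hs hq hqs h₀ hsub' hfint (by rwa [hκτ])
  have hsol := wolffSol_eq hs hq h₀ hsub'
  have hne : τ.withDensity (fun y => wolffSol s l q u₀ τ y ^ q) ≠ 0 := by
    intro h
    have hx : x₀ ∈ ball x₀ R := mem_ball_self hR
    have h1 := le_wolffSol (s := s) (l := l) (q := q) (u₀ := u₀) τ x₀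
    rw [hsol x₀, h, wolff_zero hs, hu₀, indicator_of_mem hx] at h1
    exact hc0 (le_antisymm h1 (zero_le))
  refine ⟨τ.withDensity fun y => wolffSol s l q u₀ τ y ^ q, ?_, fun x ρ hsub => ?_⟩
  · rw [withDensity_apply _ MeasurableSet.univ, Measure.restrict_univ, ← hκτ]
    exact hbound
  · rw [← embConst_restrict_of_subset hs hq σ hsub measurableSet_ball]
    exact embConst_rpow_le_of_supersolution hs hl hq hqs τ (measurable_wolffSol h₀ τ)
      measurableSet_ball hne (Filter.Eventually.of_forall fun x => (hsol x).ge)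

end Iteration

/-! ### Pointwise upper bound for finite-energy subsolutions -/

section UpperBound

set_option linter.unusedSectionVars false

variable {E : Type*} [MetricSpace E] [MeasurableSpace E] [BorelSpace E] [SecondCountableTopology E]

/-- The local part of a Wolff potential on a ball, plus the tail centred at the ball. -/
theorem wolff_le_restrict_add {s l : ℝ} (hs : 0 ≤ s) (ω : Measure E) {x y : E} {ρ : ℝ}
    (hρ : 0 < ρ) (hy : y ∈ ball x ρ) :
    wolff s l ω y ≤ wolff s l (ω.restrict (ball x (2 * ρ))) y +
      ENNReal.ofReal (2 ^ l) * radialPot s l (Ioi (2 * ρ)) fun t => ω (ball x t) := by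
  have hd : dist y x < ρ := hy
  rw [← radialPot_comp_mul (by norm_num : (0 : ℝ) < 2) hρ.le]
  have hsplit : Ioi (0 : ℝ) = Ioc 0 ρ ∪ Ioi ρ := (Ioc_union_Ioi_eq_Ioi hρ.le).symm
  unfold wolff
  calc radialPot s l (Ioi 0) (fun t => ω (ball y t))
      ≤ radialPot s l (Ioc 0 ρ) (fun t => ω (ball y t)) +
        radialPot s l (Ioi ρ) (fun t => ω (ball y t)) := by
        unfold radialPot
        rw [hsplit]
        exact lintegral_union_le _ _ _
    _ ≤ _ := by
        refine add_le_add (le_trans (radialPot_mono hs measurableSet_Ioc fun t ht => ?_)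
          (radialPot_mono_set (Ioc_subset_Ioi_self) _))
          (radialPot_mono hs measurableSet_Ioi fun t ht => ?_)
        · rw [Measure.restrict_apply measurableSet_ball, inter_eq_left.2]
          exact ball_subset_ball' (by linarith [ht.2])
        · refine measure_mono (ball_subset_ball' ?_)
          have : ρ < t := ht
          linarith

theorem exists_wolff_le_embConst {s l q : ℝ} (hs : 0 < s) (hl : 0 < l) (hq : 0 < q)
    (hqs : q * s < 1) :
    ∃ C : ℝ≥0∞, C ≠ ⊤ ∧ ∀ (σ : Measure E) (v : E → ℝ≥0∞),
      σ.withDensity (fun y => v y ^ q) univ ≠ ⊤ →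
      (∀ x, v x ≤ wolff s l (σ.withDensity fun y => v y ^ q) x) → ∀ x,
      wolff s l (σ.withDensity fun y => v y ^ q) x ≤
        C * (radialPot s l (Ioi 0) (fun ρ => embConst s l q σ (ball x ρ) ^ (q / (1 - q * s))) +
          wolff s l σ x ^ (1 / (1 - q * s))) := by
  have ha0 : 0 < q * s := mul_pos hq hs
  have ha1 : 0 < 1 - q * s := by linarith
  set a := q * s with ha
  set c₀ : ℝ≥0∞ := 2 ^ a * 2 ^ s with hc₀
  set L : ℝ≥0∞ := ENNReal.ofReal (2 ^ l) with hL
  have hL0 : L ≠ 0 := by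
    rw [hL]; simp only [ne_eq, ENNReal.ofReal_eq_zero, not_le]; positivity
  have hLt : L ≠ ⊤ := ENNReal.ofReal_ne_top
  have hc0 : c₀ ≠ 0 := by simp [hc₀, ENNReal.rpow_eq_zero_iff]
  have hct : c₀ ≠ ⊤ := ENNReal.mul_ne_top (ENNReal.two_rpow_ne_top _) (ENNReal.two_rpow_ne_top _)
  have hD0 : 4 * (c₀ * L) ≠ 0 := by simp [hc0, hL0]
  have hDt : 4 * (c₀ * L) ≠ ⊤ := ENNReal.mul_ne_top (by simp) (ENNReal.mul_ne_top hct hLt)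
  obtain ⟨C, hC, hyoung⟩ := ENNReal.exists_young_rpow ha0 (by linarith)
    (ENNReal.inv_ne_zero.2 hDt) (ENNReal.inv_ne_top.2 hD0)
  set η := (4 * (c₀ * L))⁻¹ with hη
  refine ⟨2 * (c₀ * C), by finiteness, fun σ v hfin hv x => ?_⟩
  set ω := σ.withDensity fun y => v y ^ q with hω
  set κ : ℝ → ℝ≥0∞ := fun ρ => embConst s l q σ (ball x ρ) with hκ
  set K := radialPot s l (Ioi 0) fun ρ => κ ρ ^ (q / (1 - a)) with hK
  set W := wolff s l σ x with hW
  refine radialPot_Ioi_le_of_forall fun ε hε => ?_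
  set A := radialPot s l (Ioi ε) fun ρ => ω (ball x ρ) with hA
  have hAt : A ≠ ⊤ :=
    (radialPot_Ioi_lt_top hs.le hl hε hfin fun ρ _ => measure_mono (subset_univ _)).ne
  have hmeas : ∀ ν : Measure E, Measurable fun ρ => ν (ball x ρ) := fun ν =>
    (measurable_measure_ball ν).comp (measurable_const.prodMk measurable_id)
  have hball : ∀ ρ, ε < ρ → ω (ball x ρ) ^ s ≤ c₀ * (η * ω (ball x (2 * ρ)) ^ s +
      C * (κ ρ ^ (q / (1 - a))) ^ s + (L * A) ^ a * σ (ball x ρ) ^ s) := by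
    intro ρ hρ
    have hρ0 : 0 < ρ := hε.trans hρ
    have : IsFiniteMeasure ω := ⟨hfin.lt_top⟩
    have h1 : ω (ball x ρ) ≤ 2 ^ q * (κ ρ ^ q * ω (ball x (2 * ρ)) ^ a +
        (L * A) ^ q * σ (ball x ρ)) := by
      calc ω (ball x ρ) = ∫⁻ y in ball x ρ, v y ^ q ∂σ := by
            rw [hω, withDensity_apply _ measurableSet_ball]
        _ ≤ ∫⁻ y in ball x ρ, 2 ^ q *
            (wolff s l (ω.restrict (ball x (2 * ρ))) y ^ q + (L * A) ^ q) ∂σ := by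
            refine setLIntegral_mono' measurableSet_ball fun y hy => ?_
            refine le_trans ?_ (ENNReal.add_rpow_le_two_rpow_mul _ _ hq.le)
            refine ENNReal.rpow_le_rpow ((hv y).trans ?_) hq.le
            refine (wolff_le_restrict_add hs.le ω hρ0 hy).trans ?_
            gcongr
            exact radialPot_mono_set (Ioi_subset_Ioi (by linarith)) _
        _ = 2 ^ q * (∫⁻ y in ball x ρ, wolff s l (ω.restrict (ball x (2 * ρ))) y ^ q ∂σ +
            (L * A) ^ q * σ (ball x ρ)) := by
            rw [lintegral_const_mul _ (((measurable_wolff _ _ _).pow_const q).add_const _),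
              lintegral_add_right _ measurable_const, setLIntegral_const]
        _ ≤ _ := by
            gcongr
            refine (embConst_spec (l := l) hs hq σ (ball x ρ) (ω.restrict (ball x (2 * ρ)))).trans ?_
            rw [Measure.restrict_apply_univ]
    calc ω (ball x ρ) ^ s ≤ (2 ^ q * (κ ρ ^ q * ω (ball x (2 * ρ)) ^ a +
        (L * A) ^ q * σ (ball x ρ))) ^ s := by gcongr
      _ ≤ 2 ^ a * (2 ^ s * ((κ ρ ^ q * ω (ball x (2 * ρ)) ^ a) ^ s +
          ((L * A) ^ q * σ (ball x ρ)) ^ s)) := by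
          rw [ENNReal.mul_rpow_of_nonneg _ _ hs.le, ← ENNReal.rpow_mul]
          gcongr
          exact ENNReal.add_rpow_le_two_rpow_mul _ _ hs.le
      _ = c₀ * (((κ ρ ^ (q / (1 - a))) ^ s) ^ (1 - a) * (ω (ball x (2 * ρ)) ^ s) ^ a +
          (L * A) ^ a * σ (ball x ρ) ^ s) := by
          rw [ENNReal.mul_rpow_of_nonneg _ _ hs.le, ENNReal.mul_rpow_of_nonneg _ _ hs.le]
          simp only [← ENNReal.rpow_mul]
          rw [show q / (1 - a) * s * (1 - a) = q * s by field_simp, mul_comm s a, ← mul_assoc]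
      _ ≤ c₀ * (η * ω (ball x (2 * ρ)) ^ s +
          C * (κ ρ ^ (q / (1 - a))) ^ s + (L * A) ^ a * σ (ball x ρ) ^ s) := by
          gcongr
          exact hyoung _ _
  have hmain : A ≤ c₀ * (η * (L * A) + C * K + (L * A) ^ a * W) := by
    have hw : Measurable fun ρ : ℝ => ENNReal.ofReal (ρ ^ (-l - 1)) := by fun_prop
    have hm1 : Measurable fun ρ => ω (ball x (2 * ρ)) ^ s * ENNReal.ofReal (ρ ^ (-l - 1)) :=
      (((hmeas ω).comp (measurable_const_mul 2)).pow_const s).mul hw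
    have hm2 : Measurable fun ρ => (κ ρ ^ (q / (1 - a))) ^ s * ENNReal.ofReal (ρ ^ (-l - 1)) := by
      have : Measurable κ :=
        (measurable_embConst_ball hs hq σ).comp (measurable_const.prodMk measurable_id)
      exact ((this.pow_const _).pow_const s).mul hw
    have hm3 : Measurable fun ρ => σ (ball x ρ) ^ s * ENNReal.ofReal (ρ ^ (-l - 1)) :=
      ((hmeas σ).pow_const s).mul hw
    calc A ≤ ∫⁻ ρ in Ioi ε, c₀ * (η * (ω (ball x (2 * ρ)) ^ s * ENNReal.ofReal (ρ ^ (-l - 1))) +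
          C * ((κ ρ ^ (q / (1 - a))) ^ s * ENNReal.ofReal (ρ ^ (-l - 1))) +
          (L * A) ^ a * (σ (ball x ρ) ^ s * ENNReal.ofReal (ρ ^ (-l - 1)))) := by
          refine setLIntegral_mono' measurableSet_Ioi fun ρ hρ => ?_
          refine (mul_le_mul_left (hball ρ hρ) _).trans (le_of_eq ?_)
          ring
      _ = c₀ * (η * radialPot s l (Ioi ε) (fun ρ => ω (ball x (2 * ρ))) +
          C * radialPot s l (Ioi ε) (fun ρ => κ ρ ^ (q / (1 - a))) +
          (L * A) ^ a * radialPot s l (Ioi ε) (fun ρ => σ (ball x ρ))) := by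
          unfold radialPot
          rw [lintegral_const_mul _ (by fun_prop), lintegral_add_right _ (hm3.const_mul _),
            lintegral_add_right _ (hm2.const_mul _), lintegral_const_mul _ hm1,
            lintegral_const_mul _ hm2, lintegral_const_mul _ hm3]
      _ ≤ _ := by
          rw [radialPot_comp_mul (by norm_num : (0 : ℝ) < 2) hε.le fun ρ => ω (ball x ρ)]
          gcongr
          · exact radialPot_mono_set (Ioi_subset_Ioi (by linarith)) _
          · exact radialPot_mono_set (Ioi_subset_Ioi hε.le) _
          · exact radialPot_mono_set (Ioi_subset_Ioi hε.le) _
  have hy2 : (L * A) ^ a * W ≤ η * (L * A) + C * W ^ (1 / (1 - a)) := by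
    have := hyoung (W ^ (1 / (1 - a))) (L * A)
    rwa [← ENNReal.rpow_mul, one_div_mul_cancel ha1.ne', ENNReal.rpow_one, mul_comm W] at this
  have hhalf : A ≤ 2⁻¹ * A + c₀ * C * (K + W ^ (1 / (1 - a))) := by
    calc A ≤ c₀ * (η * (L * A) + C * K + (η * (L * A) + C * W ^ (1 / (1 - a)))) :=
          hmain.trans (by gcongr)
      _ = 2 * (c₀ * L) * η * A + c₀ * C * (K + W ^ (1 / (1 - a))) := by ring
      _ = _ := by
          congr 2
          have h4 : (4 : ℝ≥0∞) * (c₀ * L) = 2 * (2 * (c₀ * L)) := by ring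
          rw [hη, h4, ENNReal.mul_inv (by simp) (by simp), mul_comm, mul_assoc,
            ENNReal.inv_mul_cancel, mul_one] <;> simp [hc0, hL0, hct, hLt, ENNReal.mul_eq_top]
  calc A ≤ 2 * (c₀ * C * (K + W ^ (1 / (1 - a)))) := ENNReal.le_two_mul_of_le_half_add hAt hhalf
    _ = _ := by ring

end UpperBound

/-! ### A Muckenhoupt–Wheeden type inequality -/

theorem ENNReal.add_pow_succ_le (x y : ℝ≥0∞) (k : ℕ) :
    (x + y) ^ (k + 1) ≤ x ^ (k + 1) + (k + 1) * (y * (x + y) ^ k) := by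
  induction k with
  | zero => simp
  | succ k ih =>
    calc (x + y) ^ (k + 1 + 1) = (x + y) ^ (k + 1) * x + y * (x + y) ^ (k + 1) := by ring
      _ ≤ (x ^ (k + 1) + (k + 1) * (y * (x + y) ^ k)) * x + y * (x + y) ^ (k + 1) := by gcongr
      _ = x ^ (k + 1 + 1) + (k + 1) * (y * ((x + y) ^ k * x)) + y * (x + y) ^ (k + 1) := by ring
      _ ≤ x ^ (k + 1 + 1) + (k + 1) * (y * ((x + y) ^ k * (x + y))) + y * (x + y) ^ (k + 1) := by
          gcongr; exact le_self_add
      _ = _ := by push_cast; ring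

theorem ENNReal.sum_range_pow_succ_le (g : ℕ → ℝ≥0∞) (k J : ℕ) :
    (∑ i ∈ Finset.range J, g i) ^ (k + 1) ≤
      (k + 1) * ∑ j ∈ Finset.range J, g j * (∑ i ∈ Finset.range (j + 1), g i) ^ k := by
  induction J with
  | zero => simp
  | succ J ih =>
    rw [Finset.sum_range_succ g J]
    refine (ENNReal.add_pow_succ_le _ _ k).trans ?_
    rw [Finset.sum_range_succ (fun j => g j * (∑ i ∈ Finset.range (j + 1), g i) ^ k) J, mul_add,
      Finset.sum_range_succ g J]
    gcongr

theorem ENNReal.sum_range_pow_add_two_le (g : ℕ → ℝ≥0∞) (k J : ℕ) :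
    (∑ i ∈ Finset.range J, g i) ^ (k + 2) ≤
      ((k + 2) * (k + 1)) * ∑ j ∈ Finset.range J, ∑ i ∈ Finset.range (j + 1),
        g j * (g i * (∑ h ∈ Finset.range (i + 1), g h) ^ k) := by
  refine (ENNReal.sum_range_pow_succ_le g (k + 1) J).trans ?_
  rw [mul_assoc]
  push_cast
  rw [add_assoc, one_add_one_eq_two, Finset.mul_sum _ _ ((k : ℝ≥0∞) + 1)]
  refine mul_le_mul_right (Finset.sum_le_sum fun j _ => ?_) _
  refine (mul_le_mul_right (ENNReal.sum_range_pow_succ_le g k (j + 1)) _).trans (le_of_eq ?_)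
  rw [← Finset.mul_sum]
  ring

theorem ENNReal.tsum_rpow_le_rpow_tsum {ι : Type*} (g : ι → ℝ≥0∞) {p : ℝ} (hp : 1 ≤ p) :
    ∑' i, g i ^ p ≤ (∑' i, g i) ^ p := by
  have hsplit : ∀ x : ℝ≥0∞, x * x ^ (p - 1) = x ^ p := fun x => by
    nth_rewrite 1 [← ENNReal.rpow_one x]
    rw [← ENNReal.rpow_add_of_nonneg _ _ zero_le_one (by linarith)]
    congr 1; ring
  calc ∑' i, g i ^ p ≤ ∑' i, g i * (∑' i, g i) ^ (p - 1) := by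
        refine ENNReal.tsum_le_tsum fun i => ?_
        rw [← hsplit]
        gcongr
        exact ENNReal.le_tsum i
    _ = _ := by rw [ENNReal.tsum_mul_right, hsplit]

/-- Absorption argument for sums of functions whose interactions decay geometrically. -/
theorem exists_lintegral_sum_pow_le {X : Type*} [MeasurableSpace X] {μ : Measure X} (k : ℕ)
    {C C₁ c : ℝ≥0∞} (hC : C ≠ ⊤) (hC₁ : C₁ ≠ ⊤) (hc : c < 1) {g G : ℕ → X → ℝ≥0∞}
    {D : X → ℝ≥0∞} (hg : ∀ i, Measurable (g i)) (hG : ∀ i, Measurable (G i)) (hD : Measurable D)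
    (hGD : ∀ i x, G i x ≤ D x) (hgG : ∀ i x, g i x ≤ G i x)
    (hGg : ∀ i x, G (i + 1) x ≤ C₁ * g i x)
    (hfint : ∀ i j, i ≤ j →
      ∫⁻ x, g j x * (g i x * (∑ h ∈ Finset.range (i + 1), g h x) ^ k) ∂μ ≤
        C * c ^ (j - i) * ∫⁻ x, G i x * (G i x * (∑ h ∈ Finset.range (i + 1), G h x) ^ k) ∂μ)
    (hfin : ∫⁻ x, D x ^ (k + 2) ∂μ ≠ ⊤) :
    ∃ C' : ℝ≥0∞, C' ≠ ⊤ ∧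
      ∀ J, ∫⁻ x, (∑ i ∈ Finset.range J, g i x) ^ (k + 2) ∂μ ≤ C' := by
  have hgeo : (1 - c)⁻¹ ≠ ⊤ := ENNReal.inv_ne_top.2 (tsub_pos_of_lt hc).ne'
  set F : ℕ → X → ℝ≥0∞ := fun J x => ∑ i ∈ Finset.range J, g i x with hF
  set F' : ℕ → X → ℝ≥0∞ := fun J x => ∑ i ∈ Finset.range J, G i x with hF'
  have hFm : ∀ J, Measurable (F J) := fun J => Finset.measurable_sum _ fun i _ => hg i
  have hF'm : ∀ J, Measurable (F' J) := fun J => Finset.measurable_sum _ fun i _ => hG i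
  have hF'le : ∀ J x, F' J x ≤ (1 + C₁) * (D x + F J x) := by
    intro J x
    have : F' J x ≤ D x + C₁ * F J x := by
      rcases J with _ | J
      · simp [hF']
      · simp only [hF', hF, Finset.sum_range_succ' (fun i => G i x) J]
        rw [add_comm]
        refine add_le_add (hGD 0 x) ?_
        rw [Finset.sum_range_succ, mul_add, Finset.mul_sum]
        exact le_add_right (Finset.sum_le_sum fun i _ => hGg i x)
    calc F' J x ≤ D x + C₁ * F J x := this
      _ ≤ (D x + C₁ * F J x) + (F J x + C₁ * D x) := le_self_add
      _ = _ := by ring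
  set M : ℝ≥0∞ := (k + 2) * (k + 1) * (C * (1 - c)⁻¹) * (1 + C₁) ^ (k + 1) * 2 ^ ((k + 2 : ℕ) : ℝ)
    with hM
  have hMt : M ≠ ⊤ := by
    have := ENNReal.two_rpow_ne_top ((k + 2 : ℕ) : ℝ)
    finiteness
  have hη0 : (2 * (M + 1))⁻¹ ≠ 0 := ENNReal.inv_ne_zero.2 (by finiteness)
  have hηt : (2 * (M + 1))⁻¹ ≠ ⊤ := ENNReal.inv_ne_top.2 (by simp)
  set a : ℝ := (k + 1 : ℝ) / (k + 2) with ha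
  have ha0 : 0 < a := by positivity
  have ha1 : a < 1 := by rw [ha, div_lt_one (by positivity)]; linarith
  obtain ⟨C₂, hC₂, hyoung⟩ := ENNReal.exists_young_rpow ha0 ha1 hη0 hηt
  set η := (2 * (M + 1))⁻¹ with hη
  set I := ∫⁻ x, D x ^ (k + 2) ∂μ with hI
  refine ⟨2 * (2⁻¹ * I + M * C₂ * I), by finiteness, fun J => ?_⟩
  have hpt : ∀ x, D x * (D x + F J x) ^ (k + 1) ≤
      2 ^ ((k + 2 : ℕ) : ℝ) * (η * (D x ^ (k + 2) + F J x ^ (k + 2)) + C₂ * D x ^ (k + 2)) := by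
    intro x
    have h := hyoung (D x ^ (k + 2)) ((D x + F J x) ^ (k + 2))
    have e1 : (D x ^ (k + 2)) ^ (1 - a) = D x := by
      rw [← ENNReal.rpow_natCast, ← ENNReal.rpow_mul]
      have : ((k + 2 : ℕ) : ℝ) * (1 - a) = 1 := by
        rw [ha]; push_cast; field_simp; ring
      rw [this, ENNReal.rpow_one]
    have e2 : ((D x + F J x) ^ (k + 2)) ^ a = (D x + F J x) ^ (k + 1) := by
      rw [← ENNReal.rpow_natCast, ← ENNReal.rpow_natCast, ← ENNReal.rpow_mul]
      congr 1
      rw [ha]; push_cast; field_simp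
    rw [e1, e2] at h
    refine h.trans ?_
    have h2 := ENNReal.add_rpow_le_two_rpow_mul (D x) (F J x) (r := ((k + 2 : ℕ) : ℝ)) (by positivity)
    simp only [ENNReal.rpow_natCast] at h2 ⊢
    rw [mul_add, mul_left_comm]
    have h3 : (1 : ℝ≥0∞) ≤ 2 ^ (k + 2) := one_le_pow₀ (by norm_num)
    refine add_le_add (by gcongr) ?_
    calc C₂ * D x ^ (k + 2) = 1 * (C₂ * D x ^ (k + 2)) := (one_mul _).symm
      _ ≤ _ := by gcongr
  have hmain : ∫⁻ x, F J x ^ (k + 2) ∂μ ≤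
      (k + 2) * (k + 1) * (C * (1 - c)⁻¹) * ∫⁻ x, D x * F' J x ^ (k + 1) ∂μ := by
    have hm1 : ∀ i j, Measurable fun x => g j x * (g i x * F (i + 1) x ^ k) := fun i j =>
      (hg j).mul ((hg i).mul ((hFm (i + 1)).pow_const k))
    have hm2 : ∀ i, Measurable fun x => G i x * (G i x * F' (i + 1) x ^ k) := fun i =>
      (hG i).mul ((hG i).mul ((hF'm (i + 1)).pow_const k))
    calc ∫⁻ x, F J x ^ (k + 2) ∂μ
        ≤ ∫⁻ x, ((k + 2) * (k + 1)) * ∑ j ∈ Finset.range J, ∑ i ∈ Finset.range (j + 1),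
          g j x * (g i x * F (i + 1) x ^ k) ∂μ :=
          lintegral_mono fun x => ENNReal.sum_range_pow_add_two_le (fun i => g i x) k J
      _ = ((k + 2) * (k + 1)) * ∑ j ∈ Finset.range J, ∑ i ∈ Finset.range (j + 1),
          ∫⁻ x, g j x * (g i x * F (i + 1) x ^ k) ∂μ := by
          rw [lintegral_const_mul _ (Finset.measurable_sum _ fun j _ =>
            Finset.measurable_sum _ fun i _ => hm1 i j),
            lintegral_finsetSum _ fun j _ => Finset.measurable_sum _ fun i _ => hm1 i j]
          congr 1
          exact Finset.sum_congr rfl fun j _ => lintegral_finsetSum _ fun i _ => hm1 i j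
      _ ≤ ((k + 2) * (k + 1)) * ∑ j ∈ Finset.range J, ∑ i ∈ Finset.range (j + 1),
          C * c ^ (j - i) * ∫⁻ x, G i x * (G i x * F' (i + 1) x ^ k) ∂μ := by
          gcongr with j _ i hi
          exact hfint i j (Nat.lt_succ_iff.1 (Finset.mem_range.1 hi))
      _ = ((k + 2) * (k + 1)) * ∑ i ∈ Finset.range J, ∑ j ∈ Finset.Ico i J,
          C * c ^ (j - i) * ∫⁻ x, G i x * (G i x * F' (i + 1) x ^ k) ∂μ := by
          congr 1
          refine Finset.sum_comm' fun j i => ?_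
          simp only [Finset.mem_range, Finset.mem_Ico]
          omega
      _ ≤ ((k + 2) * (k + 1)) * ∑ i ∈ Finset.range J,
          C * (1 - c)⁻¹ * ∫⁻ x, G i x * (G i x * F' (i + 1) x ^ k) ∂μ := by
          gcongr with i _
          rw [← Finset.sum_mul, ← Finset.mul_sum]
          gcongr
          rw [Finset.sum_Ico_eq_sum_range, ← ENNReal.tsum_geometric]
          simp only [add_tsub_cancel_left]
          exact ENNReal.sum_le_tsum _
      _ = (k + 2) * (k + 1) * (C * (1 - c)⁻¹) *
          ∫⁻ x, ∑ i ∈ Finset.range J, G i x * (G i x * F' (i + 1) x ^ k) ∂μ := by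
          rw [lintegral_finsetSum _ fun i _ => hm2 i, ← Finset.mul_sum]
          ring
      _ ≤ _ := by
          gcongr with x
          calc ∑ i ∈ Finset.range J, G i x * (G i x * F' (i + 1) x ^ k)
              ≤ ∑ i ∈ Finset.range J, D x * (G i x * F' J x ^ k) := by
                gcongr with i hi
                · exact hGD i x
                · simp only [hF']
                  have := Finset.mem_range.1 hi
                  exact Finset.sum_le_sum_of_subset (Finset.range_mono (by omega))
            _ = D x * F' J x ^ (k + 1) := by
                rw [← Finset.mul_sum, ← Finset.sum_mul]
                ring
  have hfinF : ∫⁻ x, F J x ^ (k + 2) ∂μ ≠ ⊤ := by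
    refine ne_top_of_le_ne_top (b := (J : ℝ≥0∞) ^ (k + 2) * I) (by finiteness) ?_
    rw [hI, ← lintegral_const_mul _ (hD.pow_const _)]
    refine lintegral_mono fun x => ?_
    rw [← mul_pow]
    gcongr
    calc F J x ≤ ∑ i ∈ Finset.range J, D x :=
          Finset.sum_le_sum fun i _ => (hgG i x).trans (hGD i x)
      _ = _ := by simp
  refine ENNReal.le_two_mul_of_le_half_add hfinF ?_
  have hηM : M * η ≤ 2⁻¹ := by
    rw [hη, ENNReal.mul_inv (by simp) (by simp), mul_left_comm]
    calc 2⁻¹ * (M * (M + 1)⁻¹) ≤ 2⁻¹ * ((M + 1) * (M + 1)⁻¹) := by gcongr; exact le_self_add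
      _ ≤ 2⁻¹ * 1 := by gcongr; exact ENNReal.mul_inv_le_one _
      _ = _ := mul_one _
  have hDm : Measurable fun x => D x ^ (k + 2) := hD.pow_const _
  have hFJm : Measurable fun x => F J x ^ (k + 2) := (hFm J).pow_const _
  calc ∫⁻ x, F J x ^ (k + 2) ∂μ
      ≤ (k + 2) * (k + 1) * (C * (1 - c)⁻¹) * ∫⁻ x, D x * F' J x ^ (k + 1) ∂μ := hmain
    _ ≤ (k + 2) * (k + 1) * (C * (1 - c)⁻¹) * ∫⁻ x, (1 + C₁) ^ (k + 1) *
        (2 ^ ((k + 2 : ℕ) : ℝ) *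
          (η * (D x ^ (k + 2) + F J x ^ (k + 2)) + C₂ * D x ^ (k + 2))) ∂μ := by
        refine mul_le_mul_right (lintegral_mono fun x => ?_) _
        calc D x * F' J x ^ (k + 1) ≤ D x * ((1 + C₁) * (D x + F J x)) ^ (k + 1) := by
              gcongr; exact hF'le J x
          _ = (1 + C₁) ^ (k + 1) * (D x * (D x + F J x) ^ (k + 1)) := by rw [mul_pow]; ring
          _ ≤ _ := mul_le_mul_right (hpt x) _
    _ = M * η * (I + ∫⁻ x, F J x ^ (k + 2) ∂μ) + M * C₂ * I := by
        rw [lintegral_const_mul _ (by fun_prop), lintegral_const_mul _ (by fun_prop),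
          lintegral_add_left (by fun_prop), lintegral_const_mul _ (by fun_prop),
          lintegral_const_mul _ (by fun_prop), lintegral_add_left hDm, hM]
        ring
    _ ≤ 2⁻¹ * (I + ∫⁻ x, F J x ^ (k + 2) ∂μ) + M * C₂ * I := by gcongr
    _ = _ := by ring

theorem radialPot_Ioo_le_tsum {s l R : ℝ} (hs : 0 ≤ s) (hl : 0 ≤ l) (hR : 0 < R)
    {φ : ℝ → ℝ≥0∞} (hφ : Monotone φ) :
    radialPot s l (Ioo 0 R) φ ≤
      ENNReal.ofReal (2 ^ l) * ∑' i : ℕ, φ (R / 2 ^ i) ^ s * ENNReal.ofReal ((R / 2 ^ i) ^ (-l)) := by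
  have hcover : Ioo 0 R ⊆ ⋃ i : ℕ, Ioc (R / 2 ^ (i + 1)) (R / 2 ^ i) := by
    intro x hx
    obtain ⟨i, hi, hi'⟩ := exists_nat_pow_near ((one_le_div hx.1).2 hx.2.le) one_lt_two
    refine mem_iUnion.2 ⟨i, ?_, ?_⟩
    · rw [div_lt_iff₀ hx.1] at hi'
      rw [div_lt_iff₀ (by positivity)]
      linarith
    · rw [le_div_iff₀ hx.1] at hi
      rw [le_div_iff₀ (by positivity)]
      linarith
  rw [← ENNReal.tsum_mul_left]
  refine (lintegral_mono_set hcover).trans ((lintegral_iUnion_le _ _).trans ?_)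
  refine ENNReal.tsum_le_tsum fun i => ?_
  have hρ : 0 < R / 2 ^ (i + 1) := by positivity
  have h2 : R / 2 ^ i = 2 * (R / 2 ^ (i + 1)) := by rw [pow_succ]; field_simp
  calc ∫⁻ t in Ioc (R / 2 ^ (i + 1)) (R / 2 ^ i), φ t ^ s * ENNReal.ofReal (t ^ (-l - 1))
      ≤ ∫⁻ _ in Ioc (R / 2 ^ (i + 1)) (R / 2 ^ i),
          φ (R / 2 ^ i) ^ s * ENNReal.ofReal ((R / 2 ^ (i + 1)) ^ (-l - 1)) := by
        refine setLIntegral_mono' measurableSet_Ioc fun t ht => ?_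
        gcongr ?_ ^ s * ENNReal.ofReal ?_
        · exact hφ ht.2
        · exact Real.rpow_le_rpow_of_nonpos hρ ht.1.le (by linarith)
    _ = φ (R / 2 ^ i) ^ s * ENNReal.ofReal ((R / 2 ^ (i + 1)) ^ (-l)) := by
        rw [setLIntegral_const, Real.volume_Ioc, mul_assoc, ← ENNReal.ofReal_mul (by positivity), h2]
        congr 2
        rw [show 2 * (R / 2 ^ (i + 1)) - R / 2 ^ (i + 1) = R / 2 ^ (i + 1) by ring,
          Real.rpow_sub_one hρ.ne', div_mul_cancel₀ _ hρ.ne']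
    _ = _ := by
        rw [h2, mul_left_comm, ← ENNReal.ofReal_mul (by positivity),
          Real.mul_rpow zero_le_two hρ.le, ← mul_assoc, ← Real.rpow_add zero_lt_two,
          add_neg_cancel, Real.rpow_zero, one_mul]

section Euclidean

variable {n : ℕ}

theorem volume_ball_eq_ofReal_pow (x : EuclideanSpace ℝ (Fin n)) {ρ : ℝ} (hρ : 0 < ρ) :
    volume (ball x ρ) = ENNReal.ofReal (ρ ^ n) * volume (ball (0 : EuclideanSpace ℝ (Fin n)) 1) := by
  rw [Measure.addHaar_ball_of_pos _ _ hρ, finrank_euclideanSpace_fin]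

theorem measurableSet_dist_lt (ρ : ℝ) :
    MeasurableSet {p : EuclideanSpace ℝ (Fin n) × EuclideanSpace ℝ (Fin n) | dist p.1 p.2 < ρ} :=
  measurableSet_lt measurable_dist measurable_const

theorem lintegral_lintegral_ball_swap (ν : Measure (EuclideanSpace ℝ (Fin n))) [SFinite ν]
    {F : EuclideanSpace ℝ (Fin n) → EuclideanSpace ℝ (Fin n) → ℝ≥0∞}
    (hF : Measurable (Function.uncurry F)) (ρ : ℝ) :
    ∫⁻ x, ∫⁻ y in ball x ρ, F x y ∂ν = ∫⁻ y, (∫⁻ x in ball y ρ, F x y) ∂ν := by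
  have e1 : ∀ x, ∫⁻ y in ball x ρ, F x y ∂ν =
      ∫⁻ y, {p : EuclideanSpace ℝ (Fin n) × EuclideanSpace ℝ (Fin n) | dist p.1 p.2 < ρ}.indicator
        (Function.uncurry F) (x, y) ∂ν := by
    intro x
    rw [← lintegral_indicator measurableSet_ball]
    refine lintegral_congr fun y => ?_
    simp only [indicator, mem_ball, mem_ofPred_eq, dist_comm y x]
    rfl
  have e2 : ∀ y, ∫⁻ x in ball y ρ, F x y =
      ∫⁻ x, {p : EuclideanSpace ℝ (Fin n) × EuclideanSpace ℝ (Fin n) | dist p.1 p.2 < ρ}.indicator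
        (Function.uncurry F) (x, y) := by
    intro y
    rw [← lintegral_indicator measurableSet_ball]
    rfl
  simp only [e1, e2]
  exact lintegral_lintegral_swap (hF.indicator (measurableSet_dist_lt ρ)).aemeasurable

theorem volume_ball_mul_lintegral_le {f H H' : EuclideanSpace ℝ (Fin n) → ℝ≥0∞} (hf : Measurable f)
    (hH : Measurable H) (hH' : Measurable H') {ρ : ℝ} (hρ : 0 < ρ)
    (h : ∀ x y, dist x y < ρ → H x ≤ H' y) (z : EuclideanSpace ℝ (Fin n)) :
    volume (ball z ρ) * ∫⁻ x, f x * H x ≤ ∫⁻ y, H' y * ∫⁻ x in ball y ρ, f x := by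
  have hvol : ∀ x, volume (ball x ρ) = volume (ball z ρ) := fun x => by
    rw [volume_ball_eq_ofReal_pow x hρ, volume_ball_eq_ofReal_pow z hρ]
  have hmeas : Measurable (Function.uncurry fun x y => f x * H' y) :=
    (hf.comp measurable_fst).mul (hH'.comp measurable_snd)
  calc volume (ball z ρ) * ∫⁻ x, f x * H x = ∫⁻ x, ∫⁻ _ in ball x ρ, f x * H x := by
        rw [← lintegral_const_mul _ (by fun_prop)]
        refine lintegral_congr fun x => ?_
        rw [setLIntegral_const, hvol x, mul_comm]
    _ ≤ ∫⁻ x, ∫⁻ y in ball x ρ, f x * H' y := by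
        refine lintegral_mono fun x => setLIntegral_mono' measurableSet_ball fun y hy => ?_
        gcongr
        exact h x y (by rwa [dist_comm])
    _ = ∫⁻ y, ∫⁻ x in ball y ρ, f x * H' y := lintegral_lintegral_ball_swap volume hmeas ρ
    _ = _ := by
        refine lintegral_congr fun y => ?_
        rw [lintegral_mul_const _ hf, mul_comm]

theorem setLIntegral_measure_ball_le (ν : Measure (EuclideanSpace ℝ (Fin n))) [SFinite ν]
    (y : EuclideanSpace ℝ (Fin n)) {ρ t : ℝ} (hρ : 0 < ρ) (ht : ρ ≤ t) :
    ∫⁻ x in ball y t, ν (ball x ρ) ≤ volume (ball y ρ) * ν (ball y (2 * t)) := by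
  have hvol : ∀ x, volume (ball x ρ) = volume (ball y ρ) := fun x => by
    rw [volume_ball_eq_ofReal_pow x hρ, volume_ball_eq_ofReal_pow y hρ]
  have hind : Measurable ((ball y (2 * t)).indicator (1 : EuclideanSpace ℝ (Fin n) → ℝ≥0∞)) :=
    measurable_one.indicator measurableSet_ball
  calc ∫⁻ x in ball y t, ν (ball x ρ)
      ≤ ∫⁻ x, ∫⁻ z in ball x ρ, (ball y (2 * t)).indicator 1 z ∂ν := by
        rw [← lintegral_indicator measurableSet_ball]
        refine lintegral_mono fun x => ?_
        by_cases hx : x ∈ ball y t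
        · rw [indicator_of_mem hx, ← setLIntegral_one]
          refine setLIntegral_mono' measurableSet_ball fun z hz => ?_
          rw [indicator_of_mem, Pi.one_apply]
          have := dist_triangle z x y
          simp only [mem_ball] at hx hz ⊢
          linarith
        · rw [indicator_of_notMem hx]
          exact zero_le
    _ = ∫⁻ z, (∫⁻ _ in ball z ρ, (ball y (2 * t)).indicator 1 z) ∂ν :=
        lintegral_lintegral_ball_swap ν (F := fun _ z => (ball y (2 * t)).indicator 1 z)
          (hind.comp measurable_snd) ρ
    _ = _ := by
        simp only [setLIntegral_const, hvol]
        rw [lintegral_mul_const _ hind,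
          lintegral_indicator_one measurableSet_ball, mul_comm]

theorem setLIntegral_rpow_le {X : Type*} [MeasurableSpace X] {μ : Measure X} {f : X → ℝ≥0∞}
    (hf : Measurable f) {τ : ℝ} (h0 : 0 ≤ τ) (h1 : τ ≤ 1) (A : Set X) :
    ∫⁻ x in A, f x ^ τ ∂μ ≤ μ A ^ (1 - τ) * (∫⁻ x in A, f x ∂μ) ^ τ := by
  have := ENNReal.lintegral_mul_norm_pow_le (μ := μ.restrict A) (f := fun _ => 1) (g := f)
    (by fun_prop) hf.aemeasurable (p := 1 - τ) (q := τ) (by linarith) h0 (by ring)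
  simpa using this

theorem lintegral_radialPot_rpow_lt_top {s r β R : ℝ} (hs : 0 < s) (hr : 0 < r) (hβ₀ : 0 < β)
    (hβ : β < n) (hR : 0 < R) {C₀ : ℝ≥0∞} (hC₀ : C₀ ≠ ⊤)
    {Φ : EuclideanSpace ℝ (Fin n) → ℝ → ℝ≥0∞} (hΦ : Measurable (Function.uncurry Φ))
    (hmono : ∀ x y ρ t, dist x y + ρ ≤ t → Φ x ρ ≤ Φ y t)
    (havg : ∀ y ρ t, 0 < ρ → ρ ≤ t →
      ∫⁻ x in ball y t, Φ x ρ ≤ C₀ * volume (ball y ρ) * Φ y (2 * t))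
    (hfin : ∫⁻ x, (⨆ i : ℕ, Φ x (2 * (R / 2 ^ i)) * ENNReal.ofReal ((R / 2 ^ i) ^ (-β))) ^ (s * r)
      < ⊤) :
    ∫⁻ x, radialPot s (β * s) (Ioo 0 R) (Φ x) ^ r < ⊤ := by
  have hρ : ∀ i : ℕ, 0 < R / 2 ^ i := fun i => by positivity
  have hρmono : ∀ i j : ℕ, i ≤ j → R / 2 ^ j ≤ R / 2 ^ i := fun i j hij => by
    gcongr; exact one_le_two
  set ρ : ℕ → ℝ := fun i => R / 2 ^ i with hρdef
  obtain ⟨k, hk⟩ := exists_nat_ge (max r (s * r))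
  have hk1 : r ≤ k + 2 := by linarith [le_max_left r (s * r)]
  have hk2 : s * r ≤ k + 2 := by linarith [le_max_right r (s * r)]
  set δ : ℝ := r / (k + 2) with hδ
  have hδ0 : 0 < δ := by positivity
  have hδ1 : δ ≤ 1 := by rw [hδ, div_le_one (by positivity)]; exact hk1
  set τ : ℝ := s * δ with hτ
  have hτ0 : 0 < τ := by positivity
  have hτ1 : τ ≤ 1 := by
    rw [hτ, hδ, ← mul_div_assoc, div_le_one (by positivity)]; exact hk2
  set w : ℕ → ℝ≥0∞ := fun i => ENNReal.ofReal (ρ i ^ (-(β * τ))) with hw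
  set g : ℕ → EuclideanSpace ℝ (Fin n) → ℝ≥0∞ := fun i x => Φ x (ρ i) ^ τ * w i with hg
  set G : ℕ → EuclideanSpace ℝ (Fin n) → ℝ≥0∞ := fun i x => Φ x (2 * ρ i) ^ τ * w i with hG
  set S : EuclideanSpace ℝ (Fin n) → ℝ≥0∞ :=
    fun x => ⨆ i : ℕ, Φ x (2 * ρ i) * ENNReal.ofReal (ρ i ^ (-β)) with hS
  have hΦm : ∀ t, Measurable fun x => Φ x t := fun t =>
    hΦ.comp (measurable_id.prodMk measurable_const)
  have hSm : Measurable S := Measurable.iSup fun i => (hΦm _).mul_const _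
  have hgm : ∀ i, Measurable (g i) := fun i => ((hΦm _).pow_const _).mul_const _
  have hGm : ∀ i, Measurable (G i) := fun i => ((hΦm _).pow_const _).mul_const _
  have hpull : ∀ i h x y, h ≤ i → dist x y < ρ i → g h x ≤ G h y := fun i h x y hhi hxy => by
    simp only [hg, hG]
    gcongr
    refine hmono _ _ _ _ ?_
    have : ρ i ≤ ρ h := hρmono h i hhi
    linarith
  have hgG : ∀ i x, g i x ≤ G i x := fun i x =>
    hpull i i x x le_rfl (by rw [dist_self]; exact hρ i)
  have hc : ENNReal.ofReal (2 ^ (-((n - β) * τ))) < 1 := by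
    rw [ENNReal.ofReal_lt_one]
    exact Real.rpow_lt_one_of_one_lt_of_neg one_lt_two (by nlinarith)
  have hscale : ∀ i j, i ≤ j → w j * ENNReal.ofReal ((1 / 2 ^ (j - i)) ^ n) ^ τ =
      w i * ENNReal.ofReal (2 ^ (-((n - β) * τ))) ^ (j - i) := by
    intro i j hij
    obtain ⟨d, rfl⟩ := Nat.exists_eq_add_of_le hij
    simp only [add_tsub_cancel_left, hw]
    have e : ρ (i + d) = ρ i * 2 ^ (-(d : ℝ)) := by
      simp only [hρdef]
      rw [Real.rpow_neg zero_le_two, Real.rpow_natCast, pow_add]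
      field_simp
    rw [ENNReal.ofReal_rpow_of_nonneg (by positivity) hτ0.le, ← ENNReal.ofReal_pow (by positivity),
      ← ENNReal.ofReal_mul (by have := hρ (i + d); positivity),
      ← ENNReal.ofReal_mul (by have := hρ i; positivity)]
    congr 1
    rw [e, Real.mul_rpow (hρ i).le (by positivity), mul_assoc]
    congr 1
    rw [one_div, ← Real.rpow_natCast, ← Real.rpow_natCast, ← Real.rpow_natCast,
      ← Real.rpow_neg zero_le_two, ← Real.rpow_mul zero_le_two, ← Real.rpow_mul zero_le_two,
      ← Real.rpow_mul zero_le_two, ← Real.rpow_mul zero_le_two, ← Real.rpow_add zero_lt_two]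
    congr 1
    ring
  have hinner : ∀ i j, i ≤ j → ∀ y, ∫⁻ x in ball y (ρ i), g j x ≤
      volume (ball y (ρ i)) * (C₀ ^ τ * ENNReal.ofReal (2 ^ (-((n - β) * τ))) ^ (j - i) * G i y) := by
    intro i j hij y
    have hvol : volume (ball y (ρ j)) =
        ENNReal.ofReal ((1 / 2 ^ (j - i)) ^ n) * volume (ball y (ρ i)) := by
      rw [volume_ball_eq_ofReal_pow y (hρ j), volume_ball_eq_ofReal_pow y (hρ i), ← mul_assoc,
        ← ENNReal.ofReal_mul (by positivity), ← mul_pow]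
      congr 3
      obtain ⟨d, rfl⟩ := Nat.exists_eq_add_of_le hij
      simp only [add_tsub_cancel_left, pow_add]
      field_simp
    have hsplit : volume (ball y (ρ i)) ^ (1 - τ) * volume (ball y (ρ i)) ^ τ =
        volume (ball y (ρ i)) := ENNReal.rpow_one_sub_mul_rpow_self _ hτ0.le hτ1
    calc ∫⁻ x in ball y (ρ i), g j x
        = (∫⁻ x in ball y (ρ i), Φ x (ρ j) ^ τ) * w j := by
          simp only [hg]
          rw [lintegral_mul_const _ ((hΦm _).pow_const _)]
      _ ≤ (volume (ball y (ρ i)) ^ (1 - τ) *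
          (C₀ * volume (ball y (ρ j)) * Φ y (2 * ρ i)) ^ τ) * w j := by
          gcongr
          refine (setLIntegral_rpow_le (hΦm _) hτ0.le hτ1 _).trans ?_
          gcongr
          exact havg y (ρ j) (ρ i) (hρ j) (hρmono i j hij)
      _ = (volume (ball y (ρ i)) ^ (1 - τ) * volume (ball y (ρ i)) ^ τ) *
          (C₀ ^ τ * (w j * ENNReal.ofReal ((1 / 2 ^ (j - i)) ^ n) ^ τ) * Φ y (2 * ρ i) ^ τ) := by
          rw [hvol, ENNReal.mul_rpow_of_nonneg _ _ hτ0.le, ENNReal.mul_rpow_of_nonneg _ _ hτ0.le,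
            ENNReal.mul_rpow_of_nonneg _ _ hτ0.le]
          ring
      _ = _ := by
          rw [hsplit, hscale i j hij]
          simp only [hG]
          ring
  have hDpow : ∀ x, (S x ^ τ) ^ (k + 2) = S x ^ (s * r) := fun x => by
    rw [← ENNReal.rpow_natCast, ← ENNReal.rpow_mul]
    congr 1
    rw [hτ, hδ]; push_cast; field_simp
  have hGD : ∀ i x, G i x ≤ S x ^ τ := by
    intro i x
    refine le_trans (le_of_eq ?_) (ENNReal.rpow_le_rpow
      (le_iSup (fun i => Φ x (2 * ρ i) * ENNReal.ofReal (ρ i ^ (-β))) i) hτ0.le)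
    have := hρ i
    rw [ENNReal.mul_rpow_of_nonneg _ _ hτ0.le,
      ENNReal.ofReal_rpow_of_nonneg (by positivity) hτ0.le, ← Real.rpow_mul this.le, neg_mul]
  have hGg : ∀ i x, G (i + 1) x ≤ ENNReal.ofReal (2 ^ (β * τ)) * g i x := by
    intro i x
    have e : 2 * ρ (i + 1) = ρ i := by
      simp only [hρdef]; rw [pow_succ]; field_simp
    simp only [hG, hg, hw]
    rw [e, mul_left_comm (ENNReal.ofReal _), ← ENNReal.ofReal_mul (by positivity), ← e,
      Real.mul_rpow zero_le_two (hρ _).le, ← mul_assoc (2 ^ (β * τ) : ℝ),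
      ← Real.rpow_add zero_lt_two, add_neg_cancel, Real.rpow_zero, one_mul]
  have hfint : ∀ i j, i ≤ j →
      ∫⁻ x, g j x * (g i x * (∑ h ∈ Finset.range (i + 1), g h x) ^ k) ≤
        C₀ ^ τ * ENNReal.ofReal (2 ^ (-((n - β) * τ))) ^ (j - i) *
          ∫⁻ x, G i x * (G i x * (∑ h ∈ Finset.range (i + 1), G h x) ^ k) := by
    intro i j hij
    have hV0 : volume (ball (0 : EuclideanSpace ℝ (Fin n)) (ρ i)) ≠ 0 :=
      (measure_ball_pos _ _ (hρ i)).ne'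
    have hVt : volume (ball (0 : EuclideanSpace ℝ (Fin n)) (ρ i)) ≠ ⊤ := measure_ball_lt_top.ne
    have hFm : Measurable fun x => ∑ h ∈ Finset.range (i + 1), g h x :=
      Finset.measurable_sum _ fun h _ => hgm h
    have hF'm : Measurable fun x => ∑ h ∈ Finset.range (i + 1), G h x :=
      Finset.measurable_sum _ fun h _ => hGm h
    rw [← ENNReal.mul_le_mul_iff_right hV0 hVt]
    refine (volume_ball_mul_lintegral_le (H' := fun y =>
      G i y * (∑ h ∈ Finset.range (i + 1), G h y) ^ k) (hgm j) ((hgm i).mul (hFm.pow_const k))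
      ((hGm i).mul (hF'm.pow_const k)) (hρ i) (fun x y hxy => ?_) 0).trans ?_
    · refine mul_le_mul' (hpull i i x y le_rfl hxy) (pow_le_pow_left' (Finset.sum_le_sum
        fun h hh => hpull i h x y (Nat.lt_succ_iff.1 (Finset.mem_range.1 hh)) hxy) _)
    · rw [← lintegral_const_mul _ (by fun_prop), ← lintegral_const_mul _ (by fun_prop)]
      refine lintegral_mono fun y => ?_
      refine (mul_le_mul_right (hinner i j hij y) _).trans (le_of_eq ?_)
      rw [volume_ball_eq_ofReal_pow y (hρ i), volume_ball_eq_ofReal_pow 0 (hρ i)]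
      ring
  obtain ⟨C', hC', hbound⟩ := exists_lintegral_sum_pow_le (μ := volume) k
    (C := C₀ ^ τ) (C₁ := ENNReal.ofReal (2 ^ (β * τ)))
    (c := ENNReal.ofReal (2 ^ (-((n - β) * τ)))) (g := g) (G := G) (D := fun x => S x ^ τ)
    (ENNReal.rpow_ne_top_of_nonneg hτ0.le hC₀) ENNReal.ofReal_ne_top hc hgm hGm
    (hSm.pow_const _) hGD hgG hGg hfint (by simp only [hDpow]; exact hfin.ne)
  have hpt : ∀ x, radialPot s (β * s) (Ioo 0 R) (Φ x) ^ r ≤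
      ENNReal.ofReal (2 ^ (β * s)) ^ r *
        ⨆ J, (∑ i ∈ Finset.range J, g i x) ^ (k + 2) := by
    intro x
    have hΦmono : Monotone (Φ x) := fun a b hab => hmono x x a b (by simpa using hab)
    have hterm : ∀ i, Φ x (ρ i) ^ s * ENNReal.ofReal (ρ i ^ (-(β * s))) = g i x ^ (1 / δ) := by
      intro i
      have := hρ i
      simp only [hg, hw]
      rw [ENNReal.mul_rpow_of_nonneg _ _ (by positivity), ← ENNReal.rpow_mul,
        ENNReal.ofReal_rpow_of_nonneg (by positivity) (by positivity), ← Real.rpow_mul this.le]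
      congr 3
      · rw [hτ]; field_simp
      · rw [hτ]; field_simp
    have h1 := radialPot_Ioo_le_tsum hs.le (by positivity : 0 ≤ β * s) hR hΦmono
    have h2 : ∑' i : ℕ, Φ x (ρ i) ^ s * ENNReal.ofReal (ρ i ^ (-(β * s))) ≤
        (∑' i, g i x) ^ (1 / δ) := by
      simp only [hterm]
      exact ENNReal.tsum_rpow_le_rpow_tsum _ (by rw [le_div_iff₀ hδ0]; linarith)
    calc radialPot s (β * s) (Ioo 0 R) (Φ x) ^ r
        ≤ (ENNReal.ofReal (2 ^ (β * s)) * (∑' i, g i x) ^ (1 / δ)) ^ r :=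
          ENNReal.rpow_le_rpow (h1.trans (mul_le_mul_right h2 _)) hr.le
      _ = ENNReal.ofReal (2 ^ (β * s)) ^ r * (∑' i, g i x) ^ ((k + 2 : ℕ) : ℝ) := by
          rw [ENNReal.mul_rpow_of_nonneg _ _ hr.le, ← ENNReal.rpow_mul]
          congr 2
          rw [hδ]; push_cast; field_simp
      _ = _ := by
          rw [ENNReal.tsum_eq_iSup_nat, ENNReal.iSup_rpow_const _ (by positivity)]
          simp only [ENNReal.rpow_natCast]
  refine (lintegral_mono hpt).trans_lt ?_
  have hFm : ∀ J, Measurable fun x => (∑ i ∈ Finset.range J, g i x) ^ (k + 2) := fun J =>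
    (Finset.measurable_sum _ fun i _ => hgm i).pow_const _
  rw [lintegral_const_mul _ (Measurable.iSup hFm), lintegral_iSup hFm]
  · refine ENNReal.mul_lt_top (ENNReal.rpow_ne_top_of_nonneg hr.le ENNReal.ofReal_ne_top).lt_top ?_
    exact (iSup_le hbound).trans_lt hC'.lt_top
  · intro I J hIJ x
    dsimp only
    gcongr

end Euclidean

section LocalPotentials

variable {n : ℕ} {s l q : ℝ}

theorem setLIntegral_embConst_rpow_le (hs : 0 < s) (hl : 0 < l) (hq : 0 < q) (hqs : q * s < 1)
    (σ : Measure (EuclideanSpace ℝ (Fin n))) [IsLocallyFiniteMeasure σ]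
    (y : EuclideanSpace ℝ (Fin n)) {ρ t : ℝ} (hρ : 0 < ρ) (ht : ρ ≤ t) :
    ∫⁻ x in ball y t, embConst s l q σ (ball x ρ) ^ (q / (1 - q * s)) ≤
      (supersolConst s l q ^ (1 / (1 - q * s)) + 1) * volume (ball y ρ) *
        embConst s l q σ (ball y (2 * t)) ^ (q / (1 - q * s)) := by
  have ha1 : 0 < 1 - q * s := by linarith
  have hθ : 0 < q / (1 - q * s) := by positivity
  have hV : volume (ball y ρ) ≠ 0 := (measure_ball_pos _ _ hρ).ne'
  by_cases hκ : embConst s l q σ (ball y (2 * t)) = ⊤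
  · rw [hκ, ENNReal.top_rpow_of_pos hθ, ENNReal.mul_top (by simp [hV])]
    exact le_top
  obtain ⟨ω, hω, hle⟩ := exists_measure_embConst_le hs hl hq hqs σ (by linarith : 0 < 2 * t)
    measure_ball_lt_top hκ
  have : IsFiniteMeasure ω := ⟨hω.trans_lt (ENNReal.rpow_ne_top_of_nonneg hθ.le hκ).lt_top⟩
  have h1 : ∫⁻ x in ball y t, embConst s l q σ (ball x ρ) ^ (q / (1 - q * s)) ≤
      ∫⁻ x in ball y t, supersolConst s l q ^ (1 / (1 - q * s)) * ω (ball x ρ) := by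
    refine setLIntegral_mono' measurableSet_ball fun x hx => hle x ρ (ball_subset_ball' ?_)
    have : dist x y < t := hx
    linarith
  have h2 : ∫⁻ x in ball y t, supersolConst s l q ^ (1 / (1 - q * s)) * ω (ball x ρ) =
      supersolConst s l q ^ (1 / (1 - q * s)) * ∫⁻ x in ball y t, ω (ball x ρ) :=
    lintegral_const_mul' _ _ (ENNReal.rpow_ne_top_of_nonneg (by positivity)
      (supersolConst_ne_top hq hqs))
  have h3 : ω (ball y (2 * t)) ≤ embConst s l q σ (ball y (2 * t)) ^ (q / (1 - q * s)) :=
    (measure_mono (subset_univ _)).trans hω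
  rw [mul_assoc]
  exact (h1.trans_eq h2).trans (mul_le_mul' le_self_add
    ((setLIntegral_measure_ball_le ω y hρ ht).trans (mul_le_mul' le_rfl h3)))

/-- Density of `σ` on a ball is controlled by the embedding constant. -/
theorem measure_ball_mul_rpow_le_embConst (hs : 0 < s) (hq : 0 < q) (hqs : q * s < 1) {β : ℝ}
    (hβ : 0 < β) (σ : Measure (EuclideanSpace ℝ (Fin n))) (x : EuclideanSpace ℝ (Fin n)) {ρ : ℝ}
    (hρ : 0 < ρ) :
    (σ (ball x ρ) * ENNReal.ofReal (ρ ^ (-β))) ^ (1 / (1 - q * s)) ≤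
      ENNReal.ofReal (β * s) ^ (q / (1 - q * s)) *
        (embConst s (β * s) q σ (ball x ρ) ^ (q / (1 - q * s)) * ENNReal.ofReal (ρ ^ (-β))) := by
  have ha1 : 0 < 1 - q * s := by linarith
  have hl : 0 < β * s := by positivity
  have h := measure_ball_mul_le_embConst hs hl hq σ x hρ
  have e1 : σ (ball x ρ) * ENNReal.ofReal (ρ ^ (-β)) =
      ENNReal.ofReal (β * s) ^ q * (σ (ball x ρ) * ENNReal.ofReal (ρ ^ (-(β * s)) / (β * s)) ^ q) *
        ENNReal.ofReal (ρ ^ (-β)) ^ (1 - q * s) := by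
    have : ENNReal.ofReal (β * s) ^ q * ENNReal.ofReal (ρ ^ (-(β * s)) / (β * s)) ^ q *
        ENNReal.ofReal (ρ ^ (-β)) ^ (1 - q * s) = ENNReal.ofReal (ρ ^ (-β)) := by
      rw [← ENNReal.mul_rpow_of_nonneg _ _ hq.le, ← ENNReal.ofReal_mul hl.le,
        mul_div_cancel₀ _ hl.ne', ENNReal.ofReal_rpow_of_nonneg (by positivity) hq.le,
        ENNReal.ofReal_rpow_of_nonneg (by positivity) ha1.le, ← ENNReal.ofReal_mul (by positivity),
        ← Real.rpow_mul hρ.le, ← Real.rpow_mul hρ.le, ← Real.rpow_add hρ]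
      congr 2
      ring
    nth_rewrite 1 [← this]
    ring
  calc (σ (ball x ρ) * ENNReal.ofReal (ρ ^ (-β))) ^ (1 / (1 - q * s))
      ≤ (ENNReal.ofReal (β * s) ^ q * embConst s (β * s) q σ (ball x ρ) ^ q *
          ENNReal.ofReal (ρ ^ (-β)) ^ (1 - q * s)) ^ (1 / (1 - q * s)) := by
        rw [e1]; gcongr
    _ = _ := by
        have h1 : 0 ≤ 1 / (1 - q * s) := by positivity
        rw [ENNReal.mul_rpow_of_nonneg _ _ h1, ENNReal.mul_rpow_of_nonneg _ _ h1]
        simp only [← ENNReal.rpow_mul]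
        rw [mul_one_div_cancel ha1.ne', ENNReal.rpow_one, mul_one_div, mul_assoc]

/-- Finiteness of the local parts of the intrinsic potential and of the Wolff potential. -/
theorem lintegral_local_potentials_lt_top {r β R : ℝ} (hs : 0 < s) (hq : 0 < q) (hqs : q * s < 1)
    (hr : 0 < r) (hβ₀ : 0 < β) (hβ : β < n) (hR : 0 < R)
    (σ : Measure (EuclideanSpace ℝ (Fin n))) [IsFiniteMeasure σ]
    (hfin : ∫⁻ x, (⨆ i : ℕ, embConst s (β * s) q σ (ball x (2 * (R / 2 ^ i))) ^ (q / (1 - q * s)) *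
      ENNReal.ofReal ((R / 2 ^ i) ^ (-β))) ^ (s * r) < ⊤) :
    (∫⁻ x, radialPot s (β * s) (Ioo 0 R)
        (fun ρ => embConst s (β * s) q σ (ball x ρ) ^ (q / (1 - q * s))) ^ r < ⊤) ∧
      ∫⁻ x, radialPot s (β * s) (Ioo 0 R) (fun ρ => σ (ball x ρ)) ^ (r / (1 - q * s)) < ⊤ := by
  have ha1 : 0 < 1 - q * s := by linarith
  have hl : 0 < β * s := by positivity
  have hC₀ : supersolConst s (β * s) q ^ (1 / (1 - q * s)) + 1 ≠ ⊤ := by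
    have := ENNReal.rpow_ne_top_of_nonneg (by positivity : 0 ≤ 1 / (1 - q * s))
      (supersolConst_ne_top (l := β * s) hq hqs)
    finiteness
  constructor
  · refine lintegral_radialPot_rpow_lt_top hs hr hβ₀ hβ hR hC₀
      ((measurable_embConst_ball hs hq σ).pow_const _) (fun x y ρ t h => ?_)
      (fun y ρ t hρ ht => setLIntegral_embConst_rpow_le hs hl hq hqs σ y hρ ht) hfin
    exact ENNReal.rpow_le_rpow (ball_mono_embConst hs hq σ x y ρ t h) (by positivity)
  · refine lintegral_radialPot_rpow_lt_top hs (by positivity) hβ₀ hβ hR ENNReal.one_ne_top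
      (measurable_measure_ball σ) (ball_mono_measure σ)
      (fun y ρ t hρ ht => by rw [one_mul]; exact setLIntegral_measure_ball_le σ y hρ ht) ?_
    set c : ℝ≥0∞ := (ENNReal.ofReal (2 ^ β) ^ (1 / (1 - q * s)) *
      (ENNReal.ofReal (β * s) ^ (q / (1 - q * s)))) ^ (s * r) with hc
    have hct : c ≠ ⊤ := by
      have h1 := ENNReal.rpow_ne_top_of_nonneg (by positivity : 0 ≤ 1 / (1 - q * s))
        (ENNReal.ofReal_ne_top (r := 2 ^ β))
      have h2 := ENNReal.rpow_ne_top_of_nonneg (by positivity : 0 ≤ q / (1 - q * s))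
        (ENNReal.ofReal_ne_top (r := β * s))
      exact ENNReal.rpow_ne_top_of_nonneg (by positivity) (ENNReal.mul_ne_top h1 h2)
    refine lt_of_le_of_lt ?_ (ENNReal.mul_lt_top hct.lt_top hfin)
    rw [← lintegral_const_mul' _ _ hct]
    refine lintegral_mono fun x => ?_
    rw [show s * (r / (1 - q * s)) = 1 / (1 - q * s) * (s * r) by field_simp, ENNReal.rpow_mul, hc,
      ← ENNReal.mul_rpow_of_nonneg _ _ (by positivity : 0 ≤ s * r)]
    refine ENNReal.rpow_le_rpow ?_ (by positivity)
    rw [ENNReal.iSup_rpow_const _ (by positivity), ENNReal.mul_iSup]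
    refine iSup_mono fun i => ?_
    have hρ : 0 < R / 2 ^ i := by positivity
    have e : ENNReal.ofReal ((R / 2 ^ i) ^ (-β)) =
        ENNReal.ofReal (2 ^ β) * ENNReal.ofReal ((2 * (R / 2 ^ i)) ^ (-β)) := by
      rw [← ENNReal.ofReal_mul (by positivity), Real.mul_rpow zero_le_two hρ.le, ← mul_assoc,
        ← Real.rpow_add zero_lt_two, add_neg_cancel, Real.rpow_zero, one_mul]
    have h := measure_ball_mul_rpow_le_embConst hs hq hqs hβ₀ σ x
      (by positivity : 0 < 2 * (R / 2 ^ i))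
    calc (σ (ball x (2 * (R / 2 ^ i))) * ENNReal.ofReal ((R / 2 ^ i) ^ (-β))) ^ (1 / (1 - q * s))
        = ENNReal.ofReal (2 ^ β) ^ (1 / (1 - q * s)) * (σ (ball x (2 * (R / 2 ^ i))) *
          ENNReal.ofReal ((2 * (R / 2 ^ i)) ^ (-β))) ^ (1 / (1 - q * s)) := by
          rw [← ENNReal.mul_rpow_of_nonneg _ _ (by positivity), e]
          congr 1
          ring
      _ ≤ ENNReal.ofReal (2 ^ β) ^ (1 / (1 - q * s)) * (ENNReal.ofReal (β * s) ^ (q / (1 - q * s)) *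
          (embConst s (β * s) q σ (ball x (2 * (R / 2 ^ i))) ^ (q / (1 - q * s)) *
            ENNReal.ofReal ((R / 2 ^ i) ^ (-β)))) := by
          refine mul_le_mul' le_rfl (h.trans (mul_le_mul' le_rfl (mul_le_mul' le_rfl ?_)))
          exact ENNReal.ofReal_le_ofReal
            (Real.rpow_le_rpow_of_nonpos hρ (by linarith) (by linarith))
      _ = _ := by ring

end LocalPotentials

section Necessity

variable {s l q : ℝ}

theorem antitone_radialPot_Ioi (φ : ℝ → ℝ≥0∞) : Antitone fun t => radialPot s l (Ioi t) φ :=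
  fun _ _ h => radialPot_mono_set (Ioi_subset_Ioi h) φ

theorem radialPot_sublevel_le {t₀ : ℝ} {ψ : ℝ → ℝ≥0∞} (c : ℝ≥0∞) :
    radialPot s l {ρ | t₀ < ρ ∧ radialPot s l (Ioi ρ) ψ ≤ c} ψ ≤ c := by
  set S := {ρ | t₀ < ρ ∧ radialPot s l (Ioi ρ) ψ ≤ c} with hS
  rcases S.eq_empty_or_nonempty with h | hne
  · rw [h]; simp [radialPot]
  have hbdd : BddBelow S := ⟨t₀, fun ρ hρ => hρ.1.le⟩
  have hsub : S ⊆ Ici (sInf S) := fun ρ hρ => csInf_le hbdd hρ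
  refine (radialPot_mono_set hsub ψ).trans ?_
  have : radialPot s l (Ici (sInf S)) ψ = radialPot s l (Ioi (sInf S)) ψ := by
    unfold radialPot
    rw [Measure.restrict_congr_set Ioi_ae_eq_Ici]
  rw [this]
  refine radialPot_Ioi_le_of_forall fun t ht => ?_
  obtain ⟨ρ, hρ, hρt⟩ := exists_lt_of_csInf_lt hne ht
  exact (antitone_radialPot_Ioi ψ hρt.le).trans hρ.2

/-- If `g^q φ ≤ c ψ`, where `g` is the tail of the potential of `ψ`, then finiteness of the
potential of `ψ` passes to `φ`. -/
theorem radialPot_lt_top_of_tail_rpow_mul_le (hs : 0 < s) (hq : 0 < q) (hqs : q * s < 1) {t₀ : ℝ}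
    {φ ψ : ℝ → ℝ≥0∞} {c : ℝ≥0∞} (hc : c ≠ ⊤) (hfin : radialPot s l (Ioi t₀) ψ < ⊤)
    (hpos : ∀ ρ, t₀ < ρ → 0 < radialPot s l (Ioi ρ) ψ)
    (h : ∀ ρ, t₀ < ρ → radialPot s l (Ioi ρ) ψ ^ q * φ ρ ≤ c * ψ ρ) :
    radialPot s l (Ioi t₀) φ < ⊤ := by
  have ha0 : 0 < q * s := by positivity
  have ha1 : 0 < 1 - q * s := by linarith
  set g : ℝ → ℝ≥0∞ := fun t => radialPot s l (Ioi t) ψ with hg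
  have hganti : Antitone g := antitone_radialPot_Ioi ψ
  set G := g t₀ with hG
  have hGt : G ≠ ⊤ := hfin.ne
  have hG0 : G ≠ 0 := ((hpos (t₀ + 1) (by linarith)).trans_le (hganti (by linarith))).ne'
  set b : ℕ → ℝ≥0∞ := fun k => G * 2⁻¹ ^ k with hb
  have hb0 : ∀ k, b k ≠ 0 := fun k => mul_ne_zero hG0 (by simp)
  have hbt : ∀ k, b k ≠ ⊤ := fun k => ENNReal.mul_ne_top hGt (by finiteness)
  set A : ℕ → Set ℝ := fun k => Ioi t₀ ∩ {ρ | b (k + 1) < g ρ ∧ g ρ ≤ b k} with hA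
  have hAm : ∀ k, MeasurableSet (A k) := fun k =>
    measurableSet_Ioi.inter ((measurableSet_lt measurable_const hganti.measurable).inter
      (measurableSet_le hganti.measurable measurable_const))
  have hlim : Filter.Tendsto b Filter.atTop (nhds 0) := by
    have := ENNReal.Tendsto.const_mul (a := G)
      (ENNReal.tendsto_pow_atTop_nhds_zero_of_lt_one (r := 2⁻¹) (by simp)) (Or.inr hGt)
    simpa using this
  have hcover : Ioi t₀ ⊆ ⋃ k, A k := by
    intro ρ hρ
    have hex : ∃ k, b k < g ρ := (hlim.eventually_lt_const (hpos ρ hρ)).exists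
    classical
    have hmin := Nat.find_spec hex
    have hle : g ρ ≤ b 0 := by simpa [hb] using hganti (le_of_lt hρ)
    have hne : Nat.find hex ≠ 0 := fun h0 => by
      rw [h0] at hmin; exact absurd hle (not_le.2 hmin)
    obtain ⟨k, hk⟩ := Nat.exists_eq_succ_of_ne_zero hne
    refine mem_iUnion.2 ⟨k, hρ, ?_, ?_⟩
    · rw [hk] at hmin; exact hmin
    · exact not_lt.1 (Nat.find_min hex (by omega : k < Nat.find hex))
  have hpt : ∀ k, ∀ ρ ∈ A k, φ ρ ^ s ≤ (b (k + 1) ^ (-(q * s)) * c ^ s) * ψ ρ ^ s := by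
    rintro k ρ ⟨hρ, hlt, -⟩
    have h1 : b (k + 1) ^ q * φ ρ ≤ c * ψ ρ :=
      (mul_le_mul' (ENNReal.rpow_le_rpow hlt.le hq.le) le_rfl).trans (h ρ hρ)
    have h2 := ENNReal.rpow_le_rpow h1 hs.le
    rw [ENNReal.mul_rpow_of_nonneg _ _ hs.le, ENNReal.mul_rpow_of_nonneg _ _ hs.le,
      ← ENNReal.rpow_mul] at h2
    calc φ ρ ^ s = b (k + 1) ^ (-(q * s)) * (b (k + 1) ^ (q * s) * φ ρ ^ s) := by
          rw [← mul_assoc, ← ENNReal.rpow_add _ _ (hb0 _) (hbt _)]; simp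
      _ ≤ b (k + 1) ^ (-(q * s)) * (c ^ s * ψ ρ ^ s) := mul_le_mul' le_rfl h2
      _ = _ := by ring
  have hpiece : ∀ k, radialPot s l (A k) φ ≤ (b (k + 1) ^ (-(q * s)) * c ^ s) * b k := by
    intro k
    have hct : b (k + 1) ^ (-(q * s)) * c ^ s ≠ ⊤ :=
      ENNReal.mul_ne_top (ENNReal.rpow_ne_top_of_ne_zero (hb0 _) (hbt _))
        (ENNReal.rpow_ne_top_of_nonneg hs.le hc)
    calc radialPot s l (A k) φ
        ≤ ∫⁻ ρ in A k, (b (k + 1) ^ (-(q * s)) * c ^ s) *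
            (ψ ρ ^ s * ENNReal.ofReal (ρ ^ (-l - 1))) := by
          refine setLIntegral_mono' (hAm k) fun ρ hρ => ?_
          rw [← mul_assoc]
          exact mul_le_mul' (hpt k ρ hρ) le_rfl
      _ = (b (k + 1) ^ (-(q * s)) * c ^ s) * radialPot s l (A k) ψ := lintegral_const_mul' _ _ hct
      _ ≤ _ := by
          refine mul_le_mul' le_rfl ((radialPot_mono_set ?_ ψ).trans
            (radialPot_sublevel_le (t₀ := t₀) (b k)))
          exact fun ρ hρ => ⟨hρ.1, hρ.2.2⟩
  have hterm : ∀ k, (b (k + 1) ^ (-(q * s)) * c ^ s) * b k =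
      (c ^ s * 2 * (G * 2⁻¹) ^ (1 - q * s)) * (2⁻¹ ^ (1 - q * s)) ^ k := by
    intro k
    have e1 : b k = 2 * b (k + 1) := by
      simp only [hb, pow_succ]
      rw [mul_comm 2, mul_assoc, mul_assoc, ENNReal.inv_mul_cancel two_ne_zero (by simp), mul_one]
    have e2 : b (k + 1) ^ (-(q * s)) * b (k + 1) = b (k + 1) ^ (1 - q * s) := by
      nth_rewrite 2 [← ENNReal.rpow_one (b (k + 1))]
      rw [← ENNReal.rpow_add _ _ (hb0 _) (hbt _)]
      congr 1; ring
    have e3 : b (k + 1) ^ (1 - q * s) = (G * 2⁻¹) ^ (1 - q * s) * (2⁻¹ ^ (1 - q * s)) ^ k := by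
      rw [show b (k + 1) = (G * 2⁻¹) * 2⁻¹ ^ k by simp only [hb, pow_succ]; ring,
        ENNReal.mul_rpow_of_nonneg _ _ ha1.le, ← ENNReal.rpow_natCast, ← ENNReal.rpow_natCast,
        ← ENNReal.rpow_mul, ← ENNReal.rpow_mul, mul_comm (k : ℝ)]
    rw [e1, show (b (k + 1) ^ (-(q * s)) * c ^ s) * (2 * b (k + 1)) =
      c ^ s * 2 * (b (k + 1) ^ (-(q * s)) * b (k + 1)) by ring, e2, e3]
    ring
  calc radialPot s l (Ioi t₀) φ ≤ radialPot s l (⋃ k, A k) φ := radialPot_mono_set hcover φ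
    _ ≤ ∑' k, radialPot s l (A k) φ := lintegral_iUnion_le _ _
    _ ≤ ∑' k, (c ^ s * 2 * (G * 2⁻¹) ^ (1 - q * s)) * (2⁻¹ ^ (1 - q * s)) ^ k :=
        ENNReal.tsum_le_tsum fun k => (hpiece k).trans_eq (hterm k)
    _ < ⊤ := by
        rw [ENNReal.tsum_mul_left, ENNReal.tsum_geometric]
        have h1 : (2⁻¹ : ℝ≥0∞) ^ (1 - q * s) < 1 := ENNReal.rpow_lt_one (by simp) ha1
        refine ENNReal.mul_lt_top (ENNReal.mul_lt_top (ENNReal.mul_lt_top ?_ (by simp)) ?_) ?_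
        · exact (ENNReal.rpow_ne_top_of_nonneg hs.le hc).lt_top
        · exact (ENNReal.rpow_ne_top_of_nonneg ha1.le (by finiteness)).lt_top
        · exact ENNReal.inv_lt_top.2 (tsub_pos_of_lt h1)

variable {E : Type*} [MetricSpace E] [MeasurableSpace E] [BorelSpace E] [SecondCountableTopology E]

theorem radialPot_Ioi_ball_le_wolff (hs : 0 ≤ s) (ν : Measure E) (x z : E) {t : ℝ} (ht : 0 < t) :
    radialPot s l (Ioi t) (fun ρ => ν (ball z ρ)) ≤
      ENNReal.ofReal ((1 + dist z x / t) ^ l) * wolff s l ν x := by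
  have hc : 0 < 1 + dist z x / t := by positivity
  calc radialPot s l (Ioi t) (fun ρ => ν (ball z ρ))
      ≤ radialPot s l (Ioi t) (fun ρ => (fun ρ => ν (ball x ρ)) ((1 + dist z x / t) * ρ)) := by
        refine radialPot_mono hs measurableSet_Ioi fun ρ hρ => ball_mono_measure ν z x _ _ ?_
        have h1 : dist z x / t * t ≤ dist z x / t * ρ := by
          have : t ≤ ρ := le_of_lt hρ
          gcongr
        rw [div_mul_cancel₀ _ ht.ne'] at h1
        linarith
    _ = ENNReal.ofReal ((1 + dist z x / t) ^ l) *
          radialPot s l (Ioi ((1 + dist z x / t) * t)) (fun ρ => ν (ball x ρ)) :=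
        radialPot_comp_mul hc ht.le fun ρ => ν (ball x ρ)
    _ ≤ _ := mul_le_mul' le_rfl (radialPot_mono_set (Ioi_subset_Ioi (by positivity)) _)

/-- Finiteness of the two potentials at infinity, for measures which carry a solution. -/
theorem radialPot_Ioi_lt_top_of_solution (hs : 0 < s) (hl : 0 < l) (hq : 0 < q) (hqs : q * s < 1)
    {σ : Measure E} {u : E → ℝ≥0∞} (hu : Measurable u)
    (hω : σ.withDensity (fun y => u y ^ q) ≠ 0)
    (hsol : ∀ᵐ x ∂σ, u x = wolff s l (σ.withDensity fun y => u y ^ q) x)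
    {x₀ : E} (hx₀ : wolff s l (σ.withDensity fun y => u y ^ q) x₀ < ⊤) (z : E) {t : ℝ}
    (ht : 0 < t) :
    radialPot s l (Ioi t) (fun ρ => σ (ball z ρ)) < ⊤ ∧
      radialPot s l (Ioi t) (fun ρ => embConst s l q σ (ball z ρ) ^ (q / (1 - q * s))) < ⊤ := by
  have ha1 : 0 < 1 - q * s := by linarith
  set ω := σ.withDensity fun y => u y ^ q with hωdef
  have hfin : radialPot s l (Ioi t) (fun ρ => ω (ball z ρ)) < ⊤ :=
    (radialPot_Ioi_ball_le_wolff hs.le ω x₀ z ht).trans_lt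
      (ENNReal.mul_lt_top ENNReal.ofReal_lt_top hx₀)
  constructor
  · refine radialPot_lt_top_of_tail_rpow_mul_le hs hq hqs
      (ENNReal.rpow_ne_top_of_nonneg hq.le (ENNReal.ofReal_ne_top (r := 2 ^ l))) hfin ?_ ?_
    · intro ρ hρ
      obtain ⟨R, hR, hωR⟩ := exists_measure_ball_pos hω z
      have hM : 0 < max R ρ := lt_max_of_lt_left hR
      refine lt_of_lt_of_le ?_ (antitone_radialPot_Ioi _ (le_max_right R ρ))
      refine lt_of_lt_of_le ?_ (le_radialPot_Ioi hs.le hl hM fun r hr =>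
        measure_mono (ball_subset_ball ((le_max_left R ρ).trans hr.le)))
      refine ENNReal.mul_pos (by simp [ENNReal.rpow_eq_zero_iff, hωR.ne', hs, hs.le]) ?_
      simp only [ne_eq, ENNReal.ofReal_eq_zero, not_le]
      positivity
    · intro ρ hρ
      have hρ0 : 0 < ρ := ht.trans hρ
      set g := radialPot s l (Ioi ρ) (fun ρ => ω (ball z ρ)) with hg
      have hgt : g ≠ ⊤ := ((antitone_radialPot_Ioi _ (le_of_lt hρ)).trans_lt hfin).ne
      have hc : ENNReal.ofReal (2 ^ l) ^ q ≠ ⊤ :=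
        ENNReal.rpow_ne_top_of_nonneg hq.le ENNReal.ofReal_ne_top
      calc g ^ q * σ (ball z ρ) = ∫⁻ y in ball z ρ, g ^ q ∂σ := by simp
        _ ≤ ∫⁻ y in ball z ρ, ENNReal.ofReal (2 ^ l) ^ q * u y ^ q ∂σ := by
            refine setLIntegral_mono_ae' measurableSet_ball ?_
            filter_upwards [hsol] with y hy hyz
            rw [← ENNReal.mul_rpow_of_nonneg _ _ hq.le, hy]
            refine ENNReal.rpow_le_rpow
              ((radialPot_Ioi_ball_le_wolff hs.le ω y z hρ0).trans (mul_le_mul' ?_ le_rfl)) hq.le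
            have h1 : dist z y / ρ ≤ 1 := by
              rw [div_le_one hρ0, dist_comm]; exact le_of_lt hyz
            refine ENNReal.ofReal_le_ofReal (Real.rpow_le_rpow (by positivity) (by linarith) hl.le)
        _ = ENNReal.ofReal (2 ^ l) ^ q * ω (ball z ρ) := by
            rw [lintegral_const_mul' _ _ hc, hωdef, withDensity_apply _ measurableSet_ball]
  · set C := supersolConst s l q ^ (1 / (1 - q * s)) with hC
    have hCt : C ^ s ≠ ⊤ := ENNReal.rpow_ne_top_of_nonneg hs.le
      (ENNReal.rpow_ne_top_of_nonneg (by positivity) (supersolConst_ne_top hq hqs))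
    refine lt_of_le_of_lt ?_ (ENNReal.mul_lt_top hCt.lt_top hfin)
    unfold radialPot
    rw [← lintegral_const_mul' _ _ hCt]
    refine lintegral_mono fun ρ => ?_
    rw [← mul_assoc, ← ENNReal.mul_rpow_of_nonneg _ _ hs.le]
    refine mul_le_mul' (ENNReal.rpow_le_rpow ?_ hs.le) le_rfl
    exact embConst_rpow_le_of_supersolution hs hl hq hqs σ hu measurableSet_ball hω
      (ae_restrict_of_ae (hsol.mono fun x hx => hx.ge))

theorem embConst_ball_le_wolff_of_solution (hs : 0 < s) (hl : 0 < l) (hq : 0 < q)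
    (hqs : q * s < 1) {σ : Measure E} {u : E → ℝ≥0∞} (hu : Measurable u)
    (hω : σ.withDensity (fun y => u y ^ q) ≠ 0)
    (hsol : ∀ᵐ x ∂σ, u x = wolff s l (σ.withDensity fun y => u y ^ q) x) :
    ∃ C : ℝ≥0∞, C ≠ ⊤ ∧ ∀ x ρ, 0 < ρ →
      (embConst s l q σ (ball x ρ) ^ (q / (1 - q * s))) ^ s * ENNReal.ofReal (ρ ^ (-l)) ≤
        C * wolff s l (σ.withDensity fun y => u y ^ q) x := by
  have ha1 : 0 < 1 - q * s := by linarith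
  set ω := σ.withDensity fun y => u y ^ q with hωdef
  set C := supersolConst s l q ^ (1 / (1 - q * s)) with hC
  have hCt : C ^ s ≠ ⊤ := ENNReal.rpow_ne_top_of_nonneg hs.le
    (ENNReal.rpow_ne_top_of_nonneg (by positivity) (supersolConst_ne_top hq hqs))
  refine ⟨C ^ s * ENNReal.ofReal l, ENNReal.mul_ne_top hCt ENNReal.ofReal_ne_top,
    fun x ρ hρ => ?_⟩
  have h1 := embConst_rpow_le_of_supersolution hs hl hq hqs σ hu (measurableSet_ball (x := x) (ε := ρ))
    hω (ae_restrict_of_ae (hsol.mono fun x hx => hx.ge))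
  have h2 : ENNReal.ofReal (ρ ^ (-l)) = ENNReal.ofReal l * ENNReal.ofReal (ρ ^ (-l) / l) := by
    rw [← ENNReal.ofReal_mul hl.le, mul_div_cancel₀ _ hl.ne']
  calc (embConst s l q σ (ball x ρ) ^ (q / (1 - q * s))) ^ s * ENNReal.ofReal (ρ ^ (-l))
      ≤ (C * ω (ball x ρ)) ^ s * (ENNReal.ofReal l * ENNReal.ofReal (ρ ^ (-l) / l)) := by
        rw [h2]
        exact mul_le_mul' (ENNReal.rpow_le_rpow h1 hs.le) le_rfl
    _ = C ^ s * ENNReal.ofReal l * (ω (ball x ρ) ^ s * ENNReal.ofReal (ρ ^ (-l) / l)) := by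
        rw [ENNReal.mul_rpow_of_nonneg _ _ hs.le]; ring
    _ ≤ _ := mul_le_mul' le_rfl (le_wolff hs.le hl ω x hρ)

end Necessity

section Existence

variable {s l q : ℝ}
variable {E : Type*} [MetricSpace E] [MeasurableSpace E] [BorelSpace E] [SecondCountableTopology E]

/-- Existence of a solution, with an upper bound, when the embedding constants of balls are
finite. -/
theorem exists_solution_le (hs : 0 < s) (hl : 0 < l) (hq : 0 < q) (hqs : q * s < 1)
    {σ : Measure E} (hσ : σ ≠ 0) {x₀ : E} (hfin : ∀ R, σ (ball x₀ R) < ⊤)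
    (hκ : ∀ R, 0 < R → embConst s l q σ (ball x₀ R) ≠ ⊤) :
    ∃ u : E → ℝ≥0∞, Measurable u ∧ σ.withDensity (fun y => u y ^ q) ≠ 0 ∧
      (∀ x, u x = wolff s l (σ.withDensity fun y => u y ^ q) x) ∧
      ∃ C : ℝ≥0∞, C ≠ ⊤ ∧ ∀ x, u x ≤
        C * (radialPot s l (Ioi 0) (fun ρ => embConst s l q σ (ball x ρ) ^ (q / (1 - q * s))) +
          wolff s l σ x ^ (1 / (1 - q * s))) := by
  have ha1 : 0 < 1 - q * s := by linarith
  obtain ⟨R, hR, hpos⟩ := exists_measure_ball_pos hσ x₀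
  obtain ⟨c, hc0, hct, hc⟩ := exists_subsolution_ball hs hl hq hqs hR hpos (hfin R)
  set u₀ : E → ℝ≥0∞ := (ball x₀ R).indicator fun _ => c with hu₀
  have hu₀m : Measurable u₀ := measurable_const.indicator measurableSet_ball
  set τ : ℕ → Measure E := fun k => σ.restrict (ball x₀ (R + k)) with hτ
  have hτmono : Monotone τ := fun j k hjk =>
    Measure.restrict_mono (ball_subset_ball (by gcongr)) le_rfl
  have hτσ : ∀ k, τ k ≤ σ := fun k => Measure.restrict_le_self
  have hsub : ∀ k, u₀ ≤ wolff s l ((τ k).withDensity fun y => u₀ y ^ q) := fun k =>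
    hc _ (Measure.restrict_mono (ball_subset_ball (by simp)) le_rfl)
  set U : ℕ → E → ℝ≥0∞ := fun k => wolffSol s l q u₀ (τ k) with hU
  have hUm : ∀ k, Measurable (U k) := fun k => measurable_wolffSol hu₀m _
  have hUmono : Monotone U := fun j k hjk => wolffSol_mono_measure hs hq (hτmono hjk)
  set u : E → ℝ≥0∞ := fun x => ⨆ k, U k x with hu
  have hum : Measurable u := Measurable.iSup hUm
  have hUu : ∀ k, U k ≤ u := fun k x => le_iSup (fun k => U k x) k
  have hball : ∀ x ρ, σ.withDensity (fun y => u y ^ q) (ball x ρ) =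
      ⨆ k, (τ k).withDensity (fun y => U k y ^ q) (ball x ρ) := by
    intro x ρ
    refine le_antisymm ?_ (iSup_le fun k => withDensity_rpow_mono hq (hτσ k) (hUu k) _)
    rw [withDensity_rpow_apply_eq_iSup hq hUm hUmono measurableSet_ball]
    refine iSup_le fun j => ?_
    obtain ⟨K, hK⟩ := exists_nat_ge (ρ + dist x x₀)
    have hsubset : ball x ρ ⊆ ball x₀ (R + (max j K : ℕ)) := by
      refine ball_subset_ball' ?_
      have : (K : ℝ) ≤ (max j K : ℕ) := by exact_mod_cast le_max_right j K
      linarith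
    refine le_trans ?_ (le_iSup _ (max j K))
    rw [withDensity_apply _ measurableSet_ball, withDensity_apply _ measurableSet_ball, hτ]
    simp only
    rw [Measure.restrict_restrict measurableSet_ball, inter_eq_self_of_subset_left hsubset]
    exact lintegral_mono fun y => ENNReal.rpow_le_rpow (hUmono (le_max_left j K) y) hq.le
  have hUeq : ∀ k x, U k x = wolff s l ((τ k).withDensity fun y => U k y ^ q) x := fun k =>
    wolffSol_eq hs hq hu₀m (hsub k)
  have hueq : ∀ x, u x = wolff s l (σ.withDensity fun y => u y ^ q) x := fun x => by
    rw [wolff_eq_iSup hs (μ := fun k => (τ k).withDensity fun y => U k y ^ q)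
      (fun j k hjk => withDensity_rpow_mono hq (hτmono hjk) (hUmono hjk)) hball x]
    exact iSup_congr fun k => hUeq k x
  obtain ⟨C, hCt, hC⟩ := exists_wolff_le_embConst (E := E) hs hl hq hqs
  refine ⟨u, hum, fun h0 => ?_, hueq, C, hCt, fun x => iSup_le fun k => ?_⟩
  · have h1 : ∫⁻ y in ball x₀ R, u y ^ q ∂σ = 0 := by
      rw [← withDensity_apply _ measurableSet_ball, h0]; simp
    have h2 : ∫⁻ y in ball x₀ R, c ^ q ∂σ ≤ ∫⁻ y in ball x₀ R, u y ^ q ∂σ := by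
      refine setLIntegral_mono' measurableSet_ball fun y hy => ENNReal.rpow_le_rpow ?_ hq.le
      refine le_trans ?_ ((le_wolffSol (τ 0) y).trans (hUu 0 y))
      rw [hu₀, indicator_of_mem hy]
    rw [h1, setLIntegral_const, nonpos_iff_eq_zero] at h2
    have h3 : c ^ q ≠ 0 := by simp [ENNReal.rpow_eq_zero_iff, hc0, hct]
    exact (mul_ne_zero h3 hpos.ne') h2
  · have hκle : ∀ k, embConst s l q (τ k) univ ≤ embConst s l q σ (ball x₀ (R + k)) := fun k =>
      embConst_mono hs hq (by rw [Measure.restrict_univ])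
    have hfint : ∫⁻ y, u₀ y ^ q ∂(τ k) ≠ ⊤ := by
      have : ∫⁻ y, u₀ y ^ q ∂(τ k) ≤ ∫⁻ y, c ^ q ∂(τ k) :=
        lintegral_mono fun y => ENNReal.rpow_le_rpow (indicator_le_self' (by simp) y) hq.le
      refine (this.trans_lt ?_).ne
      rw [lintegral_const, hτ]
      simp only [Measure.restrict_apply_univ]
      exact ENNReal.mul_lt_top (ENNReal.rpow_ne_top_of_nonneg hq.le hct).lt_top (hfin _)
    have hκt : embConst s l q (τ k) univ ≠ ⊤ := ne_top_of_le_ne_top (hκ _ (by positivity)) (hκle k)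
    have hω : (τ k).withDensity (fun y => U k y ^ q) univ ≠ ⊤ := by
      rw [withDensity_apply _ MeasurableSet.univ, Measure.restrict_univ]
      exact ne_top_of_le_ne_top (ENNReal.rpow_ne_top_of_nonneg (by positivity) hκt)
        (lintegral_wolffSol_rpow_le hs hq hqs hu₀m (hsub k) hfint hκt)
    rw [hUeq k x]
    refine (hC (τ k) (U k) hω (fun x => (hUeq k x).le) x).trans ?_
    refine mul_le_mul' le_rfl (add_le_add ?_ ?_)
    · refine radialPot_mono hs.le measurableSet_Ioi fun ρ _ => ENNReal.rpow_le_rpow ?_ (by positivity)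
      exact embConst_mono hs hq (Measure.restrict_mono le_rfl (hτσ k))
    · exact ENNReal.rpow_le_rpow (wolff_mono hs.le (hτσ k) x) (by positivity)

end Existence

section LocalIntegrability

variable {n : ℕ} {s l q : ℝ}

theorem setLIntegral_radialPot_rpow_lt_top {r R : ℝ} (hs : 0 ≤ s) (hr : 0 ≤ r)
    (hR : 1 ≤ R) {Φ : EuclideanSpace ℝ (Fin n) → ℝ → ℝ≥0∞}
    (hmono : ∀ x y ρ t, dist x y + ρ ≤ t → Φ x ρ ≤ Φ y t)
    (htail : radialPot s l (Ioi 1) (Φ 0) < ⊤)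
    (hloc : ∫⁻ x in ball 0 R, radialPot s l (Ioo 0 R) (Φ x) ^ r < ⊤) :
    ∫⁻ x in ball 0 R, radialPot s l (Ioi 0) (Φ x) ^ r < ⊤ := by
  have hR0 : 0 < R := by linarith
  set T := ENNReal.ofReal (2 ^ l) * radialPot s l (Ioi 1) (Φ 0) with hT
  have hTt : T < ⊤ := ENNReal.mul_lt_top ENNReal.ofReal_lt_top htail
  have hle : ∀ x ∈ ball (0 : EuclideanSpace ℝ (Fin n)) R,
      radialPot s l (Ioi 0) (Φ x) ≤ radialPot s l (Ioo 0 R) (Φ x) + T := by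
    intro x hx
    have h1 : radialPot s l (Ioi 0) (Φ x) ≤
        radialPot s l (Ioo 0 R) (Φ x) + radialPot s l (Ici R) (Φ x) := by
      rw [← Ioo_union_Ici_eq_Ioi hR0]
      exact lintegral_union_le _ _ _
    have h2 : radialPot s l (Ici R) (Φ x) = radialPot s l (Ioi R) (Φ x) := by
      unfold radialPot
      rw [Measure.restrict_congr_set Ioi_ae_eq_Ici]
    have h3 : radialPot s l (Ioi R) (Φ x) ≤ radialPot s l (Ioi R) (fun ρ => Φ 0 (2 * ρ)) := by
      refine radialPot_mono hs measurableSet_Ioi fun ρ hρ => hmono _ _ _ _ ?_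
      have h4 : dist x 0 < R := hx
      have h5 : R < ρ := hρ
      linarith
    rw [radialPot_comp_mul two_pos hR0.le (Φ 0)] at h3
    refine h1.trans (add_le_add le_rfl (h2.trans_le (h3.trans (mul_le_mul' le_rfl ?_))))
    exact radialPot_mono_set (Ioi_subset_Ioi (by linarith)) _
  calc ∫⁻ x in ball 0 R, radialPot s l (Ioi 0) (Φ x) ^ r
      ≤ ∫⁻ x in ball 0 R, 2 ^ r * (radialPot s l (Ioo 0 R) (Φ x) ^ r + T ^ r) := by
        refine setLIntegral_mono' measurableSet_ball fun x hx => ?_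
        exact (ENNReal.rpow_le_rpow (hle x hx) hr).trans (ENNReal.add_rpow_le_two_rpow_mul _ _ hr)
    _ = 2 ^ r * ((∫⁻ x in ball 0 R, radialPot s l (Ioo 0 R) (Φ x) ^ r) +
          T ^ r * volume (ball (0 : EuclideanSpace ℝ (Fin n)) R)) := by
        rw [lintegral_const_mul' _ _ (ENNReal.two_rpow_ne_top r),
          lintegral_add_right _ measurable_const, setLIntegral_const]
    _ < ⊤ := by
        refine ENNReal.mul_lt_top (ENNReal.two_rpow_ne_top r).lt_top (ENNReal.add_lt_top.2 ⟨hloc, ?_⟩)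
        exact ENNReal.mul_lt_top (ENNReal.rpow_ne_top_of_nonneg hr hTt.ne).lt_top measure_ball_lt_top

theorem embConst_eq_zero_of_measure_eq_zero {E : Type*} [MetricSpace E] [MeasurableSpace E]
    [BorelSpace E] [SecondCountableTopology E] {σ : Measure E} {A : Set E} (h : σ A = 0) : embConst s l q σ A = 0 := by
  refine le_antisymm (embConst_le fun ν _ => ?_) zero_le
  rw [Measure.restrict_eq_zero.2 h]
  simp

/-- Finiteness of the embedding constants of balls. -/
theorem embConst_ball_ne_top (hs : 0 < s) (hq : 0 < q) (hqs : q * s < 1) {r β : ℝ} (hr : 0 < r)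
    {σ : Measure (EuclideanSpace ℝ (Fin n))}
    (h : ∀ R : ℝ, 0 < R → ∫⁻ x in ball (0 : EuclideanSpace ℝ (Fin n)) R,
      ⨆ (ρ : ℝ) (_ : 0 < ρ) (_ : ρ < R), (embConst s l q σ (ball x ρ) ^ (q / (1 - q * s)) *
        ENNReal.ofReal (ρ ^ (-β))) ^ (s * r) < ⊤) {R : ℝ} (hR : 0 < R) :
    embConst s l q σ (ball 0 R) ≠ ⊤ := by
  have ha1 : 0 < 1 - q * s := by linarith
  intro htop
  refine absurd (h (R + 2) (by linarith)) (not_lt.2 ?_)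
  have h1 : ∫⁻ _ in ball (0 : EuclideanSpace ℝ (Fin n)) 1, (⊤ : ℝ≥0∞) = ⊤ := by
    rw [setLIntegral_const, ENNReal.top_mul (measure_ball_pos _ _ one_pos).ne']
  refine h1.ge.trans (le_trans (setLIntegral_mono' measurableSet_ball fun x hx => ?_)
    (lintegral_mono_set (ball_subset_ball (by linarith : (1 : ℝ) ≤ R + 2))))
  refine le_iSup_of_le (R + 1) (le_iSup₂_of_le (by linarith) (by linarith) ?_)
  have hx1 : dist x 0 < 1 := hx
  have h3 : embConst s l q σ (ball x (R + 1)) = ⊤ := by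
    refine top_le_iff.1 (htop.ge.trans (ball_mono_embConst hs hq σ _ _ _ _ ?_))
    rw [dist_comm]; linarith
  rw [h3, ENNReal.top_rpow_of_pos (by positivity), ENNReal.top_mul, ENNReal.top_rpow_of_pos
    (by positivity)]
  simp only [ne_eq, ENNReal.ofReal_eq_zero, not_le]
  positivity

theorem setLIntegral_potentials_lt_top (hs : 0 < s) (hq : 0 < q) (hqs : q * s < 1) {r β : ℝ}
    (hr : 0 < r) (hβ₀ : 0 < β) (hβ : β < n)
    {σ : Measure (EuclideanSpace ℝ (Fin n))} (hσ : ∀ R, σ (ball 0 R) < ⊤)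
    (hσtail : radialPot s (β * s) (Ioi 1) (fun ρ => σ (ball 0 ρ)) < ⊤)
    (hκtail : radialPot s (β * s) (Ioi 1)
      (fun ρ => embConst s (β * s) q σ (ball 0 ρ) ^ (q / (1 - q * s))) < ⊤)
    (h : ∀ R : ℝ, 0 < R → ∫⁻ x in ball (0 : EuclideanSpace ℝ (Fin n)) R,
      ⨆ (ρ : ℝ) (_ : 0 < ρ) (_ : ρ < R), (embConst s (β * s) q σ (ball x ρ) ^ (q / (1 - q * s)) *
        ENNReal.ofReal (ρ ^ (-β))) ^ (s * r) < ⊤) {R : ℝ} (hR : 1 ≤ R) :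
    (∫⁻ x in ball 0 R, radialPot s (β * s) (Ioi 0)
        (fun ρ => embConst s (β * s) q σ (ball x ρ) ^ (q / (1 - q * s))) ^ r < ⊤) ∧
      ∫⁻ x in ball 0 R, wolff s (β * s) σ x ^ (r / (1 - q * s)) < ⊤ := by
  have ha1 : 0 < 1 - q * s := by linarith
  have hR0 : 0 < R := by linarith
  set σ' := σ.restrict (ball 0 (2 * R)) with hσ'
  have : IsFiniteMeasure σ' := ⟨by rw [hσ', Measure.restrict_apply_univ]; exact hσ _⟩
  have hsub : ∀ x ∈ ball (0 : EuclideanSpace ℝ (Fin n)) R, ∀ ρ ∈ Ioo (0 : ℝ) R,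
      ball x ρ ⊆ ball 0 (2 * R) := fun x hx ρ hρ => by
    refine ball_subset_ball' ?_
    have h1 : dist x 0 < R := hx
    linarith [hρ.2]
  set c : ℝ≥0∞ := ENNReal.ofReal (2 ^ β) ^ (s * r) with hc
  have hct : c ≠ ⊤ := ENNReal.rpow_ne_top_of_nonneg (by positivity) ENNReal.ofReal_ne_top
  set S : EuclideanSpace ℝ (Fin n) → ℝ≥0∞ := fun x => ⨆ (ρ : ℝ) (_ : 0 < ρ) (_ : ρ < 4 * R),
    (embConst s (β * s) q σ (ball x ρ) ^ (q / (1 - q * s)) *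
      ENNReal.ofReal (ρ ^ (-β))) ^ (s * r) with hS
  have hfin : ∫⁻ x, (⨆ i : ℕ, embConst s (β * s) q σ' (ball x (2 * (R / 2 ^ i))) ^
      (q / (1 - q * s)) * ENNReal.ofReal ((R / 2 ^ i) ^ (-β))) ^ (s * r) < ⊤ := by
    have hle : ∀ x, (⨆ i : ℕ, embConst s (β * s) q σ' (ball x (2 * (R / 2 ^ i))) ^
        (q / (1 - q * s)) * ENNReal.ofReal ((R / 2 ^ i) ^ (-β))) ^ (s * r) ≤
        (ball 0 (4 * R)).indicator (fun x => c * S x) x := by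
      intro x
      rw [ENNReal.iSup_rpow_const _ (by positivity)]
      refine iSup_le fun i => ?_
      have hρ : 0 < R / 2 ^ i := by positivity
      have hρR : R / 2 ^ i ≤ R := div_le_self hR0.le (one_le_pow₀ one_le_two)
      by_cases hx : x ∈ ball (0 : EuclideanSpace ℝ (Fin n)) (4 * R)
      · rw [indicator_of_mem hx]
        have e : ENNReal.ofReal ((R / 2 ^ i) ^ (-β)) =
            ENNReal.ofReal (2 ^ β) * ENNReal.ofReal ((2 * (R / 2 ^ i)) ^ (-β)) := by
          rw [← ENNReal.ofReal_mul (by positivity), Real.mul_rpow zero_le_two hρ.le, ← mul_assoc,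
            ← Real.rpow_add zero_lt_two, add_neg_cancel, Real.rpow_zero, one_mul]
        rw [e, mul_left_comm, ENNReal.mul_rpow_of_nonneg _ _ (by positivity : 0 ≤ s * r)]
        refine mul_le_mul' le_rfl (le_trans (ENNReal.rpow_le_rpow (mul_le_mul'
          (ENNReal.rpow_le_rpow ?_ (by positivity)) le_rfl) (by positivity))
          (le_iSup_of_le (2 * (R / 2 ^ i)) (le_iSup₂_of_le (by positivity) (by linarith) le_rfl)))
        exact embConst_mono hs hq (Measure.restrict_mono le_rfl Measure.restrict_le_self)
      · have h0 : σ' (ball x (2 * (R / 2 ^ i))) = 0 := by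
          rw [hσ', Measure.restrict_apply measurableSet_ball]
          have : Disjoint (ball x (2 * (R / 2 ^ i))) (ball 0 (2 * R)) := by
            refine ball_disjoint_ball ?_
            have : 4 * R ≤ dist x 0 := not_lt.1 hx
            linarith
          rw [this.inter_eq]
          simp
        rw [embConst_eq_zero_of_measure_eq_zero h0, ENNReal.zero_rpow_of_pos (by positivity),
          zero_mul, ENNReal.zero_rpow_of_pos (by positivity)]
        exact zero_le
    refine (lintegral_mono hle).trans_lt ?_
    rw [lintegral_indicator measurableSet_ball, lintegral_const_mul' _ _ hct]
    exact ENNReal.mul_lt_top hct.lt_top (h _ (by positivity))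
  obtain ⟨hK, hW⟩ := lintegral_local_potentials_lt_top hs hq hqs hr hβ₀ hβ hR0 σ' hfin
  constructor
  · refine setLIntegral_radialPot_rpow_lt_top hs.le hr.le hR (fun x y ρ t hxy =>
      ENNReal.rpow_le_rpow (ball_mono_embConst hs hq σ x y ρ t hxy) (by positivity)) hκtail ?_
    refine lt_of_le_of_lt ?_ ((setLIntegral_le_lintegral (ball 0 R) _).trans_lt hK)
    refine setLIntegral_mono' measurableSet_ball fun x hx => ENNReal.rpow_le_rpow ?_ hr.le
    refine radialPot_mono hs.le measurableSet_Ioo fun ρ hρ => ?_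
    rw [hσ', embConst_restrict_of_subset hs hq σ (hsub x hx ρ hρ) measurableSet_ball]
  · refine setLIntegral_radialPot_rpow_lt_top hs.le (by positivity) hR (ball_mono_measure σ)
      hσtail ?_
    refine lt_of_le_of_lt ?_ ((setLIntegral_le_lintegral (ball 0 R) _).trans_lt hW)
    refine setLIntegral_mono' measurableSet_ball fun x hx => ENNReal.rpow_le_rpow ?_ (by positivity)
    refine radialPot_mono hs.le measurableSet_Ioo fun ρ hρ => ?_
    rw [hσ', Measure.restrict_apply measurableSet_ball,
      inter_eq_self_of_subset_left (hsub x hx ρ hρ)]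

end LocalIntegrability

section Characterization

variable {n : ℕ} {s q r β : ℝ}

theorem exists_solution_setLIntegral_rpow_lt_top (hs : 0 < s) (hq : 0 < q) (hqs : q * s < 1)
    (hr : 0 < r) (hβ₀ : 0 < β) (hβ : β < n) {σ : Measure (EuclideanSpace ℝ (Fin n))} (hσ₀ : σ ≠ 0)
    (hσ : ∀ R, σ (ball 0 R) < ⊤)
    (hσtail : radialPot s (β * s) (Ioi 1) (fun ρ => σ (ball 0 ρ)) < ⊤)
    (hκtail : radialPot s (β * s) (Ioi 1)
      (fun ρ => embConst s (β * s) q σ (ball 0 ρ) ^ (q / (1 - q * s))) < ⊤)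
    (h : ∀ R : ℝ, 0 < R → ∫⁻ x in ball (0 : EuclideanSpace ℝ (Fin n)) R,
      ⨆ (ρ : ℝ) (_ : 0 < ρ) (_ : ρ < R), (embConst s (β * s) q σ (ball x ρ) ^ (q / (1 - q * s)) *
        ENNReal.ofReal (ρ ^ (-β))) ^ (s * r) < ⊤) :
    ∃ u : EuclideanSpace ℝ (Fin n) → ℝ≥0∞, Measurable u ∧
      σ.withDensity (fun y => u y ^ q) ≠ 0 ∧
      (∀ x, u x = wolff s (β * s) (σ.withDensity fun y => u y ^ q) x) ∧
      ∀ R : ℝ, ∫⁻ x in ball 0 R, u x ^ r < ⊤ := by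
  have hl : 0 < β * s := by positivity
  obtain ⟨u, hum, hω, hueq, C, hCt, hC⟩ := exists_solution_le hs hl hq hqs hσ₀ hσ
    (fun R hR => embConst_ball_ne_top hs hq hqs hr h hR)
  refine ⟨u, hum, hω, hueq, fun R => ?_⟩
  obtain ⟨hK, hW⟩ := setLIntegral_potentials_lt_top hs hq hqs hr hβ₀ hβ hσ hσtail hκtail h
    (le_max_right R 1)
  have hct : C ^ r * 2 ^ r ≠ ⊤ :=
    ENNReal.mul_ne_top (ENNReal.rpow_ne_top_of_nonneg hr.le hCt) (ENNReal.two_rpow_ne_top r)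
  have hKm : Measurable fun x => radialPot s (β * s) (Ioi 0)
      (fun ρ => embConst s (β * s) q σ (ball x ρ) ^ (q / (1 - q * s))) ^ r :=
    (measurable_radialPot _ ((measurable_embConst_ball hs hq σ).pow_const _)).pow_const r
  refine (lintegral_mono_set (ball_subset_ball (le_max_left R 1))).trans_lt ?_
  refine (setLIntegral_mono' measurableSet_ball fun x _ => ?_ :
    _ ≤ ∫⁻ x in ball 0 (max R 1), C ^ r * 2 ^ r * (radialPot s (β * s) (Ioi 0)
      (fun ρ => embConst s (β * s) q σ (ball x ρ) ^ (q / (1 - q * s))) ^ r +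
        wolff s (β * s) σ x ^ (r / (1 - q * s)))).trans_lt ?_
  · refine (ENNReal.rpow_le_rpow (hC x) hr.le).trans ?_
    rw [ENNReal.mul_rpow_of_nonneg _ _ hr.le, mul_assoc,
      show r / (1 - q * s) = 1 / (1 - q * s) * r by ring, ENNReal.rpow_mul _ (1 / (1 - q * s)) r]
    exact mul_le_mul' le_rfl (ENNReal.add_rpow_le_two_rpow_mul _ _ hr.le)
  · rw [lintegral_const_mul' _ _ hct, lintegral_add_left hKm]
    exact ENNReal.mul_lt_top hct.lt_top (ENNReal.add_lt_top.2 ⟨hK, hW⟩)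

theorem setLIntegral_iSup_embConst_lt_top_of_solution (hs : 0 < s) (hq : 0 < q) (hqs : q * s < 1)
    (hr : 0 < r) (hβ₀ : 0 < β) {σ : Measure (EuclideanSpace ℝ (Fin n))}
    {u : EuclideanSpace ℝ (Fin n) → ℝ≥0∞} (hu : Measurable u)
    (hω : σ.withDensity (fun y => u y ^ q) ≠ 0)
    (hsol : ∀ᵐ x ∂σ, u x = wolff s (β * s) (σ.withDensity fun y => u y ^ q) x)
    (hsol' : ∀ᵐ x, u x = wolff s (β * s) (σ.withDensity fun y => u y ^ q) x) {R : ℝ}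
    (hfin : ∫⁻ x in ball 0 R, u x ^ r < ⊤) :
    ∫⁻ x in ball (0 : EuclideanSpace ℝ (Fin n)) R,
      ⨆ (ρ : ℝ) (_ : 0 < ρ) (_ : ρ < R), (embConst s (β * s) q σ (ball x ρ) ^ (q / (1 - q * s)) *
        ENNReal.ofReal (ρ ^ (-β))) ^ (s * r) < ⊤ := by
  have hl : 0 < β * s := by positivity
  obtain ⟨C, hCt, hC⟩ := embConst_ball_le_wolff_of_solution hs hl hq hqs hu hω hsol
  have hct : C ^ r ≠ ⊤ := ENNReal.rpow_ne_top_of_nonneg hr.le hCt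
  refine lt_of_le_of_lt ?_ (ENNReal.mul_lt_top hct.lt_top hfin)
  rw [← lintegral_const_mul' _ _ hct]
  refine lintegral_mono_ae (ae_restrict_of_ae ?_)
  filter_upwards [hsol'] with x hx
  refine iSup_le fun ρ => iSup_le fun hρ => iSup_le fun _ => ?_
  rw [ENNReal.rpow_mul, ← ENNReal.mul_rpow_of_nonneg _ _ hr.le, hx]
  refine ENNReal.rpow_le_rpow ?_ hr.le
  rw [ENNReal.mul_rpow_of_nonneg _ _ hs.le, ENNReal.ofReal_rpow_of_nonneg (by positivity) hs.le,
    ← Real.rpow_mul hρ.le, neg_mul]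
  exact hC x ρ hρ

end Characterization

/-! ### The potentials in their original normalization -/

section Translation

variable {n : ℕ} {α p q r : ℝ}

theorem wolffPot_eq_wolff (hp : 1 < p) (ν : Measure (EuclideanSpace ℝ (Fin n)))
    (x : EuclideanSpace ℝ (Fin n)) :
    wolffPot n α p ν x = wolff (1 / (p - 1)) (((n : ℝ) - α * p) * (1 / (p - 1))) ν x := by
  have hs : 0 ≤ 1 / (p - 1) := by
    have : 0 < p - 1 := by linarith
    positivity
  exact setLIntegral_congr_fun measurableSet_Ioi fun ρ hρ => div_rpow_div_eq hs hρ _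

theorem embC_eq_embConst (hp : 1 < p) (hq : 0 < q) (σ : Measure (EuclideanSpace ℝ (Fin n)))
    (A : Set (EuclideanSpace ℝ (Fin n))) :
    embC n α p q σ A =
      embConst (1 / (p - 1)) (((n : ℝ) - α * p) * (1 / (p - 1))) q σ A := by
  unfold embC embConst
  congr 1
  ext κ
  simp only [mem_ofPred_eq, wolffPot_eq_wolff hp]
  refine forall₂_congr fun ν _ => ?_
  rw [show (1 : ℝ) / q = q⁻¹ from one_div q, ENNReal.rpow_inv_le_iff hq,
     ENNReal.mul_rpow_of_nonneg _ _ hq.le, ← ENNReal.rpow_mul,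
    mul_comm q]

theorem lintegral_Ioi_add_lt_top_iff {s b : ℝ} (hs : 0 ≤ s) {φ ψ : ℝ → ℝ≥0∞} (hφ : Monotone φ) :
    ∫⁻ ρ in Ioi (1 : ℝ), ((φ ρ / ENNReal.ofReal (ρ ^ b)) ^ s +
        (ψ ρ / ENNReal.ofReal (ρ ^ b)) ^ s) / ENNReal.ofReal ρ < ⊤ ↔
      radialPot s (b * s) (Ioi 1) φ < ⊤ ∧ radialPot s (b * s) (Ioi 1) ψ < ⊤ := by
  have h : ∫⁻ ρ in Ioi (1 : ℝ), ((φ ρ / ENNReal.ofReal (ρ ^ b)) ^ s +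
        (ψ ρ / ENNReal.ofReal (ρ ^ b)) ^ s) / ENNReal.ofReal ρ =
      radialPot s (b * s) (Ioi 1) φ + radialPot s (b * s) (Ioi 1) ψ := by
    unfold radialPot
    have hφm := hφ.measurable
    rw [← lintegral_add_left (by fun_prop)]
    refine setLIntegral_congr_fun measurableSet_Ioi fun ρ hρ => ?_
    have hρ0 : 0 < ρ := one_pos.trans hρ
    rw [ENNReal.add_div, div_rpow_div_eq hs hρ0, div_rpow_div_eq hs hρ0]
  rw [h, ENNReal.add_lt_top]

theorem iSup_div_rpow_eq {s b R : ℝ} (X : ℝ → ℝ≥0∞) :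
    ⨆ (ρ : ℝ) (_ : 0 < ρ) (_ : ρ < R), (X ρ / ENNReal.ofReal (ρ ^ b)) ^ s =
      ⨆ (ρ : ℝ) (_ : 0 < ρ) (_ : ρ < R), (X ρ * ENNReal.ofReal (ρ ^ (-b))) ^ s := by
  refine iSup_congr fun ρ => iSup_congr fun hρ => iSup_congr fun _ => ?_
  rw [div_eq_mul_inv, ← ENNReal.ofReal_inv_of_pos (by positivity), Real.rpow_neg hρ.le]

end Translation

/-- For `n(p−1)/(n−αp) ≤ r < ∞` and `σ ≠ 0`: a nontrivial solution
`u ∈ L^r_loc(ℝⁿ)` of `u = W_{α,p}(u^q dσ)` exists iff conditions (a) and (b) hold. -/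
theorem exists_nontrivial_Lr_loc_solution_iff (n : ℕ) (hn : 1 ≤ n) (α p q r : ℝ)
    (hp : 1 < p) (hq0 : 0 < q) (hqp : q < p - 1)
    (hα0 : 0 < α) (hαp : α < n / p)
    (hr : (n : ℝ) * (p - 1) / ((n : ℝ) - α * p) ≤ r)
    (σ : Measure (EuclideanSpace ℝ (Fin n))) (hσloc : IsLocallyFiniteMeasure σ)
    (hσ : σ ≠ 0) :
    (∃ u : EuclideanSpace ℝ (Fin n) → ℝ≥0∞, IsSolution n α p q σ u ∧
        ¬ (∀ᵐ x ∂(volume : Measure (EuclideanSpace ℝ (Fin n))), u x = 0) ∧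
        ∀ R : ℝ, 0 < R →
          (∫⁻ x in Metric.ball (0 : EuclideanSpace ℝ (Fin n)) R, u x ^ r) < ⊤) ↔
      ((∫⁻ ρ in Set.Ioi (1 : ℝ),
          ((σ (Metric.ball (0 : EuclideanSpace ℝ (Fin n)) ρ) /
              ENNReal.ofReal (ρ ^ ((n : ℝ) - α * p))) ^ (1 / (p - 1)) +
            (embC n α p q σ (Metric.ball (0 : EuclideanSpace ℝ (Fin n)) ρ) ^
                (q * (p - 1) / (p - 1 - q)) /
              ENNReal.ofReal (ρ ^ ((n : ℝ) - α * p))) ^ (1 / (p - 1))) /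
            ENNReal.ofReal ρ) < ⊤ ∧
        ∀ R : ℝ, 0 < R →
          (∫⁻ x in Metric.ball (0 : EuclideanSpace ℝ (Fin n)) R,
            ⨆ (ρ : ℝ) (_ : 0 < ρ) (_ : ρ < R),
              (embC n α p q σ (Metric.ball x ρ) ^ (q * (p - 1) / (p - 1 - q)) /
                ENNReal.ofReal (ρ ^ ((n : ℝ) - α * p))) ^ (r / (p - 1))) < ⊤) := by
  have hp1 : 0 < p - 1 := by linarith
  have hp0 : 0 < p := by linarith
  have hn0 : (0 : ℝ) < n := by exact_mod_cast hn
  have hβ₀ : 0 < (n : ℝ) - α * p := by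
    rw [lt_div_iff₀ hp0] at hαp
    linarith
  have hβ : (n : ℝ) - α * p < n := by
    have : 0 < α * p := by positivity
    linarith
  have hr0 : 0 < r := lt_of_lt_of_le (by positivity) hr
  have hs : 0 < 1 / (p - 1) := by positivity
  have hqs : q * (1 / (p - 1)) < 1 := by rwa [mul_one_div, div_lt_one hp1]
  have hl : 0 < ((n : ℝ) - α * p) * (1 / (p - 1)) := by positivity
  have hθ : q * (p - 1) / (p - 1 - q) = q / (1 - q * (1 / (p - 1))) := by
    have : p - 1 - q ≠ 0 := by linarith
    field_simp
  have hsr : r / (p - 1) = 1 / (p - 1) * r := by ring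
  have hfin : ∀ R, σ (ball 0 R) < ⊤ := fun R => measure_ball_lt_top
  simp only [IsSolution, embC_eq_embConst hp hq0, wolffPot_eq_wolff hp, hθ, hsr, iSup_div_rpow_eq]
  rw [lintegral_Ioi_add_lt_top_iff hs.le
    fun _ _ h => measure_mono (ball_subset_ball h)]
  constructor
  · rintro ⟨u, ⟨hu, -, hsol, hsol'⟩, hne, hur⟩
    have hω : σ.withDensity (fun y => u y ^ q) ≠ 0 := fun h0 => hne <| by
      filter_upwards [hsol'] with x hx
      rw [hx, h0, wolff_zero hs]
    have hae : ∀ᵐ x ∂volume.restrict (ball (0 : EuclideanSpace ℝ (Fin n)) 1), u x ^ r < ⊤ :=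
      ae_lt_top (hu.pow_const r) (hur 1 one_pos).ne
    have : NeZero (volume.restrict (ball (0 : EuclideanSpace ℝ (Fin n)) 1)) :=
      ⟨by simpa [Measure.restrict_eq_zero] using (measure_ball_pos volume _ one_pos).ne'⟩
    obtain ⟨x₀, hx₀, hx₀'⟩ := (hae.and (ae_restrict_of_ae hsol')).exists
    rw [ENNReal.rpow_lt_top_iff_of_pos hr0, hx₀'] at hx₀
    exact ⟨radialPot_Ioi_lt_top_of_solution hs hl hq0 hqs hu hω hsol hx₀ 0 one_pos,
      fun R hR => setLIntegral_iSup_embConst_lt_top_of_solution hs hq0 hqs hr0 hβ₀ hu hω hsol hsol'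
        (hur R hR)⟩
  · rintro ⟨⟨hσtail, hκtail⟩, h⟩
    obtain ⟨u, hu, hω, hueq, hur⟩ := exists_solution_setLIntegral_rpow_lt_top hs hq0 hqs hr0 hβ₀ hβ
      hσ hfin hσtail hκtail h
    have hvol : volume.restrict (ball (0 : EuclideanSpace ℝ (Fin n)) 1) ≠ 0 := by
      simpa [Measure.restrict_eq_zero] using (measure_ball_pos volume _ one_pos).ne'
    have : NeZero (volume.restrict (ball (0 : EuclideanSpace ℝ (Fin n)) 1)) := ⟨hvol⟩
    have hupos : ∀ x, 0 < u x := fun x => (wolff_pos hs hl hω x).trans_eq (hueq x).symm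
    refine ⟨u, ⟨hu, fun x R _ => ?_, .of_forall hueq, .of_forall hueq⟩, fun h0 => ?_,
      fun R _ => hur R⟩
    · obtain ⟨x₀, hx₀⟩ := (ae_lt_top (hu.pow_const r) (hur 1).ne).exists
      rw [ENNReal.rpow_lt_top_iff_of_pos hr0, hueq x₀] at hx₀
      rw [← withDensity_apply _ measurableSet_ball]
      exact (measure_mono (ball_subset_ball' le_rfl)).trans_lt
        (measure_ball_lt_top_of_wolff_lt_top hs hl hx₀ (R + dist x x₀))
    · obtain ⟨x, hx⟩ := (ae_restrict_of_ae (s := ball 0 1) h0).exists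
      exact (hupos x).ne' hx
end

section
/- Let n ≥ 1, 1 < p < ∞, 0 < q < p−1, 0 < α < n/p, and r ≥ n(p−1)/(n−αp). There exists a constant C = C(α,p,q,r,n) > 0 such that for every locally finite nonnegative Borel measure σ on ℝⁿ and every R > 0, ∫_{{x : |x| ≥ 3R}} ( ∫₀^∞ ( σ(B(x,ρ) ∩ B(0,2R)) / ρ^{n−αp} )^{1/(p−1−q)} dρ/ρ )^{r} dx ≤ C · σ(B(0,2R))^{r/(p−1−q)} · R^{n − (n−αp)r/(p−1−q)}; in particular, this integral is finite whenever σ(B(0,2R)) < ∞. -/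
open MeasureTheory Metric Set
open scoped ENNReal NNReal

/-- The mass of a power tail: `∫_c^∞ ρ^{-γ-1} dρ = c^{-γ}/γ`. -/
lemma lintegral_Ioi_rpow_neg_sub_one {γ c : ℝ} (hγ : 0 < γ) (hc : 0 < c) :
    ∫⁻ ρ in Ioi c, ENNReal.ofReal (ρ ^ (-γ - 1)) = ENNReal.ofReal (c ^ (-γ) / γ) := by
  have hlt : -γ - 1 < -1 := by linarith
  rw [← ofReal_integral_eq_lintegral_ofReal (integrableOn_Ioi_rpow_of_lt hlt hc),
    integral_Ioi_rpow_of_lt hlt hc]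
  · congr 1
    rw [show -γ - 1 + 1 = -γ by ring, neg_div_neg_eq]
  · filter_upwards [ae_restrict_mem measurableSet_Ioi] with ρ hρ
    exact Real.rpow_nonneg (hc.trans hρ).le _

lemma ENNReal.div_ofReal_rpow_rpow_div (m : ℝ≥0∞) {a s ρ : ℝ} (hs : 0 ≤ s) (hρ : 0 < ρ) :
    (m / ENNReal.ofReal (ρ ^ a)) ^ s / ENNReal.ofReal ρ =
      m ^ s * ENNReal.ofReal (ρ ^ (-(a * s) - 1)) := by
  have ha : 0 < ρ ^ a := Real.rpow_pos_of_pos hρ a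
  rw [ENNReal.div_rpow_of_nonneg _ _ hs, ENNReal.ofReal_rpow_of_pos ha, ← Real.rpow_mul hρ.le,
    div_eq_mul_inv, div_eq_mul_inv, mul_assoc,
    ← ENNReal.ofReal_inv_of_pos (Real.rpow_pos_of_pos hρ _), ← ENNReal.ofReal_inv_of_pos hρ,
    ← ENNReal.ofReal_mul (by positivity), Real.rpow_sub_one hρ.ne', Real.rpow_neg hρ.le,
    div_eq_mul_inv]

/-- A Wolff-type integral of a measure restricted to a ball, evaluated far from that ball. -/
lemma lintegral_ball_inter_ball_le {E : Type*} [NormedAddCommGroup E] [MeasurableSpace E]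
    (σ : Measure E) {a s R : ℝ} (ha : 0 < a) (hs : 0 < s) (hR : 0 < R) {x : E}
    (hx : 3 * R ≤ ‖x‖) :
    ∫⁻ ρ in Ioi (0 : ℝ), (σ (ball x ρ ∩ ball 0 (2 * R)) / ENNReal.ofReal (ρ ^ a)) ^ s /
        ENNReal.ofReal ρ ≤
      σ (ball 0 (2 * R)) ^ s * ENNReal.ofReal ((‖x‖ / 3) ^ (-(a * s)) / (a * s)) := by
  have hc : 0 < ‖x‖ / 3 := by linarith
  have hle : ∀ ρ ∈ Ioi (0 : ℝ), (σ (ball x ρ ∩ ball 0 (2 * R)) / ENNReal.ofReal (ρ ^ a)) ^ s /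
      ENNReal.ofReal ρ ≤ (Ioi (‖x‖ / 3)).indicator
        (fun ρ => σ (ball 0 (2 * R)) ^ s * ENNReal.ofReal (ρ ^ (-(a * s) - 1))) ρ := by
    intro ρ hρ
    rw [ENNReal.div_ofReal_rpow_rpow_div _ hs.le hρ]
    by_cases h : ρ ∈ Ioi (‖x‖ / 3)
    · rw [indicator_of_mem h]
      gcongr
      exact inter_subset_right
    · have hρx : ρ ≤ ‖x‖ / 3 := not_lt.1 h
      have hdisj : Disjoint (ball x ρ) (ball 0 (2 * R)) :=
        ball_disjoint_ball (by rw [dist_zero_right]; linarith)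
      rw [hdisj.inter_eq, measure_empty, ENNReal.zero_rpow_of_pos hs, zero_mul]
      exact zero_le
  calc _ ≤ _ := setLIntegral_mono ((by fun_prop : Measurable _).indicator measurableSet_Ioi) hle
    _ ≤ _ := setLIntegral_le_lintegral _ _
    _ = _ := by
      rw [lintegral_indicator measurableSet_Ioi, lintegral_const_mul _ (by fun_prop),
        lintegral_Ioi_rpow_neg_sub_one (mul_pos ha hs) hc]

lemma lintegral_one_add_norm_inv_smul {n : ℕ} {β R : ℝ} (hR : 0 < R) :
    ∫⁻ x : EuclideanSpace ℝ (Fin n), ENNReal.ofReal ((1 + ‖R⁻¹ • x‖) ^ (-β)) =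
      ENNReal.ofReal (R ^ (n : ℝ)) *
        ∫⁻ x : EuclideanSpace ℝ (Fin n), ENNReal.ofReal ((1 + ‖x‖) ^ (-β)) := by
  rw [← lintegral_map (f := fun y : EuclideanSpace ℝ (Fin n) =>
      ENNReal.ofReal ((1 + ‖y‖) ^ (-β))) (by fun_prop) (measurable_const_smul R⁻¹),
    Measure.map_addHaar_smul _ (inv_ne_zero hR.ne'), lintegral_smul_measure,
    finrank_euclideanSpace_fin, inv_pow, inv_inv, abs_of_pos (by positivity), Real.rpow_natCast,
    smul_eq_mul]

/-- For `r ≥ n(p−1)/(n−αp)` there is `C = C(α,p,q,r,n) > 0` such that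
`∫_{|x|≥3R} (∫₀^∞ (σ(B(x,ρ)∩B(0,2R))/ρ^{n−αp})^{1/(p−1−q)} dρ/ρ)^r dx
 ≤ C σ(B(0,2R))^{r/(p−1−q)} R^{n−(n−αp)r/(p−1−q)}`. -/
theorem tail_integral_bound (n : ℕ) (hn : 1 ≤ n) (α p q r : ℝ)
    (hp : 1 < p) (hq0 : 0 < q) (hqp : q < p - 1)
    (hα0 : 0 < α) (hαp : α < n / p)
    (hr : (n : ℝ) * (p - 1) / ((n : ℝ) - α * p) ≤ r) :
    ∃ C : ℝ, 0 < C ∧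
      ∀ σ : Measure (EuclideanSpace ℝ (Fin n)), IsLocallyFiniteMeasure σ →
        ∀ R : ℝ, 0 < R →
          (∫⁻ x in {x : EuclideanSpace ℝ (Fin n) | 3 * R ≤ ‖x‖},
            (∫⁻ ρ in Set.Ioi (0 : ℝ),
              (σ (Metric.ball x ρ ∩ Metric.ball (0 : EuclideanSpace ℝ (Fin n)) (2 * R)) /
                  ENNReal.ofReal (ρ ^ ((n : ℝ) - α * p))) ^ (1 / (p - 1 - q)) /
                ENNReal.ofReal ρ) ^ r) ≤
            ENNReal.ofReal C *
              σ (Metric.ball (0 : EuclideanSpace ℝ (Fin n)) (2 * R)) ^ (r / (p - 1 - q)) *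
              ENNReal.ofReal (R ^ ((n : ℝ) - ((n : ℝ) - α * p) * r / (p - 1 - q))) := by
  have hp0 : 0 < p := by linarith
  have hn0 : (0 : ℝ) < n := by exact_mod_cast hn
  have ha : 0 < (n : ℝ) - α * p := sub_pos.2 ((lt_div_iff₀ hp0).1 hαp)
  have ht : 0 < p - 1 - q := by linarith
  have hr0 : 0 < r := lt_of_lt_of_le (div_pos (mul_pos hn0 (by linarith)) ha) hr
  set a : ℝ := (n : ℝ) - α * p
  have hs : 0 < 1 / (p - 1 - q) := one_div_pos.2 ht
  set s : ℝ := 1 / (p - 1 - q) with hs_def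
  have hγ : 0 < a * s := mul_pos ha hs
  have hβ : (n : ℝ) < a * s * r := by
    rw [div_le_iff₀ ha] at hr
    rw [hs_def, mul_one_div, div_mul_eq_mul_div, lt_div_iff₀ ht]
    nlinarith
  set I : ℝ≥0∞ := ∫⁻ y : EuclideanSpace ℝ (Fin n), ENNReal.ofReal ((1 + ‖y‖) ^ (-(a * s * r)))
  have hI : I ≠ ∞ := (finite_integral_one_add_norm (by simpa using hβ)).ne
  set K : ℝ := 4 ^ (a * s * r) / (a * s) ^ r with hK_def
  have hK : 0 < K := by positivity
  refine ⟨K * (I.toReal + 1), by positivity, fun σ _ R hR => ?_⟩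
  set M := σ (ball 0 (2 * R))
  have hpt : ∀ x ∈ {x : EuclideanSpace ℝ (Fin n) | 3 * R ≤ ‖x‖},
      (∫⁻ ρ in Ioi (0 : ℝ), (σ (ball x ρ ∩ ball 0 (2 * R)) / ENNReal.ofReal (ρ ^ a)) ^ s /
        ENNReal.ofReal ρ) ^ r ≤
      M ^ (r / (p - 1 - q)) * (ENNReal.ofReal (K * R ^ (-(a * s * r))) *
        ENNReal.ofReal ((1 + ‖R⁻¹ • x‖) ^ (-(a * s * r)))) := by
    intro x hx
    have hx' : 3 * R ≤ ‖x‖ := hx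
    have hc : 0 < ‖x‖ / 3 := by linarith
    refine (ENNReal.rpow_le_rpow (lintegral_ball_inter_ball_le σ ha hs hR hx) hr0.le).trans ?_
    rw [ENNReal.mul_rpow_of_nonneg _ _ hr0.le, ← ENNReal.rpow_mul,
      ENNReal.ofReal_rpow_of_pos (by positivity), ← ENNReal.ofReal_mul (by positivity),
      show s * r = r / (p - 1 - q) by rw [hs_def]; ring]
    gcongr
    have hle : R / 4 * (1 + ‖R⁻¹ • x‖) ≤ ‖x‖ / 3 := by
      rw [norm_smul, norm_inv, Real.norm_of_nonneg hR.le, mul_add, ← mul_assoc,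
        show R / 4 * R⁻¹ = 1 / 4 by field_simp]
      linarith
    rw [Real.div_rpow (by positivity) hγ.le, ← Real.rpow_mul hc.le, neg_mul]
    calc (‖x‖ / 3) ^ (-(a * s * r)) / (a * s) ^ r
        ≤ (R / 4 * (1 + ‖R⁻¹ • x‖)) ^ (-(a * s * r)) / (a * s) ^ r := by
          gcongr ?_ / _
          exact Real.rpow_le_rpow_of_nonpos (by positivity) hle (by linarith)
      _ = K * R ^ (-(a * s * r)) * (1 + ‖R⁻¹ • x‖) ^ (-(a * s * r)) := by
          rw [Real.mul_rpow (by positivity) (by positivity), Real.div_rpow hR.le (by norm_num),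
            Real.rpow_neg (by norm_num : (0 : ℝ) ≤ 4), hK_def, div_inv_eq_mul]
          ring
  calc _ ≤ _ := setLIntegral_mono (by fun_prop) hpt
    _ ≤ _ := setLIntegral_le_lintegral _ _
    _ = M ^ (r / (p - 1 - q)) * (ENNReal.ofReal (K * R ^ (-(a * s * r))) *
          (ENNReal.ofReal (R ^ (n : ℝ)) * I)) := by
        rw [lintegral_const_mul _ (by fun_prop), lintegral_const_mul _ (by fun_prop),
          lintegral_one_add_norm_inv_smul hR]
    _ ≤ M ^ (r / (p - 1 - q)) * (ENNReal.ofReal (K * R ^ (-(a * s * r))) *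
          (ENNReal.ofReal (R ^ (n : ℝ)) * ENNReal.ofReal (I.toReal + 1))) := by
        gcongr
        rw [← ENNReal.ofReal_toReal hI]
        exact ENNReal.ofReal_le_ofReal (by simp)
    _ = _ := by
        rw [mul_comm (ENNReal.ofReal (K * (I.toReal + 1))), mul_assoc (M ^ _),
          ← ENNReal.ofReal_mul (by positivity), ← ENNReal.ofReal_mul (by positivity),
          ← ENNReal.ofReal_mul (by positivity),
          show (n : ℝ) - a * r / (p - 1 - q) = -(a * s * r) + n by rw [hs_def]; ring,
          Real.rpow_add hR]
        congr 2
        ring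
end

section
/- Let n ≥ 1, 1 < p < ∞, 0 < q < p−1, 0 < α < n/p, x ∈ ℝⁿ, R > 0, and let σ be a locally finite nonnegative Borel measure on ℝⁿ. Write σ' = σ|_{ℝⁿ∖B(x,2R)}. Then for every y ∈ B(x,R): (a) W_{α,p}σ'(y) ≤ ∫_R^∞ ( σ(B(x,2ρ)) / ρ^{n−αp} )^{1/(p−1)} dρ/ρ; and (b) K_{α,p,q}σ'(y) ≤ ∫_R^∞ ( κ(B(x,2ρ))^{q(p−1)/(p−1−q)} / ρ^{n−αp} )^{1/(p−1)} dρ/ρ, where in (b) the intrinsic potential K_{α,p,q}σ' is defined using the embedding constants of σ' while κ on the right-hand side is the embedding constant of the full measure σ. -/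
open MeasureTheory Metric Set
open scoped ENNReal NNReal

theorem embC_mono {n : ℕ} {α p q : ℝ} (hq : 0 ≤ q)
    {μ σ : Measure (EuclideanSpace ℝ (Fin n))} {E F : Set (EuclideanSpace ℝ (Fin n))}
    (h : μ.restrict E ≤ σ.restrict F) : embC n α p q μ E ≤ embC n α p q σ F :=
  sInf_le_sInf fun _ hκ ν hν =>
    (ENNReal.rpow_le_rpow (lintegral_mono' h le_rfl) (one_div_nonneg.2 hq)).trans (hκ ν hν)

theorem embC_eq_zero {n : ℕ} {α p q : ℝ} (hq : 0 < q)
    {μ : Measure (EuclideanSpace ℝ (Fin n))} {E : Set (EuclideanSpace ℝ (Fin n))}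
    (h : μ.restrict E = 0) : embC n α p q μ E = 0 := by
  refine le_antisymm (sInf_le fun ν _ => ?_) bot_le
  simp [h, ENNReal.zero_rpow_of_pos (inv_pos.2 hq)]

theorem setLIntegral_Ioi_le_of_eq_zero {F G : ℝ → ℝ≥0∞} {a b : ℝ}
    (hF : ∀ ρ ≤ b, F ρ = 0) (hFG : ∀ ρ, b < ρ → F ρ ≤ G ρ) :
    ∫⁻ ρ in Ioi a, F ρ ≤ ∫⁻ ρ in Ioi b, G ρ := by
  rw [← lintegral_indicator measurableSet_Ioi G]
  refine (setLIntegral_le_lintegral _ _).trans (lintegral_mono fun ρ => ?_)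
  by_cases h : b < ρ
  · simpa [h] using hFG ρ h
  · simp [hF ρ (not_lt.1 h)]

/-- Tail bounds for the Wolff and intrinsic potentials of the restricted measure
`σ' = σ|_{ℝⁿ∖B(x,2R)}`, valid for every `y ∈ B(x,R)`. In (b), the intrinsic
potential of `σ'` is defined via the embedding constants of `σ'`, while the
right-hand side uses the embedding constants of the full measure `σ`. -/
theorem restricted_potentials_tail_bounds (n : ℕ) (hn : 1 ≤ n) (α p q : ℝ)
    (hp : 1 < p) (hq0 : 0 < q) (hqp : q < p - 1)
    (hα0 : 0 < α) (hαp : α < n / p)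
    (x : EuclideanSpace ℝ (Fin n)) (R : ℝ) (hR : 0 < R)
    (σ : Measure (EuclideanSpace ℝ (Fin n))) (hσloc : IsLocallyFiniteMeasure σ)
    (y : EuclideanSpace ℝ (Fin n)) (hy : y ∈ Metric.ball x R) :
    wolffPot n α p (σ.restrict (Metric.ball x (2 * R))ᶜ) y ≤
        (∫⁻ ρ in Set.Ioi R,
          (σ (Metric.ball x (2 * ρ)) / ENNReal.ofReal (ρ ^ ((n : ℝ) - α * p))) ^
              (1 / (p - 1)) / ENNReal.ofReal ρ) ∧
      intK n α p q (σ.restrict (Metric.ball x (2 * R))ᶜ) y ≤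
        (∫⁻ ρ in Set.Ioi R,
          (embC n α p q σ (Metric.ball x (2 * ρ)) ^ (q * (p - 1) / (p - 1 - q)) /
              ENNReal.ofReal (ρ ^ ((n : ℝ) - α * p))) ^ (1 / (p - 1)) /
            ENNReal.ofReal ρ) := by
  have hp1 : 0 < p - 1 := sub_pos.2 hp
  have hs : 0 < 1 / (p - 1) := one_div_pos.2 hp1
  have hr : 0 < q * (p - 1) / (p - 1 - q) := div_pos (mul_pos hq0 hp1) (sub_pos.2 hqp)
  have hyx : dist y x < R := hy
  have hnull : ∀ ρ ≤ R,
      (σ.restrict (ball x (2 * R))ᶜ).restrict (ball y ρ) = 0 := fun ρ hρ => by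
    have hsub : ball y ρ ⊆ ball x (2 * R) := ball_subset_ball' (by linarith)
    rw [Measure.restrict_restrict measurableSet_ball,
      (disjoint_compl_right_iff_subset.2 hsub).inter_eq, Measure.restrict_empty]
  have hsub : ∀ ρ, R < ρ → ball y ρ ⊆ ball x (2 * ρ) := fun ρ hρ =>
    ball_subset_ball' (by linarith)
  constructor
  · refine setLIntegral_Ioi_le_of_eq_zero (fun ρ hρ => ?_) fun ρ hρ => ?_
    · rw [Measure.restrict_eq_zero.1 (hnull ρ hρ), ENNReal.zero_div,
        ENNReal.zero_rpow_of_pos hs, ENNReal.zero_div]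
    · have hle : σ.restrict (ball x (2 * R))ᶜ (ball y ρ) ≤ σ (ball x (2 * ρ)) :=
        (Measure.restrict_le_self _).trans (measure_mono (hsub ρ hρ))
      gcongr
  · refine setLIntegral_Ioi_le_of_eq_zero (fun ρ hρ => ?_) fun ρ hρ => ?_
    · rw [embC_eq_zero hq0 (hnull ρ hρ), ENNReal.zero_rpow_of_pos hr, ENNReal.zero_div,
        ENNReal.zero_rpow_of_pos hs, ENNReal.zero_div]
    · have hle : embC n α p q (σ.restrict (ball x (2 * R))ᶜ) (ball y ρ) ≤
          embC n α p q σ (ball x (2 * ρ)) :=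
        embC_mono hq0.le (Measure.restrict_mono (hsub ρ hρ) Measure.restrict_le_self)
      gcongr
end
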